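/- Let A be a commutative Noetherian Cohen-Macaulay local ring of Krull dimension one and let R = A[x_1,...,x_n] be a polynomial ring over A. Then for every ideal I of R, every integer i ≥ 0, every prime ideal P of R, and every integer j ≥ 0, the Bass number μ_j(P, H^i_I(R)) is finite. -/

import Mathlib

/-!
STATEMENT 10: Let `A` be a commutative Noetherian Cohen-Macaulay local ring of Krull
dimension one and let `R = A[x_1,...,x_n]` be a polynomial ring over `A`.  Then for every
ideal `I` of `R`, every `i ≥ 0`, every prime ideal `P` of `R` and every `j ≥ 0`, the Bass
number `μ_j(P, H^i_I(R))` is finite.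
-/

universe u

open CategoryTheory

/-- A Noetherian local ring is Cohen-Macaulay if its depth equals its Krull dimension,
equivalently (for a Noetherian local ring) if there is a regular sequence contained in the
maximal ideal whose length is the Krull dimension. -/
def IsCohenMacaulayLocalRing (R : Type u) [CommRing R] [IsLocalRing R] : Prop :=
  ∃ rs : List R, (∀ r ∈ rs, r ∈ IsLocalRing.maximalIdeal R) ∧
    RingTheory.Sequence.IsRegular R rs ∧ (rs.length : WithBot ℕ∞) = ringKrullDim R

/-- The Ext module `Ext^j_{R_P}(κ(P), M_P)` whose `κ(P)`-dimension is the `j`-th Bass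
number `μ_j(P, M)` of the `R`-module `M` with respect to the prime ideal `P`. -/
noncomputable def bassExtModule (R : Type u) [CommRing R] (P : Ideal R) [P.IsPrime] (j : ℕ)
    (M : ModuleCat.{u} R) : ModuleCat.{u} (Localization.AtPrime P) :=
  ((Ext (Localization.AtPrime P) (ModuleCat.{u} (Localization.AtPrime P)) j).obj
    (Opposite.op (ModuleCat.of _ (IsLocalRing.ResidueField (Localization.AtPrime P))))).obj
    (ModuleCat.of _ (LocalizedModule P.primeCompl M))

namespace BassCech
set_option autoImplicit false
section bridge
variable {R : Type u} [CommRing R]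

lemma exists_cycle (K : CochainComplex (ModuleCat.{u} R) ℕ) (n : ℕ) (x : K.X n)
    (hx : (K.d n (n+1)).hom x = 0) : ∃ z : K.cycles n, (K.iCycles n).hom z = x := by
  refine ⟨K.cyclesMk x (n+1) (by simp) hx, ?_⟩
  exact K.i_cyclesMk x (n+1) (by simp) hx

lemma iCycles_inj (K : CochainComplex (ModuleCat.{u} R) ℕ) (n : ℕ) :
    Function.Injective (K.iCycles n).hom :=
  (ModuleCat.mono_iff_injective _).1 inferInstance

lemma homologyπ_surj (K : CochainComplex (ModuleCat.{u} R) ℕ) (n : ℕ) :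
    Function.Surjective (K.homologyπ n).hom :=
  (ModuleCat.epi_iff_surjective _).1 inferInstance

lemma homologyπ_eq_zero_iff (K : CochainComplex (ModuleCat.{u} R) ℕ) (n : ℕ) (z : K.cycles n) :
    (K.homologyπ n).hom z = 0 ↔
      ∃ y : K.X ((ComplexShape.up ℕ).prev n),
        (K.d ((ComplexShape.up ℕ).prev n) n).hom y = (K.iCycles n).hom z := by
  have h := ShortComplex.exact_of_g_is_cokernel
    (ShortComplex.mk (K.toCycles ((ComplexShape.up ℕ).prev n) n) (K.homologyπ n) (by simp))
    (K.homologyIsCokernel _ n rfl)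
  rw [ShortComplex.moduleCat_exact_iff] at h
  have key : ∀ y, (K.iCycles n).hom ((K.toCycles ((ComplexShape.up ℕ).prev n) n).hom y) =
      (K.d ((ComplexShape.up ℕ).prev n) n).hom y := by
    intro y
    have := K.toCycles_i ((ComplexShape.up ℕ).prev n) n
    rw [← this]; rfl
  constructor
  · intro hz
    obtain ⟨y, hy⟩ := h z hz
    refine ⟨y, ?_⟩
    rw [← hy]
    exact (key y).symm
  · rintro ⟨y, hy⟩
    have : (K.toCycles ((ComplexShape.up ℕ).prev n) n).hom y = z := by
      apply iCycles_inj
      rw [key, hy]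
    rw [← this]
    have h2 := K.toCycles_comp_homologyπ ((ComplexShape.up ℕ).prev n) n
    exact LinearMap.congr_fun (congrArg ModuleCat.Hom.hom h2) y

variable {X Y : ModuleCat.{u} R} (P : ProjectiveResolution X) (n : ℕ)

/-- The inclusion of cocycles into the module of morphisms. -/
noncomputable def ic : (P.complex.linearYonedaObj R Y).cycles n →ₗ[R] (P.complex.X n ⟶ Y) :=
  ((P.complex.linearYonedaObj R Y).iCycles n).hom

lemma ic_cocycle (z : (P.complex.linearYonedaObj R Y).cycles n) :
    P.complex.d (n+1) n ≫ ic P n z = 0 := by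
  have h := (P.complex.linearYonedaObj R Y).iCycles_d n (n+1)
  exact LinearMap.congr_fun (congrArg ModuleCat.Hom.hom h) z

/-- Cocycles of the Hom complex give elements of the (new) Ext. -/
noncomputable def cyc : (P.complex.linearYonedaObj R Y).cycles n →ₗ[R] Abelian.Ext X Y n where
  toFun z := P.extMk (ic P n z) (n+1) rfl (ic_cocycle P n z)
  map_add' a b := by
    rw [P.add_extMk]
    congr 1
    exact map_add _ _ _
  map_smul' r a := by
    rw [Abelian.Ext.smul_eq_comp_mk₀, RingHom.id_apply, P.extMk_comp_mk₀]
    congr 1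
    rw [Linear.comp_smul, Category.comp_id]
    exact map_smul _ _ _

lemma cyc_surj : Function.Surjective (cyc (Y := Y) P n) := by
  intro α
  obtain ⟨f, hf, rfl⟩ := P.extMk_surjective α (n+1) rfl
  obtain ⟨z, hz⟩ := exists_cycle (P.complex.linearYonedaObj R Y) n f hf
  refine ⟨z, ?_⟩
  have hz' : ic P n z = f := hz
  simp only [cyc, LinearMap.coe_mk, AddHom.coe_mk]
  congr 1

open CochainComplex HomComplex in
lemma extMk_zero_deg (f : P.complex.X 0 ⟶ Y) (hf : P.complex.d 1 0 ≫ f = 0)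
    (h : P.extMk f 1 rfl hf = 0) : f = 0 := by
  simp only [← P.extEquivCohomologyClass.apply_eq_iff_eq,
    ProjectiveResolution.extEquivCohomologyClass_extMk,
    ProjectiveResolution.extEquivCohomologyClass_zero,
    CohomologyClass.mk_eq_zero_iff] at h
  rw [Cocycle.toSingleMk_mem_coboundaries_iff _ _ _ _ _ 1 (by simp)] at h
  obtain ⟨g, hg⟩ := h
  have hz : Limits.IsZero (P.cochainComplex.X 1) := by
    exact P.cochainComplex.isZero_of_isStrictlyLE 0 1 (by simp)
  rw [hz.eq_of_src g 0, Limits.comp_zero] at hg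
  rw [← cancel_epi (P.cochainComplexXIso (-(0:ℕ)) 0 rfl).hom, Limits.comp_zero]
  exact hg.symm

lemma cyc_ker (z : (P.complex.linearYonedaObj R Y).cycles n) :
    cyc P n z = 0 ↔ ((P.complex.linearYonedaObj R Y).homologyπ n).hom z = 0 := by
  rw [homologyπ_eq_zero_iff]
  cases n with
  | zero =>
    have h0 : ∀ y, ((P.complex.linearYonedaObj R Y).d ((ComplexShape.up ℕ).prev 0) 0).hom y = 0 := by
      intro y
      rw [(P.complex.linearYonedaObj R Y).shape _ _ (by simp)]; rfl
    constructor
    · intro h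
      refine ⟨0, ?_⟩
      rw [h0]
      exact (extMk_zero_deg P (ic P 0 z) (ic_cocycle P 0 z) h).symm
    · rintro ⟨y, hy⟩
      rw [h0] at hy
      have : z = 0 := by apply iCycles_inj; rw [← hy]; exact (map_zero _).symm
      rw [this, map_zero]
  | succ n =>
    have : (ComplexShape.up ℕ).prev (n+1) = n := by simp
    rw [this]
    exact P.extMk_eq_zero_iff (ic P (n+1) z) _ rfl (ic_cocycle P _ z) n rfl

/-- Homology of the Hom complex versus new Ext. -/
noncomputable def homEquiv : (P.complex.linearYonedaObj R Y).homology n ≃ₗ[R] Abelian.Ext X Y n :=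
  LinearEquiv.symm ((LinearMap.quotKerEquivOfSurjective _ (cyc_surj (Y := Y) P n)).symm.trans
   ((Submodule.quotEquivOfEq _ _ (by ext z; exact cyc_ker P n z)).trans
   (LinearMap.quotKerEquivOfSurjective _ (homologyπ_surj _ n))))

lemma homEquiv_π (z : (P.complex.linearYonedaObj R Y).cycles n) :
    homEquiv P n (((P.complex.linearYonedaObj R Y).homologyπ n).hom z) = cyc P n z := by
  rw [homEquiv, ← LinearEquiv.eq_symm_apply, LinearEquiv.symm_symm]
  have : (LinearMap.quotKerEquivOfSurjective _ (cyc_surj (Y := Y) P n)).symm (cyc P n z) =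
     Submodule.Quotient.mk z := by
    rw [LinearEquiv.symm_apply_eq]; rfl
  simp only [LinearEquiv.trans_apply]
  rw [this]; rfl

/-- The old Ext is linearly equivalent to the new one. -/
noncomputable def oldNew : ((_root_.Ext R (ModuleCat.{u} R) n).obj (Opposite.op X)).obj Y
    ≃ₗ[R] Abelian.Ext X Y n :=
  (P.isoExt (R := R) n Y).toLinearEquiv.trans (homEquiv P n)

variable {X' : ModuleCat.{u} R} (P' : ProjectiveResolution X') (g : X' ⟶ X)

/-- Pull-back of cochains along a morphism of resolutions. -/
noncomputable def pullK (φ : P'.complex ⟶ P.complex) :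
    P.complex.linearYonedaObj R Y ⟶ P'.complex.linearYonedaObj R Y :=
  (HomologicalComplex.unopFunctor _ _).map
    ((((linearYoneda R (ModuleCat.{u} R)).obj Y).rightOp.mapHomologicalComplex _).map φ).op

lemma abs_nat {D : Type*} [Category D] {L' L H' H : Dᵒᵖ} {K' K : D} (lg : L' ⟶ L) (i' : L' ≅ H')
    (i : L ≅ H) (m : H' ⟶ H) (o' : H' ≅ Opposite.op K') (o : H ≅ Opposite.op K) (k : K ⟶ K')
    (h1 : i'.inv ≫ lg = m ≫ i.inv) (h2 : m ≫ o.hom = o'.hom ≫ k.op) :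
    lg.unop ≫ (i'.unop.symm ≪≫ o'.unop.symm).hom = (i.unop.symm ≪≫ o.unop.symm).hom ≫ k := by
  apply Quiver.Hom.op_inj
  have h3 : o'.inv ≫ m = k.op ≫ o.inv := by
    rw [Iso.inv_comp_eq, ← Category.assoc, ← h2, Category.assoc, Iso.hom_inv_id, Category.comp_id]
  simp [h1, reassoc_of% h3]

lemma isoExt_nat (φ : P'.complex ⟶ P.complex) (comm : φ.f 0 ≫ P.π.f 0 = P'.π.f 0 ≫ g) :
    ((_root_.Ext R (ModuleCat.{u} R) n).map g.op).app Y ≫ (P'.isoExt (R := R) n Y).hom =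
      (P.isoExt (R := R) n Y).hom ≫ HomologicalComplex.homologyMap (pullK P P' φ) n := by
  have h1 := ProjectiveResolution.isoLeftDerivedObj_inv_naturality g P' P φ comm
    ((linearYoneda R (ModuleCat.{u} R)).obj Y).rightOp n
  have h2 := HomologicalComplex.homologyOp_hom_naturality (pullK (Y := Y) P P' φ) n
  exact abs_nat _ (P'.isoLeftDerivedObj ((linearYoneda R (ModuleCat.{u} R)).obj Y).rightOp n)
    (P.isoLeftDerivedObj ((linearYoneda R (ModuleCat.{u} R)).obj Y).rightOp n) _
    ((P'.complex.linearYonedaObj R Y).homologyOp n) ((P.complex.linearYonedaObj R Y).homologyOp n)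
    (HomologicalComplex.homologyMap (pullK P P' φ) n) h1 h2

lemma oldNew_nat (φ : ProjectiveResolution.Hom P' P g)
    (a : ((_root_.Ext R (ModuleCat.{u} R) n).obj (Opposite.op X)).obj Y) :
    oldNew P' n ((((_root_.Ext R (ModuleCat.{u} R) n).map g.op).app Y).hom a) =
      (Abelian.Ext.mk₀ g).comp (oldNew P n a) (zero_add _) := by
  have h := isoExt_nat (Y := Y) P n P' g φ.hom (by simpa using φ.hom_f_zero_comp_π_f_zero)
  have h' : (P'.isoExt (R := R) n Y).hom.hom
      ((((_root_.Ext R (ModuleCat.{u} R) n).map g.op).app Y).hom a) =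
      (HomologicalComplex.homologyMap (pullK P P' φ.hom) n).hom ((P.isoExt (R := R) n Y).hom.hom a) :=
    LinearMap.congr_fun (congrArg ModuleCat.Hom.hom h) a
  change homEquiv P' n ((P'.isoExt (R := R) n Y).hom.hom _) =
    (Abelian.Ext.mk₀ g).comp (homEquiv P n ((P.isoExt (R := R) n Y).hom.hom a)) _
  rw [h']
  obtain ⟨z, hz⟩ := homologyπ_surj _ n ((P.isoExt (R := R) n Y).hom.hom a)
  rw [← hz]
  have h3 := HomologicalComplex.homologyπ_naturality (pullK (Y := Y) P P' φ.hom) n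
  have h4 : (HomologicalComplex.homologyMap (pullK P P' φ.hom) n).hom
     (((P.complex.linearYonedaObj R Y).homologyπ n).hom z) =
     ((P'.complex.linearYonedaObj R Y).homologyπ n).hom
      ((HomologicalComplex.cyclesMap (pullK P P' φ.hom) n).hom z) :=
    LinearMap.congr_fun (congrArg ModuleCat.Hom.hom h3) z
  rw [h4, homEquiv_π, homEquiv_π]
  simp only [cyc, LinearMap.coe_mk, AddHom.coe_mk]
  rw [ProjectiveResolution.mk₀_comp_extMk _ _ _ _ φ]
  congr 1
  have h5 := HomologicalComplex.cyclesMap_i (pullK (Y := Y) P P' φ.hom) n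
  exact LinearMap.congr_fun (congrArg ModuleCat.Hom.hom h5) z

end bridge
end BassCech

namespace BassCech
set_option autoImplicit false
section good
variable {Q : Type u} [CommRing Q] (κ : ModuleCat.{u} Q)

/-- All Ext modules from `κ` are Noetherian. -/
def Good (N : Type u) [AddCommGroup N] [Module Q N] : Prop :=
  ∀ j, IsNoetherian Q (Abelian.Ext κ (ModuleCat.of Q N) j)

variable {N N₁ N₂ N₃ : Type u} [AddCommGroup N] [Module Q N] [AddCommGroup N₁] [Module Q N₁]
  [AddCommGroup N₂] [Module Q N₂] [AddCommGroup N₃] [Module Q N₃]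

/-- Functoriality of Ext in the second variable. -/
noncomputable def em (f : N₁ →ₗ[Q] N₂) (j : ℕ) : Abelian.Ext κ (ModuleCat.of Q N₁) j →ₗ[Q]
    Abelian.Ext κ (ModuleCat.of Q N₂) j :=
  (Abelian.Ext.mk₀ (ModuleCat.ofHom f)).postcompOfLinear Q κ (add_zero j)

lemma em_apply (f : N₁ →ₗ[Q] N₂) (j : ℕ) (x) :
    em κ f j x = x.comp (Abelian.Ext.mk₀ (ModuleCat.ofHom f)) (add_zero j) := rfl

lemma em_comp (f : N₁ →ₗ[Q] N₂) (g : N₂ →ₗ[Q] N₃) (j : ℕ) (x) :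
    em κ g j (em κ f j x) = em κ (g ∘ₗ f) j x := by
  simp only [em_apply]
  rw [Abelian.Ext.comp_assoc_of_third_deg_zero, Abelian.Ext.mk₀_comp_mk₀]
  rfl

lemma em_id (j : ℕ) (x) : em κ (LinearMap.id (R := Q) (M := N)) j x = x := by
  simp only [em_apply]
  exact Abelian.Ext.comp_mk₀_id _

lemma em_zero (j : ℕ) (x) : em κ (0 : N₁ →ₗ[Q] N₂) j x = 0 := by
  simp only [em_apply]
  have : ModuleCat.ofHom (0 : N₁ →ₗ[Q] N₂) = 0 := rfl
  rw [this, Abelian.Ext.mk₀_zero, Abelian.Ext.comp_zero]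

lemma em_smul (f : Q) (hf : ∀ x : κ, f • x = 0) (j : ℕ) (x) :
    em κ (f • (LinearMap.id (R := Q) (M := N))) j x = 0 := by
  rw [em_apply]
  have h1 : ModuleCat.ofHom (f • (LinearMap.id (R := Q) (M := N))) = f • 𝟙 (ModuleCat.of Q N) := rfl
  rw [h1, Abelian.Ext.mk₀_smul, Abelian.Ext.comp_smul, Abelian.Ext.comp_mk₀_id]
  have h2 : f • 𝟙 κ = 0 := by
    ext x; exact hf x
  have h3 : f • x = (f • Abelian.Ext.mk₀ (𝟙 κ)).comp x (zero_add _) := by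
    rw [Abelian.Ext.smul_comp, Abelian.Ext.mk₀_id_comp]
  rw [h3, ← Abelian.Ext.mk₀_smul, h2, Abelian.Ext.mk₀_zero, Abelian.Ext.zero_comp]

variable {κ} in
lemma Good.of_equiv (e : N₁ ≃ₗ[Q] N₂) (h : Good κ N₁) : Good κ N₂ := by
  intro j
  have := h j
  refine isNoetherian_of_surjective (em κ e.toLinearMap j) ?_
  rw [LinearMap.range_eq_top]
  intro y
  refine ⟨em κ e.symm.toLinearMap j y, ?_⟩
  rw [em_comp]
  have : e.toLinearMap ∘ₗ e.symm.toLinearMap = LinearMap.id := by ext; simp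
  rw [this, em_id]

section ses

lemma em_exact (f : N₁ →ₗ[Q] N₂) (g : N₂ →ₗ[Q] N₃) (hf : Function.Injective f)
    (hg : Function.Surjective g) (h : Function.Exact f g)
    (j : ℕ) : LinearMap.range (em κ f j) = LinearMap.ker (em κ g j) := by
  let S := ModuleCat.shortComplexOfCompEqZero f g h.linearMap_comp_eq_zero
  have hS : S.ShortExact := ModuleCat.shortComplex_shortExact S h hf hg
  apply le_antisymm
  · rintro _ ⟨x, rfl⟩
    rw [LinearMap.mem_ker, em_comp, h.linearMap_comp_eq_zero, em_zero]
  · intro x hx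
    obtain ⟨y, hy⟩ := Abelian.Ext.covariant_sequence_exact₂ κ hS x hx
    exact ⟨y, hy⟩

lemma em_ker_noeth (f : N₁ →ₗ[Q] N₂) (g : N₂ →ₗ[Q] N₃) (hf : Function.Injective f)
    (hg : Function.Surjective g) (h : Function.Exact f g)
    (hG : Good κ N₃) (j : ℕ) : IsNoetherian Q (LinearMap.ker (em κ f j)) := by
  let S := ModuleCat.shortComplexOfCompEqZero f g h.linearMap_comp_eq_zero
  have hS : S.ShortExact := ModuleCat.shortComplex_shortExact S h hf hg
  cases j with
  | zero =>
    have : Mono S.f := hS.mono_f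
    have h1 : LinearMap.ker (em κ f 0) = ⊥ := by
      rw [LinearMap.ker_eq_bot]
      exact Abelian.Ext.postcomp_mk₀_injective_of_mono κ S.f
    rw [h1]
    infer_instance
  | succ j =>
    have h1 : LinearMap.ker (em κ f (j+1)) ≤
       LinearMap.range (hS.extClass.postcompOfLinear Q κ (rfl : j + 1 = j + 1)) := by
      intro x hx
      obtain ⟨y, hy⟩ := Abelian.Ext.covariant_sequence_exact₁ κ hS x hx rfl
      exact ⟨y, hy⟩
    have : IsNoetherian Q (Abelian.Ext κ S.X₃ j) := hG j
    exact isNoetherian_of_le h1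

lemma Good.mid (f : N₁ →ₗ[Q] N₂) (g : N₂ →ₗ[Q] N₃) (hf : Function.Injective f)
    (hg : Function.Surjective g) (h : Function.Exact f g)
    (h1 : Good κ N₁) (h3 : Good κ N₃) : Good κ N₂ := by
  intro j
  have := h1 j
  have := h3 j
  exact isNoetherian_of_range_eq_ker _ _ (em_exact κ f g hf hg h j)
end ses

lemma Good.lemE (f : Q) (hf : ∀ x : κ, f • x = 0) {K C : Type u} [AddCommGroup K] [Module Q K]
    [AddCommGroup C] [Module Q C] (ι : K →ₗ[Q] N) (π : N →ₗ[Q] C) (hι : Function.Injective ι)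
    (hπ : Function.Surjective π) (h1 : ∀ x, f • x = 0 ↔ x ∈ Set.range ι)
    (h2 : ∀ x, π x = 0 ↔ ∃ y, f • y = x)
    (hK : Good κ K) (hC : Good κ C) : Good κ N := by
  intro j
  let φ : N →ₗ[Q] N := f • LinearMap.id
  let a : N →ₗ[Q] LinearMap.range φ := φ.rangeRestrict
  let b : LinearMap.range φ →ₗ[Q] N := (LinearMap.range φ).subtype
  have hab : b ∘ₗ a = f • LinearMap.id := by ext x; rfl
  have e1 := em_exact κ ι a hι φ.surjective_rangeRestrict (by
    intro x
    rw [← h1, ← Subtype.coe_inj]; rfl) j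
  have e2 := em_ker_noeth κ b π (LinearMap.range φ).subtype_injective hπ (by
    intro x
    rw [h2]
    constructor
    · rintro ⟨y, hy⟩; exact ⟨⟨x, y, hy⟩, rfl⟩
    · rintro ⟨⟨_, y, rfl⟩, rfl⟩; exact ⟨y, rfl⟩) hC j
  have hle : ∀ x, em κ a j x ∈ LinearMap.ker (em κ b j) := by
    intro x
    rw [LinearMap.mem_ker, em_comp, hab, em_smul κ f hf]
  have := hK j
  refine isNoetherian_of_range_eq_ker (em κ ι j) ((em κ a j).codRestrict _ hle) ?_
  rw [LinearMap.ker_codRestrict, e1]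

lemma Good.of_subsingleton [Subsingleton N] : Good κ N := by
  intro j
  have : Subsingleton (Abelian.Ext κ (ModuleCat.of Q N) j) := by
    refine ⟨fun x y => ?_⟩
    rw [← em_id κ j x, ← em_id κ j y]
    have : (LinearMap.id (R := Q) (M := N)) = 0 := by ext; exact Subsingleton.elim _ _
    rw [this, em_zero, em_zero]
  infer_instance

lemma Good.of_fg [IsNoetherianRing Q] [Module.Finite Q κ] [Module.Finite Q N] : Good κ N := by
  intro j
  have : Module.Finite Q (Abelian.Ext κ (ModuleCat.of Q N) j) := ModuleCat.finite_ext _ _ _ _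
  exact isNoetherian_of_isNoetherianRing_of_finite _ _

end good

section goodP
variable {R : Type u} [CommRing R] (P : Ideal R) [P.IsPrime]

/-- All Bass numbers are finite (in terms of the new Ext). -/
def GoodP (V : Type u) [AddCommGroup V] [Module R V] : Prop :=
  Good (Q := Localization.AtPrime P)
    (ModuleCat.of _ (IsLocalRing.ResidueField (Localization.AtPrime P)))
    (LocalizedModule P.primeCompl V)

variable {P} {V V₁ V₂ V₃ : Type u} [AddCommGroup V] [Module R V] [AddCommGroup V₁] [Module R V₁]
  [AddCommGroup V₂] [Module R V₂] [AddCommGroup V₃] [Module R V₃]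

lemma GoodP.of_equiv (e : V₁ ≃ₗ[R] V₂) (h : GoodP P V₁) : GoodP P V₂ :=
  Good.of_equiv (IsLocalizedModule.mapEquiv P.primeCompl
    (LocalizedModule.mkLinearMap P.primeCompl V₁) (LocalizedModule.mkLinearMap P.primeCompl V₂)
    (Localization P.primeCompl) e) h

/-- localisation of a linear map -/
noncomputable abbrev lm (P : Ideal R) [P.IsPrime] (f : V₁ →ₗ[R] V₂) :
   LocalizedModule P.primeCompl V₁ →ₗ[Localization.AtPrime P]
     LocalizedModule P.primeCompl V₂ := LocalizedModule.map P.primeCompl f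

lemma GoodP.mid (f : V₁ →ₗ[R] V₂) (g : V₂ →ₗ[R] V₃) (hf : Function.Injective f)
    (hg : Function.Surjective g) (h : Function.Exact f g) (h1 : GoodP P V₁) (h3 : GoodP P V₃) :
    GoodP P V₂ :=
  Good.mid _ (lm P f) (lm P g) (LocalizedModule.map_injective _ f hf)
    (LocalizedModule.map_surjective _ g hg) (LocalizedModule.map_exact _ f g h) h1 h3

lemma GoodP.lemE (f : R) (hf : f ∈ P) {K C : Type u} [AddCommGroup K] [Module R K]
    [AddCommGroup C] [Module R C] (ι : K →ₗ[R] V) (π : V →ₗ[R] C) (hι : Function.Injective ι)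
    (hπ : Function.Surjective π) (h1 : ∀ x, f • x = 0 ↔ x ∈ Set.range ι)
    (h2 : ∀ x, π x = 0 ↔ ∃ y, f • y = x)
    (hK : GoodP P K) (hC : GoodP P C) : GoodP P V := by
  have hl : lm P (f • (LinearMap.id (R := R) (M := V))) =
     (algebraMap R (Localization.AtPrime P) f) • LinearMap.id := by
    ext x
    induction x with | h x s => 
    simp [lm, LocalizedModule.smul'_mk]
  have e1 := LocalizedModule.map_exact P.primeCompl ι (f • (LinearMap.id (R := R) (M := V)))
    (fun x => h1 x)
  have e2 := LocalizedModule.map_exact P.primeCompl (f • (LinearMap.id (R := R) (M := V))) π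
    (fun x => h2 x)
  refine Good.lemE _ (algebraMap R (Localization.AtPrime P) f) ?_ (lm P ι) (lm P π)
    (LocalizedModule.map_injective _ ι hι) (LocalizedModule.map_surjective _ π hπ) ?_ ?_ hK hC
  · intro x
    have : IsLocalRing.residue (Localization.AtPrime P) (algebraMap R _ f) = 0 := by
      rw [IsLocalRing.residue_eq_zero_iff, ← Localization.AtPrime.map_eq_maximalIdeal]
      exact Ideal.mem_map_of_mem _ hf
    have h2 : (algebraMap R (Localization.AtPrime P) f) • x =
       (IsLocalRing.residue (Localization.AtPrime P) (algebraMap R _ f)) *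
        (show IsLocalRing.ResidueField (Localization.AtPrime P) from x) := Algebra.smul_def _ _
    rw [h2, this, zero_mul]
  · intro x
    refine Iff.trans ?_ (e1 x)
    change _ ↔ lm P _ x = 0
    rw [hl]; rfl
  · intro x
    refine (e2 x).trans ?_
    change (∃ y, lm P _ y = x) ↔ _
    rw [hl]; rfl

lemma GoodP.lemE' (f : R) (hf : f ∈ P)
    (hK : GoodP P (LinearMap.ker (LinearMap.lsmul R V f)))
    (hC : GoodP P (V ⧸ (LinearMap.range (LinearMap.lsmul R V f)))) : GoodP P V :=
  GoodP.lemE f hf (Submodule.subtype _) (Submodule.mkQ _) (Submodule.subtype_injective _)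
    (Submodule.mkQ_surjective _) (by intro x; simp) (by intro x; simp) hK hC

lemma GoodP.sub_quot (U : Submodule R V) (h1 : GoodP P U) (h2 : GoodP P (V ⧸ U)) : GoodP P V :=
  GoodP.mid U.subtype U.mkQ U.subtype_injective U.mkQ_surjective (by
    intro x; simp) h1 h2

lemma GoodP.of_torsion (h : ∀ v : V, ∃ w ∉ P, w • v = 0) : GoodP P V := by
  have : Subsingleton (LocalizedModule P.primeCompl V) := by
    rw [LocalizedModule.subsingleton_iff]
    intro v
    obtain ⟨w, hw, hv⟩ := h v
    exact ⟨w, hw, hv⟩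
  exact Good.of_subsingleton _

lemma GoodP.of_fg [IsNoetherianRing R] [Module.Finite (Localization.AtPrime P)
    (LocalizedModule P.primeCompl V)] : GoodP P V := by
  have : IsNoetherianRing (Localization.AtPrime P) :=
    IsLocalization.isNoetherianRing P.primeCompl _ inferInstance
  have : Module.Finite (Localization.AtPrime P) (ModuleCat.of (Localization.AtPrime P) (IsLocalRing.ResidueField (Localization.AtPrime P))) :=
    Module.Finite.of_surjective
      (Algebra.linearMap (Localization.AtPrime P) (IsLocalRing.ResidueField (Localization.AtPrime P)))
      IsLocalRing.residue_surjective
  exact Good.of_fg _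

lemma GoodP.bass {M : ModuleCat.{u} R} (h : GoodP P M) (j : ℕ) :
    Module.Finite (Localization.AtPrime P) (bassExtModule R P j M) := by
  have := h j
  exact Module.Finite.equiv (oldNew (ProjectiveResolution.of _) j).symm
end goodP
end BassCech

namespace BassCech
set_option autoImplicit false
section cech
set_option linter.unusedSectionVars false
variable {R : Type u} [CommRing R]

/-- Localization of a module at one element. -/
abbrev Loc (f : R) (M : ModuleCat.{u} R) : ModuleCat.{u} R :=
  ModuleCat.of R (LocalizedModule (Submonoid.powers f) M)

/-- The canonical map. -/
noncomputable abbrev rho (f : R) (M : ModuleCat.{u} R) : M →ₗ[R] Loc f M :=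
  LocalizedModule.mkLinearMap (Submonoid.powers f) M

/-- Functoriality of localization. -/
noncomputable def Lmap (f : R) {M N : ModuleCat.{u} R} (φ : M →ₗ[R] N) : Loc f M →ₗ[R] Loc f N :=
  IsLocalizedModule.map (Submonoid.powers f) (rho f M) (rho f N) φ

lemma Lmap_rho (f : R) {M N : ModuleCat.{u} R} (φ : M →ₗ[R] N) (x : M) :
    Lmap f φ (rho f M x) = rho f N (φ x) :=
  IsLocalizedModule.map_apply _ _ _ _ _

lemma Lmap_comp (f : R) {M N O : ModuleCat.{u} R} (φ : M →ₗ[R] N) (ψ : N →ₗ[R] O) (x : Loc f M) :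
    Lmap f ψ (Lmap f φ x) = Lmap f (ψ ∘ₗ φ) x := by
  rw [Lmap, Lmap, Lmap, IsLocalizedModule.map_comp' _ _ (rho f N)]
  rfl

lemma Lmap_id (f : R) {M : ModuleCat.{u} R} (x : Loc f M) :
    Lmap f (LinearMap.id (M := M)) x = x := by
  rw [Lmap, IsLocalizedModule.map_id]
  rfl

/-- Auxiliary recursion step for the Cech modules. -/
def Kaux (prev : List R → ModuleCat.{u} R → ModuleCat.{u} R) :
    List R → ModuleCat.{u} R → ModuleCat.{u} R
  | [], _ => ModuleCat.of R PUnit.{u+1}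
  | f :: fs, M => ModuleCat.of R (Kaux prev fs M × prev fs (Loc f M))

/-- The modules of the Cech complex. -/
def K : ℕ → List R → ModuleCat.{u} R → ModuleCat.{u} R
  | 0 => fun _ M => M
  | p + 1 => Kaux (K p)

/-- Assembling an element of a Cech module. -/
def kmk {p : ℕ} {f : R} {fs : List R} {M : ModuleCat.{u} R} (a : K (p + 1) fs M)
    (b : K p fs (Loc f M)) : K (p + 1) (f :: fs) M := (a, b)

lemma kcases {p : ℕ} {f : R} {fs : List R} {M : ModuleCat.{u} R} (x : K (p + 1) (f :: fs) M) :
    ∃ (a : K (p + 1) fs M) (b : K p fs (Loc f M)), x = kmk a b := ⟨x.1, x.2, rfl⟩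

lemma kmk_inj {p : ℕ} {f : R} {fs : List R} {M : ModuleCat.{u} R} {a a' : K (p + 1) fs M}
    {b b' : K p fs (Loc f M)} : kmk a b = kmk a' b' ↔ a = a' ∧ b = b' := Prod.ext_iff

lemma kmk_zero {p : ℕ} {f : R} {fs : List R} {M : ModuleCat.{u} R} :
    (kmk 0 0 : K (p + 1) (f :: fs) M) = 0 := rfl

lemma kmk_eq_zero {p : ℕ} {f : R} {fs : List R} {M : ModuleCat.{u} R} {a : K (p + 1) fs M}
    {b : K p fs (Loc f M)} : kmk a b = 0 ↔ a = 0 ∧ b = 0 := Prod.ext_iff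

lemma kmk_smul {p : ℕ} {f : R} {fs : List R} {M : ModuleCat.{u} R} (r : R) (a : K (p + 1) fs M)
    (b : K p fs (Loc f M)) : r • kmk a b = kmk (r • a) (r • b) := rfl

instance knil_subsingleton (p : ℕ) (M : ModuleCat.{u} R) : Subsingleton (K (p + 1) [] M) :=
  inferInstanceAs (Subsingleton PUnit.{u+1})

/-- Auxiliary recursion step for functoriality. -/
noncomputable def KmapAux (p : ℕ)
    (prev : (fs : List R) → {M N : ModuleCat.{u} R} → (M →ₗ[R] N) → (K p fs M →ₗ[R] K p fs N)) :
    (fs : List R) → {M N : ModuleCat.{u} R} → (M →ₗ[R] N) →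
    (K (p + 1) fs M →ₗ[R] K (p + 1) fs N)
  | [], _, _, _ => LinearMap.id (R := R) (M := PUnit.{u+1})
  | f :: fs, _, _, φ => (KmapAux p prev fs φ).prodMap (prev fs (Lmap f φ))

/-- Functoriality of the Cech modules. -/
noncomputable def Kmap : (p : ℕ) → (fs : List R) → {M N : ModuleCat.{u} R} → (M →ₗ[R] N) →
    (K p fs M →ₗ[R] K p fs N)
  | 0 => fun _ _ _ φ => φ
  | p + 1 => KmapAux p (Kmap p)

/-- The differential in degree zero. -/
noncomputable def d0 : (fs : List R) → (M : ModuleCat.{u} R) → (M →ₗ[R] K 1 fs M)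
  | [], _ => 0
  | f :: fs, M => (d0 fs M).prod (rho f M)

/-- Auxiliary recursion step for the differential. -/
noncomputable def dAux (p : ℕ)
    (prev : (fs : List R) → (M : ModuleCat.{u} R) → (K p fs M →ₗ[R] K (p + 1) fs M)) :
    (fs : List R) → (M : ModuleCat.{u} R) → (K (p + 1) fs M →ₗ[R] K (p + 2) fs M)
  | [], _ => 0
  | f :: fs, M => ((dAux p prev fs M) ∘ₗ LinearMap.fst R _ _).prod
      (Kmap (p + 1) fs (rho f M) ∘ₗ LinearMap.fst R _ _ -
        prev fs (Loc f M) ∘ₗ LinearMap.snd R _ _)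

/-- The differential of the Cech complex. -/
noncomputable def d : (p : ℕ) → (fs : List R) → (M : ModuleCat.{u} R) →
    (K p fs M →ₗ[R] K (p + 1) fs M)
  | 0 => d0
  | p + 1 => dAux p (d p)

lemma Kmap_zero (fs : List R) {M N : ModuleCat.{u} R} (φ : M →ₗ[R] N) (x : M) :
    Kmap 0 fs φ x = φ x := rfl

lemma Kmap_kmk (p : ℕ) (f : R) (fs : List R) {M N : ModuleCat.{u} R} (φ : M →ₗ[R] N)
    (a : K (p + 1) fs M) (b : K p fs (Loc f M)) :
    Kmap (p + 1) (f :: fs) φ (kmk a b) = kmk (Kmap (p + 1) fs φ a) (Kmap p fs (Lmap f φ) b) := rfl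

lemma d_zero (f : R) (fs : List R) (M : ModuleCat.{u} R) (x : M) :
    d 0 (f :: fs) M x = kmk (d 0 fs M x) (rho f M x) := rfl

lemma d_kmk (p : ℕ) (f : R) (fs : List R) (M : ModuleCat.{u} R)
    (a : K (p + 1) fs M) (b : K p fs (Loc f M)) :
    d (p + 1) (f :: fs) M (kmk a b) = kmk (d (p + 1) fs M a)
      (Kmap (p + 1) fs (rho f M) a - d p fs (Loc f M) b) := rfl

/-- Induction principle for the Cech modules. -/
lemma kinduct {C : (p : ℕ) → (fs : List R) → Prop} (h0 : ∀ fs, C 0 fs) (hn : ∀ p, C (p + 1) [])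
    (hc : ∀ p f fs, C (p + 1) fs → C p fs → C (p + 1) (f :: fs)) (p : ℕ) (fs : List R) :
    C p fs := by
  induction fs generalizing p with
  | nil =>
    cases p with
    | zero => exact h0 _
    | succ p => exact hn p
  | cons f fs ih =>
    cases p with
    | zero => exact h0 _
    | succ p => exact hc p f fs (ih _) (ih _)

lemma Kmap_comp (p : ℕ) (fs : List R) {M N O : ModuleCat.{u} R} (φ : M →ₗ[R] N) (ψ : N →ₗ[R] O)
    (x : K p fs M) : Kmap p fs ψ (Kmap p fs φ x) = Kmap p fs (ψ ∘ₗ φ) x := by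
  induction p, fs using kinduct generalizing M N O with
  | h0 fs => rfl
  | hn p => exact Subsingleton.elim _ _
  | hc p f fs h1 h2 =>
    obtain ⟨a, b, rfl⟩ := kcases x
    rw [Kmap_kmk, Kmap_kmk, Kmap_kmk, h1, h2]
    congr 3
    ext x
    exact Lmap_comp f φ ψ x

lemma Kmap_id (p : ℕ) (fs : List R) {M : ModuleCat.{u} R}
    (x : K p fs M) : Kmap p fs (LinearMap.id (M := M)) x = x := by
  induction p, fs using kinduct generalizing M with
  | h0 fs => rfl
  | hn p => exact Subsingleton.elim _ _
  | hc p f fs h1 h2 =>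
    obtain ⟨a, b, rfl⟩ := kcases x
    have : Lmap f (LinearMap.id (M := M)) = LinearMap.id := by
      ext x
      exact Lmap_id f x
    rw [Kmap_kmk, h1, this, h2]

lemma d_nat (p : ℕ) (fs : List R) {M N : ModuleCat.{u} R} (φ : M →ₗ[R] N) (x : K p fs M) :
    d p fs N (Kmap p fs φ x) = Kmap (p + 1) fs φ (d p fs M x) := by
  induction fs generalizing p M N with
  | nil => exact Subsingleton.elim _ _
  | cons f fs ih =>
    cases p with
    | zero =>
      exact kmk_inj.2 ⟨ih 0 φ x, (Lmap_rho f φ x).symm⟩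
    | succ p =>
      obtain ⟨a, b, rfl⟩ := kcases x
      rw [Kmap_kmk, d_kmk, d_kmk, Kmap_kmk, ih (p + 1), ih p, map_sub, Kmap_comp, Kmap_comp]
      congr 4
      ext x
      exact (Lmap_rho f φ x).symm

lemma d_d (p : ℕ) (fs : List R) (M : ModuleCat.{u} R) (x : K p fs M) :
    d (p + 1) fs M (d p fs M x) = 0 := by
  induction fs generalizing p M with
  | nil => exact Subsingleton.elim _ _
  | cons f fs ih =>
    cases p with
    | zero =>
      exact kmk_eq_zero.2 ⟨ih 0 M x, sub_eq_zero.2 (d_nat 0 fs (rho f M) x).symm⟩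
    | succ p =>
      obtain ⟨a, b, rfl⟩ := kcases x
      rw [d_kmk, d_kmk, ih, ← d_nat, map_sub, ih p, sub_zero, sub_self]
      rfl

lemma Kmap_inj (p : ℕ) (fs : List R) {M N : ModuleCat.{u} R} (φ : M →ₗ[R] N)
    (h : Function.Injective φ) : Function.Injective (Kmap p fs φ) := by
  induction p, fs using kinduct generalizing M N with
  | h0 fs => exact h
  | hn p => exact fun _ _ _ => Subsingleton.elim _ _
  | hc p f fs h1 h2 =>
    intro x y hxy
    obtain ⟨a, b, rfl⟩ := kcases x
    obtain ⟨a', b', rfl⟩ := kcases y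
    rw [Kmap_kmk, Kmap_kmk, kmk_inj] at hxy
    exact kmk_inj.2 ⟨h1 φ h hxy.1, h2 (Lmap f φ) (IsLocalizedModule.map_injective _ _ _ φ h) hxy.2⟩

lemma Kmap_surj (p : ℕ) (fs : List R) {M N : ModuleCat.{u} R} (φ : M →ₗ[R] N)
    (h : Function.Surjective φ) : Function.Surjective (Kmap p fs φ) := by
  induction p, fs using kinduct generalizing M N with
  | h0 fs => exact h
  | hn p => exact fun _ => ⟨0, Subsingleton.elim _ _⟩
  | hc p f fs h1 h2 =>
    intro x
    obtain ⟨a, b, rfl⟩ := kcases x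
    obtain ⟨a, rfl⟩ := h1 φ h a
    obtain ⟨b, rfl⟩ := h2 (Lmap f φ) (IsLocalizedModule.map_surjective _ _ _ φ h) b
    exact ⟨kmk a b, rfl⟩

lemma Kmap_exact (p : ℕ) (fs : List R) {M N O : ModuleCat.{u} R} (φ : M →ₗ[R] N) (ψ : N →ₗ[R] O)
    (h : Function.Exact φ ψ) : Function.Exact (Kmap p fs φ) (Kmap p fs ψ) := by
  induction p, fs using kinduct generalizing M N O with
  | h0 fs => exact h
  | hn p => exact fun x => ⟨fun _ => ⟨x, Subsingleton.elim _ _⟩, fun _ => Subsingleton.elim _ _⟩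
  | hc p f fs h1 h2 =>
    intro x
    obtain ⟨a, b, rfl⟩ := kcases x
    have h1 := h1 φ ψ h a
    have h2 := h2 (Lmap f φ) (Lmap f ψ) (IsLocalizedModule.map_exact _ _ _ _ φ ψ h) b
    rw [Kmap_kmk, kmk_eq_zero, h1, h2]
    constructor
    · rintro ⟨⟨a, rfl⟩, ⟨b, rfl⟩⟩
      exact ⟨kmk a b, rfl⟩
    · rintro ⟨x, hx⟩
      obtain ⟨a', b', rfl⟩ := kcases x
      rw [Kmap_kmk, kmk_inj] at hx
      exact ⟨⟨a', hx.1⟩, ⟨b', hx.2⟩⟩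

lemma Lmap_smul (f : R) (M : ModuleCat.{u} R) (r : R) :
    Lmap f (r • LinearMap.id (M := M)) = r • LinearMap.id := by
  rw [Lmap, map_smul, IsLocalizedModule.map_id]

lemma Kmap_smul (p : ℕ) (fs : List R) {M : ModuleCat.{u} R} (r : R)
    (x : K p fs M) : Kmap p fs (r • LinearMap.id (M := M)) x = r • x := by
  induction p, fs using kinduct generalizing M with
  | h0 fs => rfl
  | hn p => exact Subsingleton.elim _ _
  | hc p f fs h1 h2 =>
    obtain ⟨a, b, rfl⟩ := kcases x
    rw [Kmap_kmk, h1, Lmap_smul, kmk_smul]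
    exact kmk_inj.2 ⟨rfl, h2 (M := Loc f M) b⟩

/-- Cocycles. -/
noncomputable def Zc (p : ℕ) (fs : List R) (M : ModuleCat.{u} R) : Submodule R (K p fs M) :=
  LinearMap.ker (d p fs M)

/-- Coboundaries. -/
noncomputable def Bc : (p : ℕ) → (fs : List R) → (M : ModuleCat.{u} R) → Submodule R (K p fs M)
  | 0, _, _ => ⊥
  | p + 1, fs, M => LinearMap.range (d p fs M)

lemma Bc_le (p : ℕ) (fs : List R) (M : ModuleCat.{u} R) : Bc p fs M ≤ Zc p fs M := by
  cases p with
  | zero => exact bot_le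
  | succ p =>
    rintro _ ⟨x, rfl⟩
    exact d_d p fs M x

/-- A subquotient. -/
abbrev SQ {X : Type u} [AddCommGroup X] [Module R X] (Z B : Submodule R X) : Type u :=
  Z ⧸ B.comap Z.subtype

/-- Cech cohomology. -/
abbrev Hc (p : ℕ) (fs : List R) (M : ModuleCat.{u} R) : Type u := SQ (Zc p fs M) (Bc p fs M)

lemma relEquiv {X₁ X₂ : Type u} [AddCommGroup X₁] [Module R X₁] [AddCommGroup X₂] [Module R X₂]
    (Z₁ B₁ : Submodule R X₁) (Z₂ B₂ : Submodule R X₂) (Rel : Submodule R (X₁ × X₂))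
    (h1 : ∀ z ∈ Z₁, ∃ y ∈ Z₂, (z, y) ∈ Rel) (h2 : ∀ y ∈ Z₂, ∃ z ∈ Z₁, (z, y) ∈ Rel)
    (h3 : ∀ z ∈ Z₁, ∀ y ∈ Z₂, (z, y) ∈ Rel → (z ∈ B₁ ↔ y ∈ B₂)) :
    Nonempty (SQ Z₁ B₁ ≃ₗ[R] SQ Z₂ B₂) := by
  let L : Submodule R (Z₁ × Z₂) := Rel.comap (Z₁.subtype.prodMap Z₂.subtype)
  let a : L →ₗ[R] SQ Z₁ B₁ := Submodule.mkQ _ ∘ₗ LinearMap.fst R _ _ ∘ₗ L.subtype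
  let b : L →ₗ[R] SQ Z₂ B₂ := Submodule.mkQ _ ∘ₗ LinearMap.snd R _ _ ∘ₗ L.subtype
  have ha : Function.Surjective a := by
    intro x
    obtain ⟨⟨z, hz⟩, rfl⟩ := Submodule.mkQ_surjective _ x
    obtain ⟨y, hy, hr⟩ := h1 z hz
    exact ⟨⟨(⟨z, hz⟩, ⟨y, hy⟩), hr⟩, rfl⟩
  have hb : Function.Surjective b := by
    intro x
    obtain ⟨⟨y, hy⟩, rfl⟩ := Submodule.mkQ_surjective _ x
    obtain ⟨z, hz, hr⟩ := h2 y hy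
    exact ⟨⟨(⟨z, hz⟩, ⟨y, hy⟩), hr⟩, rfl⟩
  have hk : LinearMap.ker a = LinearMap.ker b := by
    ext ⟨⟨⟨z, hz⟩, ⟨y, hy⟩⟩, hr⟩
    simp only [a, b, LinearMap.mem_ker, LinearMap.comp_apply, Submodule.mkQ_apply,
      Submodule.Quotient.mk_eq_zero, Submodule.mem_comap]
    exact h3 z hz y hy hr
  exact ⟨(LinearMap.quotKerEquivOfSurjective a ha).symm.trans
    ((Submodule.quotEquivOfEq _ _ hk).trans (LinearMap.quotKerEquivOfSurjective b hb))⟩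

end cech
end BassCech

namespace BassCech
set_option autoImplicit false
section cech4
variable {R : Type u} [CommRing R]

lemma rho_eq_zero (f : R) (M : ModuleCat.{u} R) (m : M) :
    rho f M m = 0 ↔ ∃ k : ℕ, f ^ k • m = 0 := by
  rw [IsLocalizedModule.eq_zero_iff (Submonoid.powers f) (rho f M)]
  constructor
  · rintro ⟨⟨_, k, rfl⟩, h⟩
    exact ⟨k, h⟩
  · rintro ⟨k, h⟩
    exact ⟨⟨_, k, rfl⟩, h⟩

lemma mem_Zc_zero (fs : List R) (M : ModuleCat.{u} R) (m : M) :
    d 0 fs M m = 0 ↔ ∀ f ∈ fs, ∃ k : ℕ, f ^ k • m = 0 := by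
  induction fs with
  | nil =>
    simp only [List.not_mem_nil, false_imp_iff, implies_true, iff_true]
    exact Subsingleton.elim _ _
  | cons f fs ih =>
    rw [List.forall_mem_cons, and_comm, ← rho_eq_zero f M m, ← ih]
    exact kmk_eq_zero

/-- The submodule of elements killed by a power of `f`. -/
noncomputable def tors (f : R) (M : ModuleCat.{u} R) : Submodule R M := LinearMap.ker (rho f M)

lemma mem_tors (f : R) (M : ModuleCat.{u} R) (m : M) :
    m ∈ tors f M ↔ ∃ k : ℕ, f ^ k • m = 0 := rho_eq_zero f M m

lemma tors_inj [IsNoetherianRing R] (f : R) (E : ModuleCat.{u} R) [hE : Module.Injective R E] :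
    Module.Injective R (tors f E) := by
  rw [← Module.Baer.iff_injective]
  intro I φ
  have hfg : I.FG := IsNoetherian.noetherian I
  have hk : ∃ k : ℕ, ∀ x : I, f ^ k • φ x = 0 := by
    have : Module.Finite R I := Module.Finite.iff_fg.2 hfg
    obtain ⟨S, hS⟩ := (Module.Finite.fg_top : (⊤ : Submodule R I).FG)
    have : ∀ x : I, ∃ k : ℕ, f ^ k • φ x = 0 := by
      intro x
      obtain ⟨k, hk⟩ := (mem_tors f E _).1 (φ x).2
      exact ⟨k, Subtype.ext hk⟩
    choose k hk using this
    refine ⟨S.sup k, fun x => ?_⟩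
    have hx : x ∈ Submodule.span R (S : Set I) := hS ▸ Submodule.mem_top
    induction hx using Submodule.span_induction with
    | mem x hx =>
      obtain ⟨c, hc⟩ := Nat.exists_eq_add_of_le (Finset.le_sup (f := k) hx)
      rw [hc, pow_add, mul_comm, mul_smul, hk, smul_zero]
    | zero => simp
    | add x y _ _ h1 h2 => rw [map_add, smul_add, h1, h2, add_zero]
    | smul r x _ h => rw [map_smul, smul_comm, h, smul_zero]
  obtain ⟨k, hk⟩ := hk
  obtain ⟨c, hc⟩ := Ideal.exists_pow_inf_eq_pow_smul (Ideal.span {f}) (M := R) I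
  have hc := hc (c + k) (by omega)
  have key : ∀ x : I, (x : R) ∈ Ideal.span {f} ^ (c + k) → φ x = 0 := by
    intro x hx
    have : (x : R) ∈ (Ideal.span {f} ^ (c + k) • ⊤ : Submodule R R) ⊓ I := by
      refine ⟨?_, x.2⟩
      simpa using hx
    rw [hc] at this
    have h2 : (x : R) ∈ Ideal.span {f} ^ k • I := by
      have := Submodule.smul_mono (le_refl (Ideal.span {f} ^ (c + k - c))) (inf_le_right) this
      rwa [Nat.add_sub_cancel_left] at this
    rw [Ideal.span_singleton_pow, smul_eq_mul, Ideal.mem_span_singleton_mul] at h2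
    obtain ⟨z, hz, hzx⟩ := h2
    have : x = f ^ k • (⟨z, hz⟩ : I) := Subtype.ext hzx.symm
    rw [this, map_smul, hk]
  let J : Ideal R := Ideal.span {f} ^ (c + k)
  let α : I →ₗ[R] R ⧸ J := J.mkQ ∘ₗ I.subtype
  let β : (I ⧸ LinearMap.ker α) →ₗ[R] E := (LinearMap.ker α).liftQ ((tors f E).subtype ∘ₗ φ) (by
    intro x hx
    have : (x : R) ∈ J := (Submodule.Quotient.mk_eq_zero J).1 hx
    simp [key x this])
  obtain ⟨h, hh⟩ := hE.out (α.ker.liftQ α le_rfl) (by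
    rw [← LinearMap.ker_eq_bot, Submodule.ker_liftQ_eq_bot _ _ _ le_rfl]) β
  have hh' : ∀ x : I, h (J.mkQ (x : R)) = φ x := fun x => hh (Submodule.Quotient.mk x)
  have h1 : ∀ r : R, h (J.mkQ r) ∈ tors f E := by
    intro r
    rw [mem_tors]
    refine ⟨c + k, ?_⟩
    rw [← map_smul, ← map_smul]
    have : J.mkQ (f ^ (c + k) • r) = 0 := by
      rw [Submodule.mkQ_apply, Submodule.Quotient.mk_eq_zero]
      refine Ideal.mul_mem_right _ _ ?_
      exact Ideal.pow_mem_pow (Ideal.mem_span_singleton_self f) _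
    rw [this, map_zero]
  exact ⟨LinearMap.codRestrict _ (h ∘ₗ J.mkQ) h1, fun x hx => Subtype.ext (hh' ⟨x, hx⟩)⟩

lemma rho_surj [IsNoetherianRing R] (f : R) (E : ModuleCat.{u} R) [hE : Module.Injective R E] :
    Function.Surjective (rho f E) := by
  intro y
  obtain ⟨⟨e, ⟨_, k, rfl⟩⟩, rfl⟩ := IsLocalizedModule.mk'_surjective (Submonoid.powers f) (rho f E) y
  obtain ⟨N, hN⟩ := monotone_stabilizes_iff_noetherian.2 (inferInstanceAs (IsNoetherian R R))
    (⟨fun n => LinearMap.ker (LinearMap.lsmul R R (f ^ n)), by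
      refine monotone_nat_of_le_succ fun n x hx => ?_
      rw [LinearMap.mem_ker] at hx ⊢
      change f ^ (n + 1) * x = 0
      have : f ^ n * x = 0 := hx
      rw [pow_succ', mul_assoc, this, mul_zero]⟩ : ℕ →o Submodule R R)
  have hN : ∀ m, N ≤ m → ∀ x : R, f ^ m * x = 0 → f ^ N * x = 0 := by
    intro m hm x hx
    have : x ∈ LinearMap.ker (LinearMap.lsmul R R (f ^ m)) := hx
    have h2 := hN m hm
    rw [show LinearMap.ker (LinearMap.lsmul R R (f ^ m)) = _ from h2.symm] at this
    exact this
  let μ := LinearMap.lsmul R R (f ^ (N + k))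
  let β : (R ⧸ LinearMap.ker μ) →ₗ[R] E := (LinearMap.ker μ).liftQ
    (LinearMap.toSpanSingleton R E (f ^ N • e)) (by
      intro x hx
      have : f ^ N * x = 0 := hN (N + k) (by omega) x hx
      rw [LinearMap.mem_ker, LinearMap.toSpanSingleton_apply, smul_smul, mul_comm, this, zero_smul])
  obtain ⟨h, hh⟩ := hE.out (μ.ker.liftQ μ le_rfl) (by
    rw [← LinearMap.ker_eq_bot, Submodule.ker_liftQ_eq_bot _ _ _ le_rfl]) β
  have h1 : h (f ^ (N + k) • 1) = f ^ N • e := by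
    exact (hh (Submodule.Quotient.mk 1)).trans (one_smul R _)
  rw [map_smul] at h1
  refine ⟨h 1, ?_⟩
  symm
  refine (IsLocalizedModule.mk'_eq_iff (f := rho f E)).2 ?_
  change rho f E e = f ^ k • rho f E (h 1)
  rw [← map_smul, ← sub_eq_zero, ← map_sub, rho_eq_zero]
  refine ⟨N, ?_⟩
  rw [smul_sub, ← h1, smul_smul, pow_add, sub_self]

lemma exists_section [IsNoetherianRing R] (f : R) (E : ModuleCat.{u} R)
    [hE : Module.Injective R E] : ∃ s : Loc f E →ₗ[R] E, rho f E ∘ₗ s = LinearMap.id := by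
  obtain ⟨r, hr⟩ := (tors_inj f E).out (tors f E).subtype Subtype.val_injective LinearMap.id
  let t : (E ⧸ LinearMap.ker (rho f E)) →ₗ[R] E := (LinearMap.ker (rho f E)).liftQ
    (LinearMap.id - (tors f E).subtype ∘ₗ r) (by
      intro x hx
      have := hr ⟨x, hx⟩
      simp only [LinearMap.mem_ker, LinearMap.sub_apply, LinearMap.id_apply, LinearMap.comp_apply]
      rw [show r x = ⟨x, hx⟩ from this]
      exact sub_self x)
  let e := LinearMap.quotKerEquivOfSurjective _ (rho_surj f E)
  refine ⟨t ∘ₗ e.symm.toLinearMap, ?_⟩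
  ext y
  obtain ⟨x, rfl⟩ := rho_surj f E y
  have : e.symm (rho f E x) = Submodule.Quotient.mk x := by
    rw [LinearEquiv.symm_apply_eq]
    rfl
  simp only [LinearMap.comp_apply, LinearEquiv.coe_coe, LinearMap.id_apply]
  rw [this]
  change rho f E (x - (r x : E)) = _
  rw [map_sub, show rho f E (r x : E) = 0 from (r x).2, sub_zero]

lemma cech_vanish [IsNoetherianRing R] (E : ModuleCat.{u} R)
    [hE : Module.Injective R E] (p : ℕ) (fs : List R) (x : K (p + 1) fs E)
    (hx : d (p + 1) fs E x = 0) : ∃ y, d p fs E y = x := by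
  induction fs generalizing p with
  | nil => exact ⟨0, Subsingleton.elim _ _⟩
  | cons f fs ih =>
    obtain ⟨a, b, rfl⟩ := kcases x
    rw [d_kmk, kmk_eq_zero] at hx
    obtain ⟨a', rfl⟩ := ih p a hx.1
    have h2 := hx.2
    rw [← d_nat, ← map_sub] at h2
    obtain ⟨s, hs⟩ := exists_section f E
    let c := Kmap p fs s (Kmap p fs (rho f E) a' - b)
    have hc : d p fs E c = 0 := by
      change d p fs E (Kmap p fs s _) = 0
      rw [d_nat, h2, map_zero]
    have hc2 : Kmap p fs (rho f E) c = Kmap p fs (rho f E) a' - b := by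
      change Kmap p fs (rho f E) (Kmap p fs s _) = _
      rw [Kmap_comp, hs, Kmap_id]
    cases p with
    | zero =>
      refine ⟨(a' - c : K 0 fs E), kmk_inj.2 ⟨?_, ?_⟩⟩
      · exact (map_sub (d 0 fs E) a' c).trans (by rw [hc, sub_zero])
      · refine (map_sub (rho f E) a' c).trans ?_
        have h3 : Kmap 0 fs (rho f E) a' - Kmap 0 fs (rho f E) c = b := by
          rw [hc2, sub_sub_cancel]
        exact h3
    | succ p =>
      refine ⟨kmk (a' - c) 0, ?_⟩
      rw [d_kmk, map_sub, hc, map_sub, hc2, map_zero]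
      exact kmk_inj.2 ⟨sub_zero _, by abel⟩

lemma cech_shift {M E Q : ModuleCat.{u} R} (j : M →ₗ[R] E) (g : E →ₗ[R] Q)
    (hj : Function.Injective j) (hg : Function.Surjective g) (hjg : Function.Exact j g)
    (p : ℕ) (fs : List R)
    (hE : ∀ x : K (p + 1) fs E, d (p + 1) fs E x = 0 → ∃ y, d p fs E y = x) :
    Nonempty (Hc (p + 1) fs M ≃ₗ[R] SQ (Zc p fs Q) ((Zc p fs E).map (Kmap p fs g))) := by
  have hj' := fun p => Kmap_inj p fs j hj
  have hg' := fun p => Kmap_surj p fs g hg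
  have hjg' := fun p => Kmap_exact p fs j g hjg
  refine relEquiv _ _ _ _
    (((LinearMap.ker (((Kmap (p + 1) fs j) ∘ₗ LinearMap.fst R _ _) -
      ((d p fs E) ∘ₗ LinearMap.snd R _ _))).map
        ((LinearMap.id).prodMap (Kmap p fs g)) :
      Submodule R (K (p + 1) fs M × K p fs Q))) ?_ ?_ ?_
  · intro z hz
    have hz : d (p + 1) fs M z = 0 := hz
    obtain ⟨e, he⟩ := hE (Kmap (p + 1) fs j z) (by rw [d_nat, hz, map_zero])
    refine ⟨Kmap p fs g e, ?_, ⟨(z, e), ?_, rfl⟩⟩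
    · change d p fs Q _ = 0
      rw [d_nat, he]
      exact (hjg' (p + 1) _).2 ⟨z, rfl⟩
    · exact sub_eq_zero.2 he.symm
  · intro y hy
    have hy : d p fs Q y = 0 := hy
    obtain ⟨e, rfl⟩ := hg' p y
    rw [d_nat] at hy
    obtain ⟨z, hz⟩ := (hjg' (p + 1) _).1 hy
    refine ⟨z, ?_, ⟨(z, e), sub_eq_zero.2 hz, rfl⟩⟩
    refine hj' (p + 2) ?_
    rw [map_zero, ← d_nat, hz, d_d]
  · intro z hz y hy hr
    obtain ⟨⟨z', e⟩, h1, h2⟩ := hr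
    obtain ⟨rfl, rfl⟩ := Prod.ext_iff.1 h2
    have h1 : Kmap (p + 1) fs j z' = d p fs E e := sub_eq_zero.1 h1
    change z' ∈ LinearMap.range (d p fs M) ↔ _
    constructor
    · rintro ⟨m, rfl⟩
      refine ⟨e - Kmap p fs j m, ?_, ?_⟩
      · change d p fs E _ = 0
        rw [map_sub, d_nat, h1, sub_self]
      · rw [map_sub, show Kmap p fs g (Kmap p fs j m) = 0 from (hjg' p _).2 ⟨m, rfl⟩, sub_zero]
        rfl
    · rintro ⟨e', he', h3⟩
      have he' : d p fs E e' = 0 := he'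
      obtain ⟨m, hm⟩ := (hjg' p (e - e')).1 (by
        rw [map_sub]
        exact sub_eq_zero.2 h3.symm)
      refine ⟨m, hj' (p + 1) ?_⟩
      rw [← d_nat, hm, map_sub, he', sub_zero]
      exact h1.symm

lemma map_Zc_succ {E Q : ModuleCat.{u} R} (g : E →ₗ[R] Q)
    (hg : Function.Surjective g)
    (p : ℕ) (fs : List R)
    (hE : ∀ x : K (p + 1) fs E, d (p + 1) fs E x = 0 → ∃ y, d p fs E y = x) :
    (Zc (p + 1) fs E).map (Kmap (p + 1) fs g) = Bc (p + 1) fs Q := by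
  ext y
  constructor
  · rintro ⟨e, he, rfl⟩
    obtain ⟨e', rfl⟩ := hE e he
    exact ⟨Kmap p fs g e', d_nat _ _ _ _⟩
  · rintro ⟨y, rfl⟩
    obtain ⟨e, rfl⟩ := Kmap_surj p fs g hg y
    exact ⟨d p fs E e, d_d _ _ _ _, (d_nat _ _ _ _).symm⟩

end cech4
end BassCech

namespace BassCech
set_option autoImplicit false
section lc
open Limits Opposite
variable {R : Type u} [CommRing R] (I : Ideal R) (i : ℕ) (M : ModuleCat.{u} R)

/-- The colimit cocone computing local cohomology. -/
noncomputable def lcCocone := ((evaluation (ModuleCat.{u} R) (ModuleCat.{u} R)).obj M).mapCocone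
   (colimit.cocone (localCohomology.diagram (localCohomology.idealPowersDiagram I) i))

/-- It is a colimit. -/
noncomputable def lcIsColimit : IsColimit (lcCocone I i M) :=
  isColimitOfPreserves ((evaluation (ModuleCat.{u} R) (ModuleCat.{u} R)).obj M) (colimit.isColimit _)

lemma pfc : PreservesFilteredColimitsOfSize.{0, 0} (forget (ModuleCat.{u} R)) :=
  preservesFilteredColimitsOfSize_shrink.{0, u, 0, u} _

/-- The module `R / I ^ t`. -/
abbrev Rq (t : ℕ) : ModuleCat.{u} R := ModuleCat.of R (R ⧸ I ^ t)

/-- Transition maps. -/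
def tr {t s : ℕ} (h : t ≤ s) : Rq I s ⟶ Rq I t :=
  ModuleCat.ofHom (Submodule.mapQ (I ^ s) (I ^ t) LinearMap.id (Ideal.pow_le_pow_right h))

/-- Local cohomology as a direct limit of the derived-category Ext modules. -/
structure Sys (i : ℕ) (M : ModuleCat.{u} R) (T : Type u) [AddCommGroup T] [Module R T] where
  φ : ∀ t : ℕ, Abelian.Ext (Rq I t) M i →ₗ[R] T
  surj : ∀ z, ∃ t x, φ t x = z
  comp : ∀ {t s : ℕ} (h : t ≤ s) (x), φ s ((Abelian.Ext.mk₀ (tr I h)).comp x (zero_add i)) = φ t x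
  zero : ∀ {t} (x), φ t x = 0 →
    ∃ (s : ℕ) (h : t ≤ s), (Abelian.Ext.mk₀ (tr I h)).comp x (zero_add i) = 0

/-- A chosen resolution. -/
noncomputable abbrev pr (X : ModuleCat.{u} R) : ProjectiveResolution X :=
  ProjectiveResolution.of X

lemma oldNew_nat' {X X' Y : ModuleCat.{u} R} (n : ℕ) (g : X' ⟶ X)
    (a : ((_root_.Ext R (ModuleCat.{u} R) n).obj (Opposite.op X)).obj Y) :
    oldNew (pr X') n ((((_root_.Ext R (ModuleCat.{u} R) n).map g.op).app Y).hom a) =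
      (Abelian.Ext.mk₀ g).comp (oldNew (pr X) n a) (zero_add _) := by
  refine oldNew_nat (pr X) n (pr X') g ⟨ProjectiveResolution.lift g _ _, ?_⟩ a
  have := ProjectiveResolution.lift_commutes_zero g (pr X') (pr X)
  simpa using this

/-- The coprojections. -/
noncomputable def lcι (t : ℕ) : ((_root_.Ext R (ModuleCat.{u} R) i).obj (Opposite.op (Rq I t))).obj M
    →ₗ[R] (localCohomology I i).obj M := ((lcCocone I i M).ι.app (op (op t))).hom

lemma lcι_surj (z : (localCohomology I i).obj M) : ∃ t y, lcι I i M t y = z := by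
  have := pfc (R := R)
  obtain ⟨t, y, h⟩ := Concrete.isColimit_exists_rep _ (lcIsColimit I i M) z
  exact ⟨t.unop.unop, y, h⟩

lemma lcι_comp {t s : ℕ} (h : t ≤ s)
    (y : ((_root_.Ext R (ModuleCat.{u} R) i).obj (Opposite.op (Rq I t))).obj M) :
    lcι I i M s ((((_root_.Ext R (ModuleCat.{u} R) i).map (tr I h).op).app M).hom y) =
      lcι I i M t y := by
  have := (lcCocone I i M).w (homOfLE h).op.op
  exact LinearMap.congr_fun (congrArg ModuleCat.Hom.hom this) y

lemma lcι_zero {t : ℕ}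
    (y : ((_root_.Ext R (ModuleCat.{u} R) i).obj (Opposite.op (Rq I t))).obj M)
    (hx : lcι I i M t y = 0) : ∃ (s : ℕ) (h : t ≤ s),
      (((_root_.Ext R (ModuleCat.{u} R) i).map (tr I h).op).app M).hom y = 0 := by
  have := pfc (R := R)
  have hx : ((lcCocone I i M).ι.app (op (op t))).hom y =
    ((lcCocone I i M).ι.app (op (op t))).hom 0 := hx.trans (map_zero _).symm
  obtain ⟨k, f, g, h⟩ := Concrete.isColimit_exists_of_rep_eq _ (lcIsColimit I i M) _ _ hx
  refine ⟨k.unop.unop, leOfHom f.unop.unop, ?_⟩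
  have hfg : f = g := Quiver.Hom.unop_inj (Quiver.Hom.unop_inj (Subsingleton.elim _ _))
  subst hfg
  exact h.trans (map_zero _)

/-- Local cohomology is such a system. -/
noncomputable def lcSys : Sys I i M ((localCohomology I i).obj M) where
  φ t := lcι I i M t ∘ₗ (oldNew (pr (Rq I t)) i).symm.toLinearMap
  surj z := by
    obtain ⟨t, y, h⟩ := lcι_surj I i M z
    refine ⟨t, oldNew (pr _) i y, ?_⟩
    rw [LinearMap.comp_apply, LinearEquiv.coe_coe, LinearEquiv.symm_apply_apply]
    exact h
  comp {t s} h x := by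
    obtain ⟨y, rfl⟩ := (oldNew (pr (Rq I t)) i).surjective x
    rw [← oldNew_nat']
    simp only [LinearMap.comp_apply, LinearEquiv.coe_coe, LinearEquiv.symm_apply_apply]
    exact lcι_comp I i M h y
  zero {t} x hx := by
    obtain ⟨y, rfl⟩ := (oldNew (pr (Rq I t)) i).surjective x
    simp only [LinearMap.comp_apply, LinearEquiv.coe_coe, LinearEquiv.symm_apply_apply] at hx
    obtain ⟨k, f, h⟩ := lcι_zero I i M y hx
    refine ⟨k, f, ?_⟩
    rw [← oldNew_nat', h, map_zero]

variable {I i M}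

lemma Sys.desc {T : Type u} [AddCommGroup T] [Module R T] (S : Sys I i M T)
    {T' : Type u} [AddCommGroup T'] [Module R T'] (ψ : ∀ t : ℕ, Abelian.Ext (Rq I t) M i →ₗ[R] T')
    (hψ : ∀ {t s : ℕ} (h : t ≤ s) (x), ψ s ((Abelian.Ext.mk₀ (tr I h)).comp x (zero_add i)) = ψ t x) :
    ∃ D : T →ₗ[R] T', ∀ t x, D (S.φ t x) = ψ t x := by
  have key0 : ∀ t x, S.φ t x = 0 → ψ t x = 0 := by
    intro t x h
    obtain ⟨s, hs, h0⟩ := S.zero x h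
    rw [← hψ hs, h0, map_zero]
  have join : ∀ t s (x : Abelian.Ext (Rq I t) M i) (y : Abelian.Ext (Rq I s) M i),
      ∃ k x' y', S.φ k x' = S.φ t x ∧ S.φ k y' = S.φ s y ∧ ψ k x' = ψ t x ∧ ψ k y' = ψ s y := by
    intro t s x y
    exact ⟨max t s, _, _, S.comp (le_max_left t s) x, S.comp (le_max_right t s) y,
      hψ (le_max_left t s) x, hψ (le_max_right t s) y⟩
  have key : ∀ t s x y, S.φ t x = S.φ s y → ψ t x = ψ s y := by
    intro t s x y h
    obtain ⟨k, x', y', h1, h2, h3, h4⟩ := join t s x y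
    rw [← h3, ← h4, ← sub_eq_zero, ← map_sub]
    apply key0
    rw [map_sub, h1, h2, h, sub_self]
  choose t x hx using S.surj
  refine ⟨{ toFun := fun z => ψ (t z) (x z), map_add' := ?_, map_smul' := ?_ }, ?_⟩
  · intro a b
    obtain ⟨k, x', y', h1, h2, h3, h4⟩ := join _ _ (x a) (x b)
    rw [← h3, ← h4, ← map_add]
    apply key
    rw [hx, map_add, h1, h2, hx, hx]
  · intro r a
    rw [RingHom.id_apply, ← map_smul]
    apply key
    rw [hx, map_smul, hx]
  · intro s y
    exact key _ _ _ _ (hx _)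

/-- Post-composition with the connecting class. -/
noncomputable def pcomp (X : ModuleCat.{u} R) {Y Z : ModuleCat.{u} R} {a b c : ℕ} (h : a + b = c)
    (e : Abelian.Ext Y Z b) : Abelian.Ext X Y a →ₗ[R] Abelian.Ext X Z c :=
  (Abelian.Ext.bilinearCompOfLinear R X Y Z a b c h).flip e

lemma pcomp_apply (X : ModuleCat.{u} R) {Y Z : ModuleCat.{u} R} {a b c : ℕ} (h : a + b = c)
    (e : Abelian.Ext Y Z b) (x : Abelian.Ext X Y a) : pcomp X h e x = x.comp e h := rfl

lemma lc_delta {S : ShortComplex (ModuleCat.{u} R)} (hS : S.ShortExact) [Injective S.X₂] (i : ℕ)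
    {T₁ T₃ : Type u} [AddCommGroup T₁] [Module R T₁] [AddCommGroup T₃] [Module R T₃]
    (S₁ : Sys I (i + 1) S.X₁ T₁) (S₃ : Sys I i S.X₃ T₃) :
    ∃ D : T₃ →ₗ[R] T₁, Function.Surjective D ∧ ∀ z, D z = 0 ↔
      ∃ t, ∃ y : Abelian.Ext (Rq I t) S.X₂ i,
        z = S₃.φ t (y.comp (Abelian.Ext.mk₀ S.g) (add_zero i)) := by
  obtain ⟨D, hD⟩ := S₃.desc (fun t => S₁.φ t ∘ₗ pcomp (Rq I t) rfl hS.extClass) (by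
    intro t s h x
    rw [LinearMap.comp_apply, LinearMap.comp_apply, pcomp_apply, pcomp_apply, ← S₁.comp h,
      Abelian.Ext.comp_assoc _ _ _ (zero_add i) rfl (by omega)])
  refine ⟨D, ?_, ?_⟩
  · intro z
    obtain ⟨t, x, rfl⟩ := S₁.surj z
    obtain ⟨y, hy⟩ := Abelian.Ext.covariant_sequence_exact₁ (Rq I t) hS x
      (Abelian.Ext.eq_zero_of_injective _) rfl
    exact ⟨S₃.φ t y, by rw [hD, LinearMap.comp_apply, pcomp_apply, hy]⟩
  · intro z
    constructor
    · intro hz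
      obtain ⟨t, x, rfl⟩ := S₃.surj z
      rw [hD, LinearMap.comp_apply, pcomp_apply] at hz
      obtain ⟨s, h, h0⟩ := S₁.zero _ hz
      rw [← Abelian.Ext.comp_assoc _ _ _ (zero_add i) rfl (by omega)] at h0
      obtain ⟨y, hy⟩ := Abelian.Ext.covariant_sequence_exact₃ (Rq I s) hS _ rfl h0
      refine ⟨s, y, ?_⟩
      rw [hy, S₃.comp]
    · rintro ⟨t, y, rfl⟩
      rw [hD, LinearMap.comp_apply, pcomp_apply,
        Abelian.Ext.comp_assoc _ _ _ (add_zero i) (zero_add 1) (by omega), hS.comp_extClass,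
        Abelian.Ext.comp_zero, map_zero]

/-- Evaluation at one. -/
noncomputable def ev1 (t : ℕ) (M : ModuleCat.{u} R) : Abelian.Ext (Rq I t) M 0 →ₗ[R] M where
  toFun x := (Abelian.Ext.linearEquiv₀ (R := R) x).hom (Submodule.Quotient.mk 1)
  map_add' x y := by rw [map_add]; rfl
  map_smul' r x := by rw [map_smul]; rfl

lemma ev1_mk₀ (t : ℕ) (M : ModuleCat.{u} R) (f : Rq I t ⟶ M) :
    ev1 t M (Abelian.Ext.mk₀ f) = f.hom (Submodule.Quotient.mk 1) := by
  have : Abelian.Ext.linearEquiv₀ (R := R) (Abelian.Ext.mk₀ f) = f := by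
    rw [← LinearEquiv.eq_symm_apply]
    rfl
  change (Abelian.Ext.linearEquiv₀ (R := R) (Abelian.Ext.mk₀ f)).hom _ = _
  rw [this]

lemma exists_mk₀ {X M : ModuleCat.{u} R} (x : Abelian.Ext X M 0) : ∃ f, x = Abelian.Ext.mk₀ f :=
  ⟨_, (Abelian.Ext.mk₀_linearEquiv₀_apply (R := R) x).symm⟩

lemma lc_zero {M : ModuleCat.{u} R} {T : Type u} [AddCommGroup T] [Module R T] (S : Sys I 0 M T) :
    ∃ D : T →ₗ[R] M, Function.Injective D ∧ (∀ t x, D (S.φ t x) = ev1 t M x) ∧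
      ∀ m, (∃ z, D z = m) ↔ ∃ t : ℕ, ∀ r ∈ I ^ t, r • m = 0 := by
  obtain ⟨D, hD⟩ := S.desc (fun t => ev1 t M) (by
    intro t s h x
    obtain ⟨f, rfl⟩ := exists_mk₀ x
    rw [Abelian.Ext.mk₀_comp_mk₀, ev1_mk₀, ev1_mk₀]
    rfl)
  refine ⟨D, ?_, hD, ?_⟩
  · rw [injective_iff_map_eq_zero]
    intro z hz
    obtain ⟨t, x, rfl⟩ := S.surj z
    obtain ⟨f, rfl⟩ := exists_mk₀ x
    rw [hD, ev1_mk₀] at hz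
    have : f = 0 := by
      refine ModuleCat.hom_ext (LinearMap.ext fun y => ?_)
      obtain ⟨r, rfl⟩ := Submodule.Quotient.mk_surjective _ y
      have h1 : (Submodule.Quotient.mk r : R ⧸ I ^ t) = r • Submodule.Quotient.mk 1 := by
        rw [← Submodule.Quotient.mk_smul, smul_eq_mul, mul_one]
      rw [h1, map_smul, hz, smul_zero]
      simp
    rw [this, Abelian.Ext.mk₀_zero, map_zero]
  · intro m
    constructor
    · rintro ⟨z, rfl⟩
      obtain ⟨t, x, rfl⟩ := S.surj z
      obtain ⟨f, rfl⟩ := exists_mk₀ x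
      refine ⟨t, fun r hr => ?_⟩
      rw [hD, ev1_mk₀, ← map_smul, ← Submodule.Quotient.mk_smul, smul_eq_mul, mul_one,
        (Submodule.Quotient.mk_eq_zero _).2 hr, map_zero]
    · rintro ⟨t, ht⟩
      refine ⟨S.φ t (Abelian.Ext.mk₀ (ModuleCat.ofHom ((I ^ t).liftQ
        (LinearMap.toSpanSingleton R M m) (fun r hr => ht r hr)))), ?_⟩
      rw [hD, ev1_mk₀]
      exact one_smul R m

lemma pow_span_iff (fs : List R) (M : ModuleCat.{u} R) (m : M) :
    (∃ t : ℕ, ∀ r ∈ Ideal.span {f : R | f ∈ fs} ^ t, r • m = 0) ↔ d 0 fs M m = 0 := by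
  rw [mem_Zc_zero]
  constructor
  · rintro ⟨t, ht⟩ f hf
    exact ⟨t, ht _ (Ideal.pow_mem_pow (Ideal.subset_span (show f ∈ {f : R | f ∈ fs} from hf)) t)⟩
  · intro h
    have h1 : Ideal.span {f : R | f ∈ fs} ≤ (Module.annihilator R (Submodule.span R {m})).radical := by
      rw [Ideal.span_le]
      intro f hf
      obtain ⟨k, hk⟩ := h f hf
      refine ⟨k, ?_⟩
      rw [Module.mem_annihilator]
      rintro ⟨y, hy⟩
      obtain ⟨r, rfl⟩ := Submodule.mem_span_singleton.1 hy
      refine Subtype.ext ?_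
      change f ^ k • r • m = 0
      rw [smul_comm, hk, smul_zero]
    obtain ⟨t, ht⟩ := Ideal.exists_pow_le_of_le_radical_of_fg h1
      (by
        classical
        exact ⟨fs.toFinset, by simp⟩)
    refine ⟨t, fun r hr => ?_⟩
    have := Module.mem_annihilator.1 (ht hr) ⟨m, Submodule.mem_span_singleton_self m⟩
    exact congrArg Subtype.val this

lemma cech_H0 (fs : List R) (M : ModuleCat.{u} R) :
    Nonempty (Hc 0 fs M ≃ₗ[R] (localCohomology (Ideal.span {f : R | f ∈ fs}) 0).obj M) := by
  obtain ⟨D', hD', -, hr⟩ := lc_zero (lcSys (Ideal.span {f : R | f ∈ fs}) 0 M)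
  let D : (localCohomology (Ideal.span {f : R | f ∈ fs}) 0).obj M →ₗ[R] K 0 fs M := D'
  have hD : Function.Injective D := hD'
  have h1 : LinearMap.range D = Zc 0 fs M := by
    ext m
    exact (hr m).trans (pow_span_iff fs M m)
  have h2 : (Bc 0 fs M).comap (Zc 0 fs M).subtype = ⊥ := by
    ext x
    exact ⟨fun h => Subtype.ext h, fun h => congrArg Subtype.val h⟩
  exact ⟨(Submodule.quotEquivOfEqBot _ h2).trans
    ((LinearEquiv.ofEq _ _ h1.symm).trans (LinearEquiv.ofInjective D hD).symm)⟩

lemma cech_H1 (fs : List R) {S : ShortComplex (ModuleCat.{u} R)} (hS : S.ShortExact)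
    [Injective S.X₂] :
    Nonempty (SQ (Zc 0 fs S.X₃) ((Zc 0 fs S.X₂).map (Kmap 0 fs S.g.hom)) ≃ₗ[R]
      (localCohomology (Ideal.span {f : R | f ∈ fs}) 1).obj S.X₁) := by
  obtain ⟨D, hD, hk⟩ := lc_delta hS 0 (lcSys (Ideal.span {f : R | f ∈ fs}) 1 S.X₁)
    (lcSys (Ideal.span {f : R | f ∈ fs}) 0 S.X₃)
  obtain ⟨E₃, hE₃, he₃, hr₃⟩ := lc_zero (lcSys (Ideal.span {f : R | f ∈ fs}) 0 S.X₃)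
  obtain ⟨E₂, hE₂, he₂, hr₂⟩ := lc_zero (lcSys (Ideal.span {f : R | f ∈ fs}) 0 S.X₂)
  let E₃' : (localCohomology (Ideal.span {f : R | f ∈ fs}) 0).obj S.X₃ →ₗ[R] K 0 fs S.X₃ := E₃
  have hE₃' : Function.Injective E₃' := hE₃
  have h1 : LinearMap.range E₃' = Zc 0 fs S.X₃ := by
    ext m
    exact (hr₃ m).trans (pow_span_iff fs _ m)
  let e : Zc 0 fs S.X₃ ≃ₗ[R] _ :=
    (LinearEquiv.ofEq _ _ h1.symm).trans (LinearEquiv.ofInjective E₃' hE₃').symm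
  have he : ∀ x, E₃ (e x) = x.1 := by
    intro x
    have := LinearEquiv.apply_symm_apply (LinearEquiv.ofInjective E₃' hE₃')
      (LinearEquiv.ofEq _ _ h1.symm x)
    exact congrArg Subtype.val this
  let F := D ∘ₗ e.toLinearMap
  have hF : Function.Surjective F := hD.comp e.surjective
  have hker : ((Zc 0 fs S.X₂).map (Kmap 0 fs S.g.hom)).comap (Zc 0 fs S.X₃).subtype =
      LinearMap.ker F := by
    ext x
    rw [LinearMap.mem_ker]
    change _ ↔ D (e x) = 0
    rw [hk]
    constructor
    · rintro ⟨m, hm, hmx⟩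
      obtain ⟨z, hz⟩ := (hr₂ m).2 ((pow_span_iff fs _ m).2 hm)
      obtain ⟨t, y, rfl⟩ := (lcSys (Ideal.span {f : R | f ∈ fs}) 0 S.X₂).surj z
      refine ⟨t, y, hE₃ ?_⟩
      rw [he, he₃]
      obtain ⟨f, rfl⟩ := exists_mk₀ y
      rw [he₂, ev1_mk₀] at hz
      rw [Abelian.Ext.mk₀_comp_mk₀, ev1_mk₀]
      refine hmx.symm.trans ?_
      exact (congrArg S.g.hom hz).symm
    · rintro ⟨t, y, hy⟩
      obtain ⟨f, rfl⟩ := exists_mk₀ y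
      refine ⟨f.hom (Submodule.Quotient.mk 1), ?_, ?_⟩
      · refine (pow_span_iff fs _ _).1 ((hr₂ _).1 ⟨_, (he₂ t (Abelian.Ext.mk₀ f)).trans ?_⟩)
        rw [ev1_mk₀]
      · have := congrArg E₃ hy
        rw [he, he₃, Abelian.Ext.mk₀_comp_mk₀, ev1_mk₀] at this
        exact this.symm
  exact ⟨(Submodule.quotEquivOfEq _ _ hker).trans (LinearMap.quotKerEquivOfSurjective F hF)⟩

theorem cech_lc [IsNoetherianRing R] (fs : List R) (i : ℕ) (M : ModuleCat.{u} R) :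
    Nonempty (Hc i fs M ≃ₗ[R] (localCohomology (Ideal.span {f : R | f ∈ fs}) i).obj M) := by
  induction i generalizing M with
  | zero => exact cech_H0 fs M
  | succ i ih =>
    let j := Injective.ι M
    let S : ShortComplex (ModuleCat.{u} R) := ShortComplex.mk j (cokernel.π j) (cokernel.condition j)
    have hS : S.ShortExact :=
      { exact := ShortComplex.exact_cokernel j
        mono_f := inferInstanceAs (Mono j)
        epi_g := inferInstanceAs (Epi (cokernel.π j)) }
    have hI : Injective S.X₂ := inferInstanceAs (Injective (Injective.under M))
    have hI' : Module.Injective R S.X₂ := by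
      have : Injective (ModuleCat.of R S.X₂) := hI
      exact Module.injective_module_of_injective_object R S.X₂
    have hv := fun p => cech_vanish S.X₂ p fs
    have hinj : Function.Injective S.f.hom := hS.moduleCat_injective_f
    have hsurj : Function.Surjective S.g.hom := hS.moduleCat_surjective_g
    have hex : Function.Exact S.f.hom S.g.hom :=
      (ShortComplex.ShortExact.moduleCat_exact_iff_function_exact S).1 hS.exact
    obtain ⟨e⟩ := cech_shift S.f.hom S.g.hom hinj hsurj hex i fs (hv i)
    cases i with
    | zero =>
      obtain ⟨e'⟩ := cech_H1 fs hS
      exact ⟨e.trans e'⟩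
    | succ i =>
      rw [map_Zc_succ S.g.hom hsurj i fs (hv i)] at e
      obtain ⟨e'⟩ := ih S.X₃
      obtain ⟨D, hD, hk⟩ := lc_delta hS (i + 1) (lcSys (Ideal.span {f : R | f ∈ fs}) (i + 2) S.X₁)
        (lcSys (Ideal.span {f : R | f ∈ fs}) (i + 1) S.X₃)
      have hDi : Function.Injective D := by
        rw [injective_iff_map_eq_zero]
        intro z hz
        obtain ⟨t, y, rfl⟩ := (hk z).1 hz
        rw [Abelian.Ext.eq_zero_of_injective y, Abelian.Ext.zero_comp, map_zero]
      exact ⟨e.trans (e'.trans (LinearEquiv.ofBijective D ⟨hDi, hD⟩))⟩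

end lc
end BassCech

namespace BassCech
set_option autoImplicit false
section tw
set_option linter.unusedSimpArgs false
set_option linter.unusedSectionVars false
set_option linter.unusedVariables false
variable {R : Type u} [CommRing R]

/-- Sequences in `V`, with an action of `R` twisted by `h`. -/
def Tw (_h : R →+* PowerSeries R) (V : Type u) : Type u := ℕ → V

variable (h : R →+* PowerSeries R) {V V' : Type u} [AddCommGroup V] [Module R V]
  [AddCommGroup V'] [Module R V']

instance : AddCommGroup (Tw h V) := inferInstanceAs (AddCommGroup (ℕ → V))

/-- Convolution of a power series with a sequence. -/
noncomputable def conv (a : PowerSeries R) (s : ℕ → V) (k : ℕ) : V :=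
  ∑ ab ∈ Finset.HasAntidiagonal.antidiagonal k, PowerSeries.coeff ab.1 a • s ab.2

lemma conv_mul (a b : PowerSeries R) (s : ℕ → V) (k : ℕ) :
    conv (a * b) s k = conv a (conv b s) k := by
  simp only [conv, PowerSeries.coeff_mul, Finset.sum_smul, Finset.smul_sum, Finset.sum_sigma']
  apply Finset.sum_nbij' (fun z ↦ ⟨(z.2.1, z.2.2 + z.1.2), (z.2.2, z.1.2)⟩)
    (fun z ↦ ⟨(z.1.1 + z.2.1, z.2.2), (z.1.1, z.2.1)⟩)
  · rintro ⟨⟨a, b⟩, c, d⟩ hh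
    rw [Finset.mem_sigma, Finset.HasAntidiagonal.mem_antidiagonal,
      Finset.HasAntidiagonal.mem_antidiagonal] at hh ⊢
    obtain ⟨h1, h2⟩ := hh
    dsimp only at h1 h2 ⊢
    exact ⟨by omega, by omega⟩
  · rintro ⟨⟨a, b⟩, c, d⟩ hh
    rw [Finset.mem_sigma, Finset.HasAntidiagonal.mem_antidiagonal,
      Finset.HasAntidiagonal.mem_antidiagonal] at hh ⊢
    obtain ⟨h1, h2⟩ := hh
    dsimp only at h1 h2 ⊢
    exact ⟨by omega, by omega⟩
  · rintro ⟨⟨a, b⟩, c, d⟩ hh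
    simp only [Finset.mem_sigma, Finset.HasAntidiagonal.mem_antidiagonal] at hh
    obtain ⟨h1, rfl⟩ := hh
    rfl
  · rintro ⟨⟨a, b⟩, c, d⟩ hh
    simp only [Finset.mem_sigma, Finset.HasAntidiagonal.mem_antidiagonal] at hh
    obtain ⟨h1, rfl⟩ := hh
    rfl
  · rintro ⟨⟨a, b⟩, c, d⟩ hh
    simp only [mul_smul]

lemma conv_C (r : R) (s : ℕ → V) (k : ℕ) : conv (PowerSeries.C r) s k = r • s k := by
  rw [conv, Finset.sum_eq_single (0, k)]
  · simp
  · rintro ⟨a, b⟩ h1 h2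
    have : a ≠ 0 := by
      rintro rfl
      simp at h1
      simp [h1] at h2
    simp [PowerSeries.coeff_C, this]
  · simp

noncomputable instance : SMul R (Tw h V) := ⟨fun r s => conv (h r) s⟩

lemma Tw.smul_def (r : R) (s : Tw h V) (k : ℕ) : (r • s) k = conv (h r) s k := rfl

lemma Tw.add_def (s t : Tw h V) (k : ℕ) : (s + t) k = s k + t k := rfl

@[ext] lemma Tw.ext {s t : Tw h V} (H : ∀ k, s k = t k) : s = t := funext H

noncomputable instance : Module R (Tw h V) where
  one_smul s := by
    ext k
    have := conv_C (1 : R) s k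
    rw [map_one, one_smul] at this
    rw [← map_one h] at this
    exact this
  mul_smul a b s := by
    ext k
    have h1 := conv_mul (h a) (h b) s k
    rw [← map_mul] at h1
    exact h1
  smul_zero a := by
    ext k
    change conv _ (fun _ => 0) k = 0
    simp [conv]
  smul_add a s t := by
    ext k
    change conv _ (fun j => s j + t j) k = conv _ s k + conv _ t k
    simp [conv, Finset.sum_add_distrib]
  add_smul a b s := by
    ext k
    change conv _ s k = conv _ s k + conv _ s k
    simp [conv, Finset.sum_add_distrib, add_smul]
  zero_smul s := by
    ext k
    change conv _ s k = 0
    simp [conv]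

/-- The splitting off of the leading term in a convolution. -/
lemma conv_eq (a : PowerSeries R) (s : ℕ → V) (k : ℕ) :
    conv a s k = PowerSeries.constantCoeff a • s k +
      ∑ ab ∈ (Finset.HasAntidiagonal.antidiagonal k).erase (0, k), PowerSeries.coeff ab.1 a • s ab.2 := by
  rw [conv, ← Finset.add_sum_erase _ _ (show (0, k) ∈ Finset.HasAntidiagonal.antidiagonal k by simp)]
  simp

lemma mem_erase_lt {k : ℕ} {ab : ℕ × ℕ} (hh : ab ∈ (Finset.HasAntidiagonal.antidiagonal k).erase (0, k)) :
    ab.2 < k ∧ ab.1 ≠ 0 ∧ ab.1 + ab.2 = k := by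
  obtain ⟨a, b⟩ := ab
  simp only [Finset.mem_erase, Finset.HasAntidiagonal.mem_antidiagonal, ne_eq, Prod.mk.injEq, not_and] at hh
  simp only
  by_cases ha : a = 0
  · omega
  · omega

/-- Solving the convolution equation. -/
noncomputable def solveC (a : PowerSeries R) (inv : V → V) (t : ℕ → V) (k : ℕ) : V :=
  inv (t k - ∑ ab ∈ ((Finset.HasAntidiagonal.antidiagonal k).erase (0, k)).attach,
    have : ab.1.2 < k := (mem_erase_lt ab.2).1
    PowerSeries.coeff ab.1.1 a • solveC a inv t ab.1.2)
termination_by k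

lemma solveC_spec (a : PowerSeries R) (inv : V → V)
    (hinv : ∀ v, PowerSeries.constantCoeff a • inv v = v) (t : ℕ → V) (k : ℕ) :
    conv a (solveC a inv t) k = t k := by
  rw [conv_eq, solveC, hinv]
  rw [Finset.sum_attach _ (fun ab : ℕ × ℕ => PowerSeries.coeff ab.1 a • solveC a inv t ab.2)]
  abel

lemma conv_inj (a : PowerSeries R)
    (hi : ∀ v : V, PowerSeries.constantCoeff a • v = 0 → v = 0) (s : ℕ → V)
    (hs : ∀ k, conv a s k = 0) (k : ℕ) : s k = 0 := by
  induction k using Nat.strong_induction_on with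
  | _ k ih =>
    have := hs k
    rw [conv_eq, Finset.sum_eq_zero, add_zero] at this
    · exact hi _ this
    · intro ab hab
      rw [ih _ (mem_erase_lt hab).1, smul_zero]

lemma Tw.isUnit (f : R) (hf : PowerSeries.constantCoeff (h f) = f)
    (hV : IsUnit (algebraMap R (Module.End R V) f)) :
    IsUnit (algebraMap R (Module.End R (Tw h V)) f) := by
  rw [Module.End.isUnit_iff] at hV ⊢
  constructor
  · rw [injective_iff_map_eq_zero]
    intro s hs
    ext k
    refine conv_inj (h f) ?_ s (fun k => congrFun hs k) k
    intro v hv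
    rw [hf] at hv
    exact (injective_iff_map_eq_zero _).1 hV.1 v hv
  · intro t
    choose inv hinv using hV.2
    refine ⟨solveC (h f) inv t, ?_⟩
    ext k
    refine solveC_spec (h f) inv ?_ t k
    intro v
    rw [hf]
    exact hinv v

/-- Functoriality of the twisted module of sequences. -/
noncomputable def Tw.map (g : V →ₗ[R] V') : Tw h V →ₗ[R] Tw h V' where
  toFun s := fun k => g (s k)
  map_add' s t := by
    ext k
    change g (s k + t k) = g (s k) + g (t k)
    simp
  map_smul' r s := by
    ext k
    change g (conv _ s k) = conv _ (fun k => g (s k)) k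
    simp [conv]

lemma Tw.map_apply (g : V →ₗ[R] V') (s : Tw h V) (k : ℕ) : Tw.map h g s k = g (s k) := rfl

end tw

section dat
set_option linter.unusedSectionVars false
set_option linter.unusedVariables false

/-- A base subring with variables and formal translations along these. -/
structure Dat (R : Type u) [CommRing R] (ι : Type) where
  B : Subring R
  x : ι → R
  H : ι → R →+* PowerSeries R
  H0 : ∀ i r, PowerSeries.constantCoeff (H i r) = r
  HB : ∀ i b, b ∈ B → H i b = PowerSeries.C b
  Hx : ∀ i j, j ≠ i → H i (x j) = PowerSeries.C (x j)
  Hxi : ∀ i, H i (x i) = PowerSeries.C (x i) + PowerSeries.X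
  gen : ∀ p : R → Prop, (∀ b ∈ B, p b) → (∀ j, p (x j)) → (∀ r s, p r → p s → p (r + s)) →
    (∀ r s, p r → p s → p (r * s)) → ∀ r, p r

variable {R : Type u} [CommRing R] {ι : Type} (D : Dat R ι)

/-- A module with formal translations and a compatible filtration. -/
structure FD (T : Finset ι) (V : Type u) [AddCommGroup V] [Module R V] where
  θ : ∀ i, i ∈ T → V →ₗ[R] Tw (D.H i) V
  θ0 : ∀ i hi v, θ i hi v 0 = v
  F : ℕ → Submodule D.B V
  mono : ∀ l, F l ≤ F (l + 1)
  exh : ∀ v, ∃ l, v ∈ F l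
  xF : ∀ j l v, v ∈ F l → D.x j • v ∈ F (l + 1)
  θF : ∀ i hi l k v, v ∈ F l → θ i hi v k ∈ F (l + k)

variable {D} {T : Finset ι} {V V' : Type u} [AddCommGroup V] [Module R V]
  [AddCommGroup V'] [Module R V']

namespace FD

lemma mono' (S : FD D T V) {l m : ℕ} (hlm : l ≤ m) : S.F l ≤ S.F m :=
  monotone_nat_of_le_succ S.mono hlm

lemma bsmul {r : R} (hr : r ∈ D.B) {Φ : Submodule D.B V} {v : V} (hv : v ∈ Φ) : r • v ∈ Φ :=
  Φ.smul_mem ⟨r, hr⟩ hv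

lemma θ_smul (S : FD D T V) (i : ι) (hi : i ∈ T) (r : R) (v : V) (k : ℕ) :
    S.θ i hi (r • v) k = conv (D.H i r) (S.θ i hi v) k := by
  rw [map_smul]
  rfl

lemma θ_smul_const (S : FD D T V) (i : ι) (hi : i ∈ T) (r : R) (hr : D.H i r = PowerSeries.C r)
    (v : V) (k : ℕ) :
    S.θ i hi (r • v) k = r • S.θ i hi v k := by
  rw [θ_smul, hr]
  exact conv_C _ _ _

lemma exists_deg (S : FD D T V) (f : R) : ∃ δ : ℕ, ∀ i a l v, v ∈ S.F l →
    PowerSeries.coeff a (D.H i f) • v ∈ S.F (l + δ) := by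
  refine D.gen (fun f => ∃ δ : ℕ, ∀ i a l v, v ∈ S.F l →
    PowerSeries.coeff a (D.H i f) • v ∈ S.F (l + δ)) ?_ ?_ ?_ ?_ f
  · intro b hb
    refine ⟨0, fun i a l v hv => ?_⟩
    rw [D.HB i b hb, PowerSeries.coeff_C]
    split_ifs
    · exact bsmul hb hv
    · simp
  · intro j
    refine ⟨1, fun i a l v hv => ?_⟩
    by_cases hj : j = i
    · subst hj
      rw [D.Hxi, map_add, add_smul]
      refine Submodule.add_mem _ ?_ ?_
      · rw [PowerSeries.coeff_C]
        split_ifs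
        · exact S.xF _ _ _ hv
        · simp
      · rw [PowerSeries.coeff_X]
        split_ifs
        · rw [one_smul]
          exact S.mono _ hv
        · simp
    · rw [D.Hx _ _ hj, PowerSeries.coeff_C]
      split_ifs
      · exact S.xF _ _ _ hv
      · simp
  · rintro r s ⟨a, ha⟩ ⟨b, hb⟩
    refine ⟨a + b, fun i c l v hv => ?_⟩
    rw [map_add, map_add, add_smul]
    exact Submodule.add_mem _ (S.mono' (by omega) (ha i c l v hv))
      (S.mono' (by omega) (hb i c l v hv))
  · rintro r s ⟨a, ha⟩ ⟨b, hb⟩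
    refine ⟨a + b, fun i c l v hv => ?_⟩
    rw [map_mul, PowerSeries.coeff_mul, Finset.sum_smul]
    refine Submodule.sum_mem _ fun z _ => ?_
    rw [mul_smul]
    have := ha i z.1 _ _ (hb i z.2 l v hv)
    exact S.mono' (by omega) this

/-- Stability of a submodule. -/
def Stable (S : FD D T V) (U : Submodule R V) : Prop :=
  ∀ i hi u k, u ∈ U → S.θ i hi u k ∈ U

/-- Compatibility of a linear map. -/
def Dlin (S : FD D T V) (S' : FD D T V') (g : V →ₗ[R] V') : Prop :=
  ∀ i hi v k, S'.θ i hi (g v) k = g (S.θ i hi v k)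

/-- Restriction to a stable submodule and fewer directions. -/
noncomputable def sub (S : FD D T V) {T' : Finset ι} (hT : T' ⊆ T) (U : Submodule R V)
    (hU : ∀ i (hi : i ∈ T') u k, u ∈ U → S.θ i (hT hi) u k ∈ U) : FD D T' U where
  θ i hi :=
    { toFun := fun u k => ⟨S.θ i (hT hi) u k, hU i hi u k u.2⟩
      map_add' := fun u v => by
        ext k
        change S.θ i (hT hi) ((u : V) + v) k = _
        rw [map_add]
        rfl
      map_smul' := fun r v => by
        ext k
        change S.θ i (hT hi) (r • (v : V)) k = Submodule.subtype U (conv _ _ k)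
        rw [θ_smul]
        simp [conv] }
  θ0 i hi v := Subtype.ext (S.θ0 i (hT hi) v)
  F l := (S.F l).comap (U.subtype.restrictScalars D.B)
  mono l v hv := S.mono l hv
  exh v := S.exh v
  xF j l v hv := S.xF j l v hv
  θF i hi l k v hv := S.θF i (hT hi) l k v hv

/-- Quotient by a stable submodule and fewer directions. -/
noncomputable def quot (S : FD D T V) {T' : Finset ι} (hT : T' ⊆ T) (U : Submodule R V)
    (hU : ∀ i (hi : i ∈ T') u k, u ∈ U → S.θ i (hT hi) u k ∈ U) : FD D T' (V ⧸ U) where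
  θ i hi := U.liftQ (Tw.map _ U.mkQ ∘ₗ S.θ i (hT hi)) (by
    intro u hu
    rw [LinearMap.mem_ker]
    ext k
    exact (Submodule.Quotient.mk_eq_zero U).2 (hU i hi u k hu))
  θ0 i hi v := by
    obtain ⟨v, rfl⟩ := U.mkQ_surjective v
    exact congrArg U.mkQ (S.θ0 i (hT hi) v)
  F l := (S.F l).map (U.mkQ.restrictScalars D.B)
  mono l := Submodule.map_mono (S.mono l)
  exh v := by
    obtain ⟨v, rfl⟩ := U.mkQ_surjective v
    obtain ⟨l, hl⟩ := S.exh v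
    exact ⟨l, v, hl, rfl⟩
  xF j l v hv := by
    obtain ⟨v, hv, rfl⟩ := hv
    exact ⟨D.x j • v, S.xF j l v hv, rfl⟩
  θF i hi l k v hv := by
    obtain ⟨v, hv, rfl⟩ := hv
    exact ⟨_, S.θF i (hT hi) l k v hv, rfl⟩

/-- Products. -/
noncomputable def prod (S : FD D T V) (S' : FD D T V') : FD D T (V × V') where
  θ i hi :=
    { toFun := fun u k => (S.θ i hi u.1 k, S'.θ i hi u.2 k)
      map_add' := fun u v => by
        ext k
        · change S.θ i hi (u.1 + v.1) k = _
          rw [map_add]; rfl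
        · change S'.θ i hi (u.2 + v.2) k = _
          rw [map_add]; rfl
      map_smul' := fun r v => by
        ext k
        · change S.θ i hi (r • v.1) k = LinearMap.fst R V V' (conv _ _ k)
          rw [θ_smul]
          simp [conv]
        · change S'.θ i hi (r • v.2) k = LinearMap.snd R V V' (conv _ _ k)
          rw [θ_smul]
          simp [conv] }
  θ0 i hi v := Prod.ext (S.θ0 i hi v.1) (S'.θ0 i hi v.2)
  F l := (S.F l).prod (S'.F l)
  mono l := Submodule.prod_mono (S.mono l) (S'.mono l)
  exh v := by
    obtain ⟨l, hl⟩ := S.exh v.1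
    obtain ⟨m, hm⟩ := S'.exh v.2
    exact ⟨l + m, S.mono' (by omega) hl, S'.mono' (by omega) hm⟩
  xF j l v hv := ⟨S.xF j l _ hv.1, S'.xF j l _ hv.2⟩
  θF i hi l k v hv := ⟨S.θF i hi l k _ hv.1, S'.θF i hi l k _ hv.2⟩

/-- The trivial module. -/
noncomputable def triv : FD D T PUnit.{u+1} where
  θ i hi := 0
  θ0 i hi v := rfl
  F l := ⊤
  mono l := le_rfl
  exh v := ⟨0, trivial⟩
  xF j l v hv := trivial
  θF i hi l k v hv := trivial

end FD
end dat
end BassCech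

namespace BassCech
set_option autoImplicit false
section loc
set_option linter.unusedSectionVars false
set_option linter.unusedVariables false
variable {R : Type u} [CommRing R] {ι : Type} {D : Dat R ι}
  {T : Finset ι} {V V' : Type u} [AddCommGroup V] [Module R V]
  [AddCommGroup V'] [Module R V']
namespace FD

variable {W : Type u} [AddCommGroup W] [Module R W] (ρ : V →ₗ[R] W) (f : R)
  [IsLocalizedModule (Submonoid.powers f) ρ]

lemma unit_loc (ρ : V →ₗ[R] W) (f : R)
    [IsLocalizedModule (Submonoid.powers f) ρ]: IsUnit (algebraMap R (Module.End R W) f) :=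
  IsLocalizedModule.map_units (S := Submonoid.powers f) ρ ⟨f, Submonoid.mem_powers f⟩

lemma units_tw (ρ : V →ₗ[R] W) (f : R)
    [IsLocalizedModule (Submonoid.powers f) ρ] (D : Dat R ι) (i : ι) (x : Submonoid.powers f) :
    IsUnit (algebraMap R (Module.End R (Tw (D.H i) W)) x) := by
  obtain ⟨_, n, rfl⟩ := x
  change IsUnit (algebraMap R (Module.End R (Tw (D.H i) W)) (f ^ n))
  rw [map_pow]
  exact (Tw.isUnit _ f (D.H0 i f) (unit_loc ρ f)).pow n

/-- Formal translations on a localization. -/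
noncomputable def locθ (S : FD D T V) (i : ι) (hi : i ∈ T) :
    W →ₗ[R] Tw (D.H i) W :=
  IsLocalizedModule.lift (Submonoid.powers f) ρ
    (Tw.map (D.H i) ρ ∘ₗ S.θ i hi) (units_tw ρ f D i)

lemma locθ_rh (S : FD D T V) (i : ι) (hi : i ∈ T) (v : V) (k : ℕ) :
    locθ ρ f S i hi (ρ v) k = ρ (S.θ i hi v k) := by
  have := IsLocalizedModule.lift_apply (Submonoid.powers f) ρ
    (Tw.map (D.H i) ρ ∘ₗ S.θ i hi) (units_tw ρ f D i) v
  exact congrFun this k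

lemma loc_inj (ρ : V →ₗ[R] W) (f : R)
    [IsLocalizedModule (Submonoid.powers f) ρ] {y : W} (n : ℕ) (hy : f ^ n • y = 0) : y = 0 := by
  have h1 := ((Module.End.isUnit_iff _).1 ((unit_loc ρ f).pow n)).1
  rw [← map_pow] at h1
  exact (injective_iff_map_eq_zero _).1 h1 y hy

lemma loc_surj (ρ : V →ₗ[R] W) (f : R)
    [IsLocalizedModule (Submonoid.powers f) ρ] (y : W) : ∃ (n : ℕ) (v : V), f ^ n • y = ρ v := by
  obtain ⟨⟨v, ⟨_, n, rfl⟩⟩, h⟩ := IsLocalizedModule.surj (Submonoid.powers f) ρ y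
  exact ⟨n, v, h⟩

lemma locθ_zero (S : FD D T V) (i : ι) (hi : i ∈ T) (y : W) :
    locθ ρ f S i hi y 0 = y := by
  obtain ⟨n, v, hv⟩ := loc_surj ρ f y
  have h1 := locθ_rh ρ f S i hi v 0
  rw [S.θ0, ← hv, map_smul] at h1
  obtain ⟨s, hs⟩ : ∃ s : ℕ → W, ∀ k, locθ ρ f S i hi y k = s k := ⟨_, fun _ => rfl⟩
  have h2 : conv (D.H i (f ^ n)) s 0 = f ^ n • y := by
    obtain rfl : s = _ := funext fun k => (hs k).symm
    exact h1
  rw [hs]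
  rw [conv_eq, D.H0] at h2
  rw [Finset.sum_eq_zero, add_zero] at h2
  · have h3 : f ^ n • (s 0 - y) = 0 := by rw [smul_sub, h2, sub_self]
    exact sub_eq_zero.1 (loc_inj ρ f n h3)
  · intro ab hab
    exact absurd (mem_erase_lt hab).1 (by omega)

/-- The image of the filtration in a localization. -/
noncomputable abbrev rF (S : FD D T V) (m : ℕ) : Submodule D.B (W) :=
  (S.F m).map (ρ.restrictScalars D.B)

/-- degree bound -/
def IsDeg (S : FD D T V) (f : R) (δ : ℕ) : Prop := (∀ l v, v ∈ S.F l → f • v ∈ S.F (l + δ)) ∧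
  ∀ i a l v, v ∈ S.F l → PowerSeries.coeff a (D.H i f) • v ∈ S.F (l + δ)

lemma exists_deg' (S : FD D T V) (f : R) : ∃ δ : ℕ, ∀ l v, v ∈ S.F l → f • v ∈ S.F (l + δ) := by
  refine D.gen (fun f => ∃ δ : ℕ, ∀ l v, v ∈ S.F l → f • v ∈ S.F (l + δ)) ?_ ?_ ?_ ?_ f
  · intro b hb
    exact ⟨0, fun l v hv => bsmul hb hv⟩
  · intro j
    exact ⟨1, fun l v hv => S.xF _ _ _ hv⟩
  · rintro r s ⟨a, ha⟩ ⟨b, hb⟩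
    refine ⟨a + b, fun l v hv => ?_⟩
    rw [add_smul]
    exact Submodule.add_mem _ (S.mono' (by omega) (ha l v hv)) (S.mono' (by omega) (hb l v hv))
  · rintro r s ⟨a, ha⟩ ⟨b, hb⟩
    refine ⟨a + b, fun l v hv => ?_⟩
    rw [mul_smul]
    exact S.mono' (by omega) (ha _ _ (hb l v hv))

lemma exists_isDeg (S : FD D T V) (f : R) : ∃ δ : ℕ, S.IsDeg f δ := by
  obtain ⟨a, ha⟩ := S.exists_deg' f
  obtain ⟨b, hb⟩ := S.exists_deg f
  exact ⟨a + b, fun l v hv => S.mono' (by omega) (ha l v hv),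
    fun i c l v hv => S.mono' (by omega) (hb i c l v hv)⟩

lemma rF_mono (S : FD D T V) {l m : ℕ} (h : l ≤ m) : rF ρ S l ≤ rF ρ S m :=
  Submodule.map_mono (S.mono' h)

lemma rF_coeff (S : FD D T V) {δ : ℕ} (hδ : S.IsDeg f δ) (i : ι) (a l : ℕ)
    (y : W) (hy : y ∈ rF ρ S l) : PowerSeries.coeff a (D.H i f) • y ∈ rF ρ S (l + δ) := by
  obtain ⟨v, hv, rfl⟩ := hy
  exact ⟨_, hδ.2 i a l v hv, ρ.map_smul _ _⟩

lemma rF_f (S : FD D T V) {δ : ℕ} (hδ : S.IsDeg f δ) (l : ℕ)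
    (y : W) (hy : y ∈ rF ρ S l) : f • y ∈ rF ρ S (l + δ) := by
  obtain ⟨v, hv, rfl⟩ := hy
  exact ⟨_, hδ.1 l v hv, ρ.map_smul _ _⟩

lemma rF_pow (S : FD D T V) {δ : ℕ} (hδ : S.IsDeg f δ) (n l : ℕ)
    (y : W) (hy : y ∈ rF ρ S l) : f ^ n • y ∈ rF ρ S (l + n * δ) := by
  induction n with
  | zero => simpa using hy
  | succ n ih =>
    rw [pow_succ', mul_smul]
    have := rF_f ρ f S hδ _ _ ih
    exact rF_mono ρ S (by rw [Nat.add_mul]; omega) this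

lemma loc_claim (S : FD D T V) {δ : ℕ} (hδ : S.IsDeg f δ) (i : ι) (hi : i ∈ T) (l m : ℕ) :
    ∀ (k : ℕ) (y : W), f ^ l • y ∈ rF ρ S m →
      f ^ (l + k) • locθ ρ f S i hi y k ∈ rF ρ S (m + k * (δ + 1)) := by
  induction l with
  | zero =>
    intro k y hy
    rw [pow_zero, one_smul] at hy
    obtain ⟨v, hv, rfl⟩ := hy
    rw [zero_add]
    change f ^ k • locθ ρ f S i hi (ρ v) k ∈ _
    rw [locθ_rh]
    have := rF_pow ρ f S hδ k (m + k) (ρ (S.θ i hi v k)) ⟨_, S.θF i hi m k v hv, rfl⟩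
    exact rF_mono ρ S (by rw [Nat.mul_add]; omega) this
  | succ l ih =>
    intro k
    induction k using Nat.strong_induction_on with
    | _ k ihk =>
      intro y hy
      have hz : f ^ l • (f • y) ∈ rF ρ S m := by
        rwa [smul_smul, ← pow_succ]
      have h1 := ih k (f • y) hz
      obtain ⟨s, hs⟩ : ∃ s : ℕ → W, ∀ k, locθ ρ f S i hi y k = s k := ⟨_, fun _ => rfl⟩
      have h2 : locθ ρ f S i hi (f • y) k = conv (D.H i f) s k := by
        obtain rfl : s = _ := funext fun k => (hs k).symm
        rw [map_smul]; rfl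
      rw [hs]
      rw [h2, conv_eq, D.H0, smul_add, smul_smul, ← pow_succ,
        show l + k + 1 = l + 1 + k by omega] at h1
      refine (Submodule.add_mem_iff_left _ ?_).1 h1
      rw [Finset.smul_sum]
      refine Submodule.sum_mem _ fun ab hab => ?_
      obtain ⟨hlt, hne, hsum⟩ := mem_erase_lt hab
      have h3 := ihk ab.2 hlt y hy
      rw [hs] at h3
      have h4 := rF_coeff ρ f S hδ i ab.1 _ _ h3
      have h5 := rF_pow ρ f S hδ (ab.1 - 1) _ _ h4
      have e : f ^ (l + k) • PowerSeries.coeff ab.1 (D.H i f) • s ab.2 =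
          f ^ (ab.1 - 1) • PowerSeries.coeff ab.1 (D.H i f) •
            f ^ (l + 1 + ab.2) • s ab.2 := by
        rw [smul_comm _ (f ^ (l + 1 + ab.2)), smul_smul _ (f ^ (l + 1 + ab.2)), ← pow_add,
          show ab.1 - 1 + (l + 1 + ab.2) = l + k by omega]
      rw [e]
      refine rF_mono ρ S ?_ h5
      obtain ⟨a, ha⟩ : ∃ a, ab.1 = a + 1 := ⟨ab.1 - 1, by omega⟩
      rw [← hsum, ha]
      simp only [Nat.add_mul, Nat.mul_add, Nat.add_sub_cancel]
      omega

/-- The filtration on a localization. -/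
noncomputable def locF (S : FD D T V) (δ : ℕ) (l : ℕ) : Submodule D.B (W) :=
  (rF ρ S (l * (δ + 1))).comap ((LinearMap.lsmul R W (f ^ l)).restrictScalars D.B)

lemma mem_locF (S : FD D T V) (δ : ℕ) (l : ℕ) (y : W) :
    y ∈ locF ρ f S δ l ↔ f ^ l • y ∈ rF ρ S (l * (δ + 1)) := Iff.rfl

/-- The structure on a localization. -/
noncomputable def loc (S : FD D T V) : FD D T (W) where
  θ i hi := locθ ρ f S i hi
  θ0 i hi v := locθ_zero ρ f S i hi v
  F l := locF ρ f S (S.exists_isDeg f).choose l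
  mono l y hy := by
    rw [mem_locF] at hy ⊢
    rw [pow_succ', mul_smul]
    refine rF_mono ρ S ?_ (rF_f ρ f S (S.exists_isDeg f).choose_spec _ _ hy)
    rw [Nat.add_mul]
    omega
  exh y := by
    obtain ⟨n, v, hv⟩ := loc_surj ρ f y
    obtain ⟨m, hm⟩ := S.exh v
    refine ⟨m + n, ?_⟩
    rw [mem_locF, pow_add, mul_smul, hv]
    refine rF_mono ρ S ?_ (rF_pow ρ f S (S.exists_isDeg f).choose_spec m m _ ⟨v, hm, rfl⟩)
    rw [Nat.add_mul, Nat.mul_add]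
    omega
  xF j l y hy := by
    rw [mem_locF] at hy ⊢
    rw [pow_succ', mul_smul, smul_comm _ (D.x j)]
    have h1 : D.x j • f ^ l • y ∈ rF ρ S (l * ((S.exists_isDeg f).choose + 1) + 1) := by
      obtain ⟨v, hv, h⟩ := hy
      refine ⟨_, S.xF j _ v hv, ?_⟩
      rw [← h]
      exact ρ.map_smul _ _
    refine rF_mono ρ S ?_ (rF_f ρ f S (S.exists_isDeg f).choose_spec _ _ h1)
    rw [Nat.add_mul]
    omega
  θF i hi l k y hy := by
    rw [mem_locF] at hy ⊢
    have := loc_claim ρ f S (S.exists_isDeg f).choose_spec i hi l _ k y hy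
    rwa [← Nat.add_mul] at this

lemma loc_θ_rh (S : FD D T V) : Dlin S (S.loc ρ f) ρ :=
  fun i hi v k => locθ_rh ρ f S i hi v k

/-- Maps out of a localization are compatible as soon as they are on the original module. -/
lemma Dlin_loc (S : FD D T V) (S' : FD D T V') (g : W →ₗ[R] V')
    
    (hunit : IsUnit (algebraMap R (Module.End R V') f))
    (hg : Dlin S S' (g ∘ₗ ρ)) : Dlin (S.loc ρ f) S' g := by
  intro i hi v k
  have : (S'.θ i hi) ∘ₗ g = Tw.map _ g ∘ₗ (S.loc ρ f).θ i hi := by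
    refine IsLocalizedModule.ext (Submonoid.powers f) ρ ?_ ?_
    · rintro ⟨_, n, rfl⟩
      change IsUnit (algebraMap R (Module.End R (Tw (D.H i) V')) (f ^ n))
      rw [map_pow]
      exact (Tw.isUnit _ f (D.H0 i f) hunit).pow n
    · ext v k
      have h1 := hg i hi v k
      refine h1.trans ?_
      exact congrArg g (locθ_rh ρ f S i hi v k).symm
  exact congrFun (LinearMap.congr_fun this v) k

end FD
end loc
end BassCech

namespace BassCech
set_option autoImplicit false
section ell
set_option linter.unusedSectionVars false
set_option linter.unusedVariables false
variable {B : Type u} [CommRing B] (q : Ideal B) [q.IsPrime]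

/-- Length of the localization at a prime. -/
noncomputable def eL (M : Type u) [AddCommGroup M] [Module B M] : ℕ∞ :=
  Module.length (Localization.AtPrime q) (LocalizedModule q.primeCompl M)

variable {M N O : Type u} [AddCommGroup M] [Module B M] [AddCommGroup N] [Module B N]
  [AddCommGroup O] [Module B O]

lemma eL_exact (f : M →ₗ[B] N) (g : N →ₗ[B] O) (hf : Function.Injective f)
    (hg : Function.Surjective g) (h : Function.Exact f g) : eL q N = eL q M + eL q O := by
  refine Module.length_eq_add_of_exact
    (LocalizedModule.map q.primeCompl f) (LocalizedModule.map q.primeCompl g)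
    (LocalizedModule.map_injective _ _ hf) (LocalizedModule.map_surjective _ _ hg)
    (LocalizedModule.map_exact _ f g h)

lemma eL_le (f : M →ₗ[B] N) (hf : Function.Injective f) : eL q M ≤ eL q N :=
  Module.length_le_of_injective (LocalizedModule.map q.primeCompl f)
    (LocalizedModule.map_injective _ _ hf)

lemma eL_torsion (h : ∀ m : M, ∃ w ∉ q, w • m = 0) : eL q M = 0 := by
  have : Subsingleton (LocalizedModule q.primeCompl M) := by
    rw [LocalizedModule.subsingleton_iff]
    intro m
    obtain ⟨w, hw, h1⟩ := h m
    exact ⟨w, hw, h1⟩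
  exact Module.length_eq_zero

/-- Length of a submodule. -/
noncomputable def ell (Φ : Submodule B M) : ℕ∞ := eL q Φ

lemma ell_mono {Φ Ψ : Submodule B M} (h : Φ ≤ Ψ) : ell q Φ ≤ ell q Ψ :=
  eL_le q (Submodule.inclusion h) (Submodule.inclusion_injective h)

lemma ell_map (g : M →ₗ[B] N) (Φ : Submodule B M) :
    ell q Φ = ell q (Φ ⊓ LinearMap.ker g) + ell q (Φ.map g) := by
  refine eL_exact q (Submodule.inclusion inf_le_left) (g.submoduleMap Φ)
    (Submodule.inclusion_injective _) (g.submoduleMap_surjective Φ) ?_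
  intro x
  constructor
  · intro hx
    have : g x = 0 := congrArg Subtype.val hx
    exact ⟨⟨x, x.2, this⟩, rfl⟩
  · rintro ⟨y, rfl⟩
    exact Subtype.ext y.2.2

lemma ell_torsion (Φ : Submodule B M) (h : ∀ m ∈ Φ, ∃ w ∉ q, w • m = 0) : ell q Φ = 0 := by
  refine eL_torsion q ?_
  rintro ⟨m, hm⟩
  obtain ⟨w, hw, h1⟩ := h m hm
  exact ⟨w, hw, Subtype.ext h1⟩

lemma ell_bot : ell q (⊥ : Submodule B M) = 0 := by
  refine ell_torsion q _ ?_
  intro m hm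
  exact ⟨1, (Ideal.ne_top_iff_one q).1 (Ideal.IsPrime.ne_top'), by simpa using hm⟩

lemma ell_map_torsion (g : M →ₗ[B] N) (Φ : Submodule B M)
    (h : ∀ m ∈ Φ, g m = 0 → ∃ w ∉ q, w • m = 0) : ell q (Φ.map g) = ell q Φ := by
  rw [ell_map q g Φ, ell_torsion q (Φ ⊓ LinearMap.ker g), zero_add]
  rintro m ⟨hm, h1⟩
  exact h m hm h1

lemma ell_map_le (g : M →ₗ[B] N) (Φ : Submodule B M) : ell q (Φ.map g) ≤ ell q Φ := by
  rw [ell_map q g Φ]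
  exact le_add_self

lemma ell_comap_le (g : M →ₗ[B] N) (hg : ∀ m, g m = 0 → m = 0) (Φ : Submodule B N) :
    ell q (Φ.comap g) ≤ ell q Φ := by
  rw [← ell_map_torsion q g (Φ.comap g)]
  · exact ell_mono q (Submodule.map_comap_le g Φ)
  · intro m _ hm
    exact ⟨1, (Ideal.ne_top_iff_one q).1 (Ideal.IsPrime.ne_top'), by simp [hg m hm]⟩

lemma ell_sup (Φ Ψ : Submodule B M) : ell q (Φ ⊔ Ψ) ≤ ell q Φ + ell q Ψ := by
  rw [ell_map q Φ.mkQ (Φ ⊔ Ψ)]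
  refine add_le_add (ell_mono q ?_) ?_
  · rw [Submodule.ker_mkQ]
    exact inf_le_right
  · rw [Submodule.map_sup]
    have : Φ.map Φ.mkQ = ⊥ := by
      exact Submodule.mkQ_map_self Φ
    rw [this, bot_sup_eq]
    exact ell_map_le q _ _

lemma ell_sum {κ : Type} (s : Finset κ) (Φ : κ → Submodule B M) (c : ℕ∞)
    (h : ∀ i ∈ s, ell q (Φ i) ≤ c) : ell q (s.sup Φ) ≤ s.card * c := by
  classical
  induction s using Finset.induction_on with
  | empty => simp [ell_bot]
  | insert a s ha ih =>
    rw [Finset.sup_insert, Finset.card_insert_of_notMem ha]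
    refine (ell_sup q _ _).trans ?_
    push_cast
    rw [add_mul, one_mul, add_comm]
    exact add_le_add (ih fun i hi => h i (Finset.mem_insert_of_mem hi))
      (h a (Finset.mem_insert_self _ _))

lemma ell_top : ell q (⊤ : Submodule B M) = eL q M :=
  le_antisymm (eL_le q (Submodule.subtype _) Subtype.val_injective)
    (eL_le q (Submodule.topEquiv.symm : M ≃ₗ[B] _).toLinearMap (LinearEquiv.injective _))

lemma ell_prod (Φ : Submodule B M) (Ψ : Submodule B N) :
    ell q (Φ.prod Ψ) ≤ ell q Φ + ell q Ψ := by
  rw [ell_map q (LinearMap.fst B M N) (Φ.prod Ψ), add_comm]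
  refine add_le_add (ell_mono q ?_) ?_
  · rintro _ ⟨y, hy, rfl⟩
    exact hy.1
  · rw [← ell_map_torsion q (LinearMap.snd B M N)]
    · refine ell_mono q ?_
      rintro _ ⟨y, hy, rfl⟩
      exact hy.1.2
    · rintro ⟨a, b⟩ ⟨-, h1⟩ h2
      refine ⟨1, (Ideal.ne_top_iff_one q).1 (Ideal.IsPrime.ne_top'), ?_⟩
      have h1' : a = 0 := h1
      have h2' : b = 0 := h2
      simp [h1', h2']
end ell

section growth
set_option linter.unusedSectionVars false
set_option linter.unusedVariables false
variable {R : Type u} [CommRing R] {ι : Type} {D : Dat R ι}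
  {T T' : Finset ι} {V V' : Type u} [AddCommGroup V] [Module R V]
  [AddCommGroup V'] [Module R V'] (q : Ideal D.B) [q.IsPrime]

namespace FD
/-- Polynomial growth of the filtration. -/
def Growth (S : FD D T V) (N : ℕ) : Prop := ∃ C : ℕ, ∀ l, ell q (S.F l) ≤ (C * (l + 1) ^ N : ℕ)

variable {q}
lemma Growth.sub {S : FD D T V} {N : ℕ} (hS : S.Growth q N) (hT : T' ⊆ T) (U : Submodule R V)
    (hU : ∀ i (hi : i ∈ T') u k, u ∈ U → S.θ i (hT hi) u k ∈ U) :
    (S.sub hT U hU).Growth q N := by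
  obtain ⟨C, hC⟩ := hS
  refine ⟨C, fun l => le_trans ?_ (hC l)⟩
  exact ell_comap_le q _ (fun m hm => Subtype.ext hm) _

lemma Growth.quot {S : FD D T V} {N : ℕ} (hS : S.Growth q N) (hT : T' ⊆ T) (U : Submodule R V)
    (hU : ∀ i (hi : i ∈ T') u k, u ∈ U → S.θ i (hT hi) u k ∈ U) :
    (S.quot hT U hU).Growth q N := by
  obtain ⟨C, hC⟩ := hS
  exact ⟨C, fun l => le_trans (ell_map_le q _ _) (hC l)⟩

lemma Growth.prod {S : FD D T V} {S' : FD D T V'} {N : ℕ} (hS : S.Growth q N)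
    (hS' : S'.Growth q N) : (S.prod S').Growth q N := by
  obtain ⟨C, hC⟩ := hS
  obtain ⟨C', hC'⟩ := hS'
  refine ⟨C + C', fun l => le_trans (ell_prod q _ _) ((add_le_add (hC l) (hC' l)).trans ?_)⟩
  rw [← Nat.cast_add, ← Nat.add_mul]

lemma Growth.triv (N : ℕ) : (FD.triv : FD D T PUnit.{u+1}).Growth q N := by
  refine ⟨0, fun l => ?_⟩
  rw [ell_torsion]
  · simp
  · intro m _
    exact ⟨1, (Ideal.ne_top_iff_one q).1 (Ideal.IsPrime.ne_top'), rfl⟩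

lemma Growth.loc {W : Type u} [AddCommGroup W] [Module R W] (ρ : V →ₗ[R] W) (f : R)
    [IsLocalizedModule (Submonoid.powers f) ρ] {S : FD D T V} {N : ℕ} (hS : S.Growth q N) :
    (S.loc ρ f).Growth q N := by
  obtain ⟨C, hC⟩ := hS
  refine ⟨C * ((S.exists_isDeg f).choose + 1) ^ N, fun l => ?_⟩
  have h1 : ell q ((S.loc ρ f).F l) ≤ ell q (S.F (l * ((S.exists_isDeg f).choose + 1))) :=
    (ell_comap_le q _ (fun m hm => loc_inj ρ f l hm) _).trans (ell_map_le q _ _)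
  refine h1.trans ((hC _).trans ?_)
  rw [Nat.cast_le, mul_assoc, ← mul_pow]
  refine Nat.mul_le_mul_left _ (Nat.pow_le_pow_left ?_ _)
  generalize (S.exists_isDeg f).choose = δ
  nlinarith
end FD
end growth
end BassCech

namespace BassCech
set_option autoImplicit false
section kfd
set_option linter.unusedSectionVars false
set_option linter.unusedVariables false
variable {R : Type u} [CommRing R] {ι : Type} {D : Dat R ι}
  {T : Finset ι} 

/-- The structure on a localization. -/
noncomputable def LFD (f : R) {M : ModuleCat.{u} R} (S : FD D T M) : FD D T (Loc f M) :=
  FD.loc (rho f M) f S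

/-- Recursion step. -/
noncomputable def KFDaux (p : ℕ)
    (prev : (fs : List R) → (M : ModuleCat.{u} R) → FD D T M → FD D T (K p fs M)) :
    (fs : List R) → (M : ModuleCat.{u} R) → FD D T M → FD D T (K (p + 1) fs M)
  | [], M, S => (FD.triv : FD D T PUnit.{u+1})
  | f :: fs, M, S => (KFDaux p prev fs M S).prod (prev fs (Loc f M) (LFD f S))

/-- The structure on the Cech modules. -/
noncomputable def KFD : (p : ℕ) → (fs : List R) → (M : ModuleCat.{u} R) → FD D T M →
    FD D T (K p fs M)
  | 0 => fun _ M S => S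
  | p + 1 => KFDaux p (KFD p)

lemma KFD_zero (fs : List R) {M : ModuleCat.{u} R} (S : FD D T M) (i : ι) (hi : i ∈ T) (m : M)
    (k : ℕ) : ((KFD 0 fs M S).θ i hi m k : M) = S.θ i hi m k := rfl

lemma KFD_kmk {p : ℕ} {f : R} {fs : List R} {M : ModuleCat.{u} R} (S : FD D T M)
    (a : K (p + 1) fs M) (b : K p fs (Loc f M)) (i : ι) (hi : i ∈ T) (k : ℕ) :
    (KFD (p + 1) (f :: fs) M S).θ i hi (kmk a b) k =
      kmk ((KFD (p + 1) fs M S).θ i hi a k) ((KFD p fs (Loc f M) (LFD f S)).θ i hi b k) := rfl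

lemma KFD_growth (q : Ideal D.B) [q.IsPrime] (N : ℕ) (p : ℕ) (fs : List R) {M : ModuleCat.{u} R}
    (S : FD D T M) (hS : S.Growth q N) : (KFD p fs M S).Growth q N := by
  induction p, fs using kinduct generalizing M with
  | h0 fs => exact hS
  | hn p => exact FD.Growth.triv N
  | hc p f fs h1 h2 => exact (h1 S hS).prod (h2 (LFD f S) (FD.Growth.loc (rho f M) f hS))

lemma Lmap_Dlin (f : R) {M N : ModuleCat.{u} R} (S : FD D T M) (S' : FD D T N) (φ : M →ₗ[R] N)
    (h : FD.Dlin S S' φ) : FD.Dlin (LFD f S) (LFD f S') (Lmap f φ) := by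
  refine FD.Dlin_loc (rho f M) f S (LFD f S') (Lmap f φ) (FD.unit_loc (rho f N) f) ?_
  intro i hi v k
  change (LFD f S').θ i hi (Lmap f φ (rho f M v)) k = Lmap f φ (rho f M (S.θ i hi v k))
  rw [Lmap_rho, Lmap_rho, ← h]
  exact FD.loc_θ_rh (rho f N) f S' i hi (φ v) k

lemma Kmap_Dlin (p : ℕ) (fs : List R) {M N : ModuleCat.{u} R} (S : FD D T M) (S' : FD D T N)
    (φ : M →ₗ[R] N)
    (h : FD.Dlin S S' φ) : FD.Dlin (KFD p fs M S) (KFD p fs N S') (Kmap p fs φ) := by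
  induction p, fs using kinduct generalizing M N with
  | h0 fs => exact h
  | hn p => 
    intro i hi v k
    exact Subsingleton.elim _ _
  | hc p f fs h1 h2 => 
    intro i hi v k
    obtain ⟨a, b, rfl⟩ := kcases v
    rw [KFD_kmk, Kmap_kmk, Kmap_kmk, KFD_kmk, kmk_inj]
    exact ⟨h1 S S' φ h i hi a k, h2 (LFD f S) (LFD f S') _ (Lmap_Dlin f S S' φ h) i hi b k⟩

lemma FD.θ_sub {V : Type u} [AddCommGroup V] [Module R V] (S : FD D T V) (i : ι) (hi : i ∈ T)
    (a b : V) (k : ℕ) : S.θ i hi (a - b) k = S.θ i hi a k - S.θ i hi b k := by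
  rw [map_sub]
  rfl

lemma FD.θ_zero {V : Type u} [AddCommGroup V] [Module R V] (S : FD D T V) (i : ι) (hi : i ∈ T)
    (k : ℕ) : S.θ i hi 0 k = 0 := by
  rw [map_zero]
  rfl

lemma rho_Dlin (f : R) {M : ModuleCat.{u} R} (S : FD D T M) : FD.Dlin S (LFD f S) (rho f M) :=
  FD.loc_θ_rh (rho f M) f S

lemma d_Dlin (p : ℕ) (fs : List R) {M : ModuleCat.{u} R} (S : FD D T M) :
    FD.Dlin (KFD p fs M S) (KFD (p + 1) fs M S) (d p fs M) := by
  induction fs generalizing p M with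
  | nil =>
    intro i hi v k
    exact Subsingleton.elim _ _
  | cons f fs ih =>
    intro i hi v k
    cases p with
    | zero =>
      exact kmk_inj.2 ⟨ih 0 S i hi v k, rho_Dlin f S i hi v k⟩
    | succ p =>
      obtain ⟨a, b, rfl⟩ := kcases v
      rw [d_kmk, KFD_kmk, KFD_kmk, d_kmk, kmk_inj]
      refine ⟨ih (p + 1) S i hi a k, ?_⟩
      rw [FD.θ_sub, ih p (LFD f S) i hi b k, Kmap_Dlin (p + 1) fs S (LFD f S) _ (rho_Dlin f S)]

lemma FD.Stable.ker {V V' : Type u} [AddCommGroup V] [Module R V] [AddCommGroup V'] [Module R V']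
    {S : FD D T V} {S' : FD D T V'} {g : V →ₗ[R] V'} (h : FD.Dlin S S' g) :
    S.Stable (LinearMap.ker g) := by
  intro i hi u k hu
  rw [LinearMap.mem_ker] at hu ⊢
  rw [← h, hu, FD.θ_zero]

lemma FD.Stable.map {V V' : Type u} [AddCommGroup V] [Module R V] [AddCommGroup V'] [Module R V']
    {S : FD D T V} {S' : FD D T V'} {g : V →ₗ[R] V'} (h : FD.Dlin S S' g) (U : Submodule R V)
    (hU : S.Stable U) : S'.Stable (U.map g) := by
  rintro i hi _ k ⟨u, hu, rfl⟩
  rw [h]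
  exact ⟨_, hU i hi u k hu, rfl⟩

lemma FD.Stable.bot {V : Type u} [AddCommGroup V] [Module R V] (S : FD D T V) : S.Stable ⊥ := by
  rintro i hi _ k rfl
  rw [FD.θ_zero]
  exact Submodule.zero_mem _

lemma FD.Stable.range {V V' : Type u} [AddCommGroup V] [Module R V] [AddCommGroup V'] [Module R V']
    {S : FD D T V} {S' : FD D T V'} {g : V →ₗ[R] V'} (h : FD.Dlin S S' g) :
    S'.Stable (LinearMap.range g) := by
  rintro i hi _ k ⟨u, rfl⟩
  rw [h]
  exact ⟨_, rfl⟩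

lemma Zc_stable (p : ℕ) (fs : List R) {M : ModuleCat.{u} R} (S : FD D T M) :
    (KFD p fs M S).Stable (Zc p fs M) := FD.Stable.ker (d_Dlin p fs S)

lemma Bc_stable (p : ℕ) (fs : List R) {M : ModuleCat.{u} R} (S : FD D T M) :
    (KFD p fs M S).Stable (Bc p fs M) := by
  cases p with
  | zero => exact FD.Stable.bot _
  | succ p => exact FD.Stable.range (d_Dlin p fs S)

/-- The structure on subquotients. -/
lemma FD.sq {V : Type u} [AddCommGroup V] [Module R V] (q : Ideal D.B) [q.IsPrime] {N : ℕ}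
    {S : FD D T V} (hS : S.Growth q N) {Z B : Submodule R V} (hZ : S.Stable Z) (hB : S.Stable B) :
    ∃ S' : FD D T (SQ Z B), S'.Growth q N :=
  ⟨_, Growth.quot (Growth.sub hS (Finset.Subset.refl T) Z hZ) (Finset.Subset.refl T)
    (B.comap Z.subtype) (fun i hi u k hu => hB i hi u k hu)⟩
end kfd
end BassCech

namespace BassCech
set_option autoImplicit false
section core1
set_option linter.unusedSectionVars false
set_option linter.unusedVariables false
variable {B : Type u} [CommRing B] (q : Ideal B) [q.IsPrime]
variable {M N O : Type u} [AddCommGroup M] [Module B M]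

lemma torsion_of_ell (Φ : Submodule B M) (h : ell q Φ = 0) (m : M) (hm : m ∈ Φ) :
    ∃ w ∉ q, w • m = 0 := by
  have : Subsingleton (LocalizedModule q.primeCompl Φ) := Module.length_eq_zero_iff.1 h
  rw [LocalizedModule.subsingleton_iff] at this
  obtain ⟨w, hw, h1⟩ := this ⟨m, hm⟩
  exact ⟨w, hw, congrArg Subtype.val h1⟩

lemma fg_of_ell (Φ : Submodule B M) (h : ell q Φ ≠ ⊤) :
    ∃ s : Finset M, ∀ m ∈ Φ, ∃ w ∉ q, w • m ∈ Submodule.span B (s : Set M) := by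
  classical
  have hfl := Module.length_ne_top_iff.1 h
  have hn : IsNoetherian (Localization.AtPrime q) (LocalizedModule q.primeCompl Φ) :=
    (isFiniteLength_iff_isNoetherian_isArtinian.1 hfl).1
  obtain ⟨s, hs⟩ := hn.noetherian ⊤
  have hch : ∀ y : LocalizedModule q.primeCompl Φ, ∃ (e : Φ) (t : q.primeCompl),
      y = LocalizedModule.mk e t := by
    intro y
    induction y using LocalizedModule.induction_on with
    | h e t => exact ⟨e, t, rfl⟩
  choose e t het using hch
  let U : Submodule B Φ := Submodule.span B (s.image e : Set Φ)
  have hz : LocalizedModule.map q.primeCompl U.mkQ = 0 := by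
    refine LinearMap.ext_on hs ?_
    intro y hy
    rw [het y, LocalizedModule.map_mk]
    have : U.mkQ (e y) = 0 := by
      rw [Submodule.mkQ_apply, Submodule.Quotient.mk_eq_zero]
      exact Submodule.subset_span (by simpa using ⟨y, hy, rfl⟩)
    rw [this]
    simp
  have hsub : Subsingleton (LocalizedModule q.primeCompl (Φ ⧸ U)) := by
    refine ⟨fun a b => ?_⟩
    obtain ⟨a, rfl⟩ := LocalizedModule.map_surjective q.primeCompl U.mkQ U.mkQ_surjective a
    obtain ⟨b, rfl⟩ := LocalizedModule.map_surjective q.primeCompl U.mkQ U.mkQ_surjective b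
    rw [hz]
    rfl
  rw [LocalizedModule.subsingleton_iff] at hsub
  refine ⟨s.image (fun y => (e y : M)), fun m hm => ?_⟩
  obtain ⟨w, hw, h1⟩ := hsub (U.mkQ ⟨m, hm⟩)
  refine ⟨w, hw, ?_⟩
  rw [← map_smul, Submodule.mkQ_apply, Submodule.Quotient.mk_eq_zero] at h1
  have h2 : w • m ∈ U.map Φ.subtype := ⟨_, h1, rfl⟩
  rw [Submodule.map_span] at h2
  convert h2 using 2
  ext y
  simp

lemma div_growth (l C N : ℕ) (e : ℕ∞) (h : ((l + 1 : ℕ) : ℕ∞) * e ≤ (C * (l + 1) ^ (N + 1) : ℕ)) :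
    e ≤ (C * (l + 1) ^ N : ℕ) := by
  induction e using ENat.recTopCoe with
  | top =>
    rw [ENat.mul_top (by simp)] at h
    exact absurd h (not_le.2 (lt_top_iff_ne_top.2 (ENat.natCast_ne_top _)))
  | coe e =>
    rw [← Nat.cast_mul, Nat.cast_le] at h
    rw [Nat.cast_le]
    refine Nat.le_of_mul_le_mul_left (c := l + 1) ?_ (by omega)
    calc _ ≤ _ := h
      _ = _ := by ring

end core1

section core2
set_option linter.unusedSectionVars false
set_option linter.unusedVariables false
variable {R : Type u} [CommRing R] {ι : Type} (D : Dat R ι) (P : Ideal R) [P.IsPrime]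

/-- Contraction of the prime to the base. -/
abbrev qB : Ideal D.B := P.comap D.B.subtype

/-- The base case. -/
lemma core_base [IsNoetherianRing R] {V : Type u} [AddCommGroup V] [Module R V] (S : FD D ∅ V)
    (hS : S.Growth (qB D P) 0) : GoodP P V := by
  obtain ⟨C, hC⟩ := hS
  simp only [pow_zero, mul_one] at hC
  have hfin : ∀ l, ell (qB D P) (S.F l) ≠ ⊤ := fun l =>
    ne_top_of_le_ne_top (ENat.natCast_ne_top C) (hC l)
  obtain ⟨l0, hl0⟩ : ∃ l0, ∀ l, ell (qB D P) (S.F l) ≤ ell (qB D P) (S.F l0) := by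
    by_contra! hcon
    have : ∀ n : ℕ, ∃ l, (n : ℕ∞) ≤ ell (qB D P) (S.F l) := by
      intro n
      induction n with
      | zero => exact ⟨0, by simp⟩
      | succ n ih =>
        obtain ⟨l, hl⟩ := ih
        obtain ⟨l', hl'⟩ := hcon l
        refine ⟨l', ?_⟩
        push_cast
        exact Order.add_one_le_of_lt (lt_of_le_of_lt hl hl')
    obtain ⟨l, hl⟩ := this (C + 1)
    have := hl.trans (hC l)
    rw [Nat.cast_le] at this
    omega
  have htor : ∀ v : V, ∃ w ∈ D.B, w ∉ P ∧ w • v ∈ S.F l0 := by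
    intro v
    obtain ⟨l, hl⟩ := S.exh v
    have h1 := ell_map (qB D P) (S.F l0).mkQ (S.F (l + l0))
    have h2 : ell (qB D P) (S.F l0) ≤
        ell (qB D P) (S.F (l + l0) ⊓ LinearMap.ker (S.F l0).mkQ) := by
      refine ell_mono _ ?_
      rw [Submodule.ker_mkQ]
      exact le_inf (S.mono' (by omega)) le_rfl
    have h3 : ell (qB D P) ((S.F (l + l0)).map (S.F l0).mkQ) = 0 := by
      have h4 := hl0 (l + l0)
      rw [h1] at h4
      have h5 := (add_le_add h2 le_rfl).trans h4
      by_contra h6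
      have h7 := Order.one_le_iff_ne_zero.2 h6
      have h8 := (add_le_add (le_refl (ell (qB D P) (S.F l0))) h7).trans h5
      exact absurd h8 (not_le.2 ((ENat.lt_add_one_iff (hfin l0)).2 le_rfl))
    obtain ⟨w, hw, h4⟩ := torsion_of_ell _ _ h3 ((S.F l0).mkQ v) ⟨v, S.mono' (by omega) hl, rfl⟩
    refine ⟨w, w.2, hw, ?_⟩
    rw [← map_smul, Submodule.mkQ_apply, Submodule.Quotient.mk_eq_zero] at h4
    exact h4
  obtain ⟨s, hs⟩ := fg_of_ell (qB D P) (S.F l0) (hfin l0)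
  let U : Submodule R V := Submodule.span R (s : Set V)
  have : Module.Finite R U := Module.Finite.span_finset R s
  refine GoodP.sub_quot U GoodP.of_fg (GoodP.of_torsion ?_)
  intro v
  obtain ⟨v, rfl⟩ := U.mkQ_surjective v
  obtain ⟨w, hwB, hwP, hw⟩ := htor v
  obtain ⟨w', hw', h1⟩ := hs _ hw
  refine ⟨w' * w, fun hh => ?_, ?_⟩
  · rcases (‹P.IsPrime›).mem_or_mem hh with h | h
    · exact hw' h
    · exact hwP h
  · rw [← map_smul, Submodule.mkQ_apply, Submodule.Quotient.mk_eq_zero, mul_smul]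
    exact Submodule.span_le_restrictScalars D.B R (s : Set V) h1
end core2
end BassCech

namespace BassCech
set_option autoImplicit false
section core3
set_option linter.unusedSectionVars false
set_option linter.unusedVariables false
variable {R : Type u} [CommRing R] {ι : Type} (D : Dat R ι) (P : Ideal R) [P.IsPrime]

/-- Algebraicity condition for the direction `i`. -/
structure HAlg (Q : Ideal R) (i : ι) (G : R) (c0 : ℕ) (a b w : R) : Prop where
  GP : G ∈ P
  c0pos : 1 ≤ c0
  wB : w ∈ D.B
  wP : w ∉ P
  low : ∀ c, 1 ≤ c → c < c0 → PowerSeries.coeff c (D.H i G) ∈ Q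
  eq : a * PowerSeries.coeff c0 (D.H i G) + b * G - w ∈ Q
  other : ∀ j, j ≠ i → D.H j G = PowerSeries.C G

variable {D P} {Q : Ideal R} {i : ι} {G : R} {c0 : ℕ} {a b w : R} (hA : HAlg D P Q i G c0 a b w)
  {T : Finset ι} {V : Type u} [AddCommGroup V] [Module R V] (S : FD D T V) (hi : i ∈ T)
  (hQ : ∀ r ∈ Q, ∀ v : V, r • v = 0)

lemma lemA (hA : HAlg D P Q i G c0 a b w) (S : FD D T V) (hi : i ∈ T)
    (hQ : ∀ r ∈ Q, ∀ v : V, r • v = 0) (s : V) (hs : G • s = 0) (k : ℕ) :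
    (∀ m, m < k * c0 → G ^ k • S.θ i hi s m = 0) ∧
    G ^ k • S.θ i hi s (k * c0) = (- PowerSeries.coeff c0 (D.H i G)) ^ k • s := by
  obtain ⟨t, ht⟩ : ∃ t : ℕ → V, ∀ m, S.θ i hi s m = t m := ⟨_, fun _ => rfl⟩
  have hG : ∀ m, G • t m = - ∑ ab ∈ (Finset.HasAntidiagonal.antidiagonal m).erase (0, m),
      PowerSeries.coeff ab.1 (D.H i G) • t ab.2 := by
    intro m
    have h1 := S.θ_smul i hi G s m
    rw [hs, FD.θ_zero] at h1
    have h2 : conv (D.H i G) t m = 0 := by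
      obtain rfl : t = _ := funext fun k => (ht k).symm
      exact h1.symm
    rw [conv_eq, D.H0] at h2
    exact eq_neg_of_add_eq_zero_left h2
  simp only [ht]
  have t0 : t 0 = s := by rw [← ht, S.θ0]
  have hkill : ∀ c, 1 ≤ c → c < c0 → ∀ v : V, PowerSeries.coeff c (D.H i G) • v = 0 :=
    fun c h1 h2 v => hQ _ (hA.low c h1 h2) v
  induction k with
  | zero =>
    refine ⟨fun m hm => by omega, ?_⟩
    simp [t0]
  | succ k ih =>
    obtain ⟨ih1, ih2⟩ := ih
    have hterm : ∀ m, ∀ ab ∈ (Finset.HasAntidiagonal.antidiagonal m).erase (0, m),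
        ab.2 < k * c0 ∨ ab.1 < c0 →
        G ^ k • PowerSeries.coeff ab.1 (D.H i G) • t ab.2 = 0 := by
      intro m ab hab h
      obtain ⟨h1, h2, h3⟩ := mem_erase_lt hab
      rcases h with h | h
      · rw [smul_comm, ih1 _ h, smul_zero]
      · rw [hkill _ (by omega) h, smul_zero]
    constructor
    · intro m hm
      rw [pow_succ, mul_smul, hG, smul_neg, Finset.smul_sum, Finset.sum_eq_zero, neg_zero]
      intro ab hab
      refine hterm m ab hab ?_
      obtain ⟨h1, h2, h3⟩ := mem_erase_lt hab
      rw [Nat.add_mul] at hm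
      omega
    · rw [pow_succ, mul_smul, hG, smul_neg, Finset.smul_sum, Finset.sum_eq_single (c0, k * c0)]
      · dsimp only
        rw [smul_comm, ih2, smul_smul, ← neg_smul, ← neg_mul, ← pow_succ']
      · intro ab hab hne
        refine hterm _ ab hab ?_
        obtain ⟨h1, h2, h3⟩ := mem_erase_lt hab
        rw [Nat.add_mul] at h3
        by_contra! hcon
        apply hne
        ext
        · simp only
          omega
        · simp only
          omega
      · intro h
        exfalso
        apply h
        have := hA.c0pos
        rw [Finset.mem_erase, Finset.HasAntidiagonal.mem_antidiagonal]
        refine ⟨?_, by rw [Nat.add_mul]; omega⟩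
        intro h
        have := congrArg Prod.fst h
        simp only at this
        omega

lemma lemA_w (hA : HAlg D P Q i G c0 a b w)
    (hQ : ∀ r ∈ Q, ∀ v : V, r • v = 0) (s : V) (hs : G • s = 0) (k : ℕ) :
    w ^ k • s = a ^ k • PowerSeries.coeff c0 (D.H i G) ^ k • s := by
  induction k with
  | zero => simp
  | succ k ih =>
    have h1 := hQ _ hA.eq s
    rw [sub_smul, add_smul, mul_smul b, hs, smul_zero, add_zero, sub_eq_zero] at h1
    rw [pow_succ, mul_comm, mul_smul, ih, smul_comm w, smul_comm w, ← h1, smul_smul, smul_smul,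
      smul_smul]
    congr 1
    ring

lemma lemA' (hA : HAlg D P Q i G c0 a b w) (S : FD D T V) (hi : i ∈ T)
    (hQ : ∀ r ∈ Q, ∀ v : V, r • v = 0) (s : V) (hs : G • s = 0) (k : ℕ) :
    ∃ y, w ^ k • s = G ^ k • y := by
  refine ⟨(a ^ k * (-1) ^ k) • S.θ i hi s (k * c0), ?_⟩
  rw [lemA_w hA hQ s hs, smul_comm (G ^ k), (lemA hA S hi hQ s hs k).2, smul_smul, smul_smul]
  congr 1
  rw [mul_assoc, ← mul_pow ((-1 : R))]
  simp

lemma lemB (hA : HAlg D P Q i G c0 a b w) (S : FD D T V) (hi : i ∈ T)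
    (hQ : ∀ r ∈ Q, ∀ v : V, r • v = 0) (t : ℕ) :
    ∀ z : V, G ^ t • z = 0 → ∃ m y, w ^ m • z = G • y := by
  induction t with
  | zero =>
    intro z hz
    rw [pow_zero, one_smul] at hz
    exact ⟨0, 0, by simp [hz]⟩
  | succ t ih =>
    intro z hz
    have hs : G • (G ^ t • z) = 0 := by rw [smul_smul, ← pow_succ', hz]
    obtain ⟨y, hy⟩ := lemA' hA S hi hQ _ hs (t + 1)
    obtain ⟨m, y', h1⟩ := ih (w ^ (t + 1) • z - G • y) (by
      rw [smul_sub, smul_comm, hy, smul_smul, ← pow_succ, sub_self])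
    refine ⟨m + (t + 1), y' + w ^ m • y, ?_⟩
    rw [smul_sub, sub_eq_iff_eq_add, smul_smul, ← pow_add] at h1
    rw [h1, smul_add, smul_comm G]


lemma w_pow_notMem (hA : HAlg D P Q i G c0 a b w) (k : ℕ) :
    ∃ w' : D.B, w' ∉ qB D P ∧ ∀ {V : Type u} [AddCommGroup V] [Module R V] (v : V),
      w' • v = w ^ k • v :=
  ⟨⟨w ^ k, pow_mem hA.wB k⟩, fun h => hA.wP ((‹P.IsPrime›).mem_of_pow_mem k h), fun v => rfl⟩

/-- Multiplication by an element as a map linear over the base. -/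
noncomputable abbrev ls (D : Dat R ι) (V : Type u) [AddCommGroup V] [Module R V] (r : R) :
    V →ₗ[D.B] V := (LinearMap.lsmul R V r).restrictScalars D.B

lemma growth_ker (hA : HAlg D P Q i G c0 a b w) (S : FD D T V) (hi : i ∈ T)
    (hQ : ∀ r ∈ Q, ∀ v : V, r • v = 0) (l : ℕ) :
    ((l + 1 : ℕ) : ℕ∞) * ell (qB D P) (S.F l ⊓ LinearMap.ker (ls D V G)) ≤
      ell (qB D P) (S.F (l + c0 * l)) := by
  have key : ∀ k, k ≤ l + 1 → (k : ℕ∞) * ell (qB D P) (S.F l ⊓ LinearMap.ker (ls D V G)) ≤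
      ell (qB D P) (S.F (l + c0 * l) ⊓ LinearMap.ker (ls D V (G ^ k))) := by
    intro k
    induction k with
    | zero => intro _; simp
    | succ k ih =>
      intro hk
      rw [ell_map (qB D P) (ls D V (G ^ k)) (S.F (l + c0 * l) ⊓ LinearMap.ker (ls D V (G ^ (k + 1))))]
      push_cast
      rw [add_mul, one_mul]
      refine add_le_add ((ih (by omega)).trans (ell_mono _ ?_)) ?_
      · rintro v ⟨h1, h2⟩
        have h2' : G ^ k • v = 0 := h2
        refine ⟨⟨h1, ?_⟩, h2⟩
        change G ^ (k + 1) • v = 0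
        rw [pow_succ', mul_smul, h2', smul_zero]
      · rw [← ell_map_torsion (qB D P) (ls D V ((- PowerSeries.coeff c0 (D.H i G)) ^ k))
          (S.F l ⊓ LinearMap.ker (ls D V G))]
        · refine ell_mono _ ?_
          rintro _ ⟨s, ⟨h1, h2⟩, rfl⟩
          have h2' : G • s = 0 := h2
          have h3 := (lemA hA S hi hQ s h2' k).2
          refine ⟨S.θ i hi s (k * c0), ⟨S.mono' ?_ (S.θF i hi l (k * c0) s h1), ?_⟩, h3⟩
          · rw [mul_comm]
            have := Nat.mul_le_mul_left c0 (show k ≤ l by omega)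
            omega
          · change G ^ (k + 1) • _ = (0 : V)
            rw [pow_succ', mul_smul, h3, smul_comm, h2', smul_zero]
        · rintro s ⟨h1, h2⟩ h3
          have h2' : G • s = 0 := h2
          have h3' : (- PowerSeries.coeff c0 (D.H i G)) ^ k • s = 0 := h3
          obtain ⟨w', hw', hw⟩ := w_pow_notMem hA k
          refine ⟨w', hw', ?_⟩
          rw [hw, lemA_w hA hQ s h2' k]
          rw [neg_pow, mul_smul] at h3'
          have h4 : (-1 : R) ^ k • (-1 : R) ^ k • PowerSeries.coeff c0 (D.H i G) ^ k • s = 0 := by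
            rw [h3', smul_zero]
          rw [smul_smul, ← mul_pow] at h4
          simp only [mul_neg, mul_one, neg_neg, one_pow, one_smul] at h4
          rw [h4, smul_zero]
  exact (key (l + 1) le_rfl).trans (ell_mono _ inf_le_left)

/-- The image of a power of an element. -/
noncomputable abbrev GV (V : Type u) [AddCommGroup V] [Module R V] (r : R) : Submodule R V :=
  LinearMap.range (LinearMap.lsmul R V r)

lemma mem_GV (r : R) (v : V) : v ∈ GV V r ↔ ∃ y, r • y = v := Iff.rfl

/-- Multiplication between quotients. -/
noncomputable def chi (G : R) (t : ℕ) : (V ⧸ GV V G) →ₗ[R] V ⧸ GV V (G ^ (t + 1)) :=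
  (GV V G).mapQ (GV V (G ^ (t + 1))) (LinearMap.lsmul R V (G ^ t)) (by
    rintro _ ⟨y, rfl⟩
    refine ⟨y, ?_⟩
    simp only [LinearMap.lsmul_apply]
    rw [smul_smul, ← pow_succ])

lemma growth_coker (hA : HAlg D P Q i G c0 a b w) (S : FD D T V) (hi : i ∈ T)
    (hQ : ∀ r ∈ Q, ∀ v : V, r • v = 0) (δ : ℕ) (hδ : ∀ l v, v ∈ S.F l → G • v ∈ S.F (l + δ))
    (l : ℕ) :
    ((l + 1 : ℕ) : ℕ∞) *
      ell (qB D P) ((S.F l).map ((GV V G).mkQ.restrictScalars D.B)) ≤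
      ell (qB D P) (S.F (l + (l + 1) * δ)) := by
  set n := ell (qB D P) ((S.F l).map ((GV V G).mkQ.restrictScalars D.B)) with hn
  have hpow : ∀ t v, v ∈ S.F l → G ^ t • v ∈ S.F (l + t * δ) := by
    intro t v hv
    induction t with
    | zero => simpa using hv
    | succ t ih =>
      rw [pow_succ', mul_smul]
      refine S.mono' ?_ (hδ _ _ ih)
      rw [Nat.add_mul]
      omega
  have key : ∀ t, t ≤ l + 1 → (t : ℕ∞) * n +
      ell (qB D P) (S.F (l + (l + 1) * δ) ⊓ (GV V (G ^ t)).restrictScalars D.B) ≤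
      ell (qB D P) (S.F (l + (l + 1) * δ)) := by
    intro t
    induction t with
    | zero =>
      intro _
      simp only [Nat.cast_zero, zero_mul, zero_add]
      exact ell_mono _ inf_le_left
    | succ t ih =>
      intro ht
      refine le_trans ?_ (ih (by omega))
      push_cast
      rw [add_mul, one_mul, add_assoc]
      refine add_le_add le_rfl ?_
      rw [ell_map (qB D P) ((GV V (G ^ (t + 1))).mkQ.restrictScalars D.B)
        (S.F (l + (l + 1) * δ) ⊓ (GV V (G ^ t)).restrictScalars D.B), add_comm]
      refine add_le_add (ell_mono _ ?_) ?_
      · rintro v ⟨h1, y, hy⟩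
        refine ⟨⟨h1, G • y, ?_⟩, ?_⟩
        · rw [← hy]
          change G ^ t • G • y = G ^ (t + 1) • y
          rw [smul_smul, ← pow_succ]
        · exact (Submodule.Quotient.mk_eq_zero _).2 ⟨y, hy⟩
      · rw [hn, ← ell_map_torsion (qB D P) ((chi G t).restrictScalars D.B)]
        · refine ell_mono _ ?_
          rintro _ ⟨_, ⟨v, hv, rfl⟩, rfl⟩
          refine ⟨G ^ t • v, ⟨S.mono' ?_ (hpow t v hv), v, rfl⟩, rfl⟩
          have := Nat.mul_le_mul_right δ (show t ≤ l + 1 by omega)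
          omega
        · rintro _ ⟨v, hv, rfl⟩ h1
          have h2 : G ^ t • v ∈ GV V (G ^ (t + 1)) := (Submodule.Quotient.mk_eq_zero _).1 h1
          obtain ⟨y, hy⟩ := h2
          have hy' : G ^ (t + 1) • y = G ^ t • v := hy
          obtain ⟨m, y', h3⟩ := lemB hA S hi hQ t (v - G • y) (by
            rw [smul_sub, smul_smul, ← pow_succ, hy', sub_self])
          obtain ⟨w', hw', hw⟩ := w_pow_notMem hA m
          refine ⟨w', hw', ?_⟩
          rw [hw]
          refine (Submodule.Quotient.mk_eq_zero (GV V G)).2 ⟨y' + w ^ m • y, ?_⟩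
          change G • (y' + w ^ m • y) = w ^ m • v
          rw [smul_sub, sub_eq_iff_eq_add] at h3
          rw [h3, smul_add, smul_comm G]
  exact le_self_add.trans (key (l + 1) le_rfl)

end core3

section core4
variable {R : Type u} [CommRing R] [IsNoetherianRing R] {ι : Type} {D : Dat R ι} {P : Ideal R}
  [P.IsPrime]

theorem core {Q : Ideal R} (hAlg : ∀ i : ι, ∃ (G : R) (c0 : ℕ) (a b w : R),
    HAlg D P Q i G c0 a b w) (T : Finset ι) :
    ∀ {V : Type u} [AddCommGroup V] [Module R V] (S : FD D T V) 
      (_ : ∀ r ∈ Q, ∀ v : V, r • v = 0) (_ : S.Growth (qB D P) T.card), GoodP P V := by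
  classical
  induction T using Finset.induction_on with
  | empty =>
    intro V _ _ S hQ hS
    exact core_base D P S hS
  | insert i T hiT ih =>
    intro V _ _ S hQ hS
    obtain ⟨G, c0, a, b, w, hA⟩ := hAlg i
    have hi : i ∈ insert i T := Finset.mem_insert_self i T
    have hsub : T ⊆ insert i T := Finset.subset_insert i T
    have hne : ∀ j ∈ T, j ≠ i := fun j hj h => hiT (h ▸ hj)
    rw [Finset.card_insert_of_notMem hiT] at hS
    obtain ⟨C, hC⟩ := hS
    have st1 : ∀ j (hj : j ∈ T) (u : V) (k : ℕ), u ∈ LinearMap.ker (LinearMap.lsmul R V G) →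
        S.θ j (hsub hj) u k ∈ LinearMap.ker (LinearMap.lsmul R V G) := by
      intro j hj u k hu
      have hu' : G • u = 0 := hu
      change G • _ = (0 : V)
      rw [← S.θ_smul_const j (hsub hj) G (hA.other j (hne j hj)), hu', FD.θ_zero]
    have st2 : ∀ j (hj : j ∈ T) (u : V) (k : ℕ), u ∈ GV V G →
        S.θ j (hsub hj) u k ∈ GV V G := by
      rintro j hj _ k ⟨u, rfl⟩
      refine ⟨S.θ j (hsub hj) u k, ?_⟩
      exact (S.θ_smul_const j (hsub hj) G (hA.other j (hne j hj)) u k).symm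
    refine GoodP.lemE' G hA.GP (ih (S.sub hsub _ st1) ?_ ?_) (ih (S.quot hsub (GV V G) st2) ?_ ?_)
    · intro r hr v
      exact Subtype.ext (hQ r hr v)
    · refine ⟨C * (c0 + 1) ^ (T.card + 1), fun l => div_growth l _ _ _ ?_⟩
      have h1 : ell (qB D P) ((S.sub hsub _ st1).F l) ≤
          ell (qB D P) (S.F l ⊓ LinearMap.ker (ls D V G)) := by
        rw [← ell_map_torsion (qB D P) ((LinearMap.ker (LinearMap.lsmul R V G)).subtype.restrictScalars D.B)]
        · refine ell_mono _ ?_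
          rintro _ ⟨v, hv, rfl⟩
          exact ⟨hv, v.2⟩
        · intro m _ hm
          refine ⟨1, (Ideal.ne_top_iff_one _).1 (Ideal.IsPrime.ne_top'), ?_⟩
          rw [one_smul]
          exact Subtype.ext hm
      refine (mul_le_mul_right h1 _).trans ((growth_ker hA S hi hQ l).trans ((hC _).trans ?_))
      rw [Nat.cast_le, mul_assoc, ← mul_pow]
      refine Nat.mul_le_mul_left _ (Nat.pow_le_pow_left ?_ _)
      nlinarith
    · intro r hr v
      obtain ⟨v, rfl⟩ := (GV V G).mkQ_surjective v
      rw [← map_smul, hQ r hr, map_zero]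
    · obtain ⟨δ, hδ⟩ := S.exists_deg' G
      refine ⟨C * (δ + 1) ^ (T.card + 1), fun l => div_growth l _ _ _ ?_⟩
      refine (growth_coker hA S hi hQ δ hδ l).trans ((hC _).trans ?_)
      rw [Nat.cast_le, mul_assoc, ← mul_pow]
      refine Nat.mul_le_mul_left _ (Nat.pow_le_pow_left ?_ _)
      nlinarith

end core4
end BassCech

namespace BassCech
set_option autoImplicit false
section finlen
set_option linter.unusedSectionVars false
set_option linter.unusedVariables false

lemma length_killed {L : Type u} [CommRing L] [IsLocalRing L] {N : Type u} [AddCommGroup N]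
    [Module L N] [Module.Finite L N]
    (h : ∀ r ∈ IsLocalRing.maximalIdeal L, ∀ v : N, r • v = 0) : Module.length L N ≠ ⊤ := by
  have ht : Module.IsTorsionBySet L N (IsLocalRing.maximalIdeal L : Set L) := by
    intro v r
    exact h r r.2 v
  letI : Module (L ⧸ IsLocalRing.maximalIdeal L) N := ht.module
  haveI : IsScalarTower L (L ⧸ IsLocalRing.maximalIdeal L) N := ht.isScalarTower
  letI : Field (L ⧸ IsLocalRing.maximalIdeal L) := Ideal.Quotient.field _
  haveI : Module.Finite (L ⧸ IsLocalRing.maximalIdeal L) N :=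
    Module.Finite.of_restrictScalars_finite L _ N
  rw [Module.length_eq_of_surjective (R := L ⧸ IsLocalRing.maximalIdeal L)
    Ideal.Quotient.mk_surjective]
  exact Module.length_ne_top

variable {B : Type u} [CommRing B] [IsNoetherianRing B] (q : Ideal B) [q.IsPrime]

lemma eL_fin (k : ℕ) : ∀ {M : Type u} [AddCommGroup M] [Module B M] [Module.Finite B M]
    (w : B) (_ : w ∉ q) (_ : ∀ r ∈ q ^ k, ∀ m : M, (w * r) • m = 0), eL q M ≠ ⊤ := by
  induction k with
  | zero =>
    intro M _ _ _ w hw h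
    rw [eL_torsion]
    · simp
    · intro m
      exact ⟨w, hw, by simpa using h 1 (by simp) m⟩
  | succ k ih =>
    intro M _ _ _ w hw h
    let U : Submodule B M := q • ⊤
    rw [eL_exact q U.subtype U.mkQ U.subtype_injective U.mkQ_surjective
      (LinearMap.exact_subtype_mkQ U)]
    have h1 : eL q U ≠ ⊤ := by
      refine ih w hw ?_
      rintro r hr ⟨u, hu⟩
      apply Subtype.ext
      change (w * r) • u = 0
      refine Submodule.smul_induction_on hu ?_ ?_
      · intro s hs m _
        rw [smul_smul, mul_assoc]
        exact h _ (by rw [pow_succ]; exact Ideal.mul_mem_mul hr hs) m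
      · intro x y hx hy
        rw [smul_add, hx, hy, add_zero]
    have h2 : eL q (M ⧸ U) ≠ ⊤ := by
      haveI : Module.Finite (Localization.AtPrime q) (LocalizedModule q.primeCompl (M ⧸ U)) :=
        Module.Finite.of_isLocalizedModule q.primeCompl
          (LocalizedModule.mkLinearMap q.primeCompl (M ⧸ U))
      refine length_killed ?_
      intro r hr v
      rw [← Localization.AtPrime.map_eq_maximalIdeal] at hr
      have hle : q.map (algebraMap B (Localization.AtPrime q)) ≤
          Module.annihilator (Localization.AtPrime q) (LocalizedModule q.primeCompl (M ⧸ U)) := by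
        rw [Ideal.map_le_iff_le_comap]
        intro s hs
        rw [Ideal.mem_comap, Module.mem_annihilator]
        intro v
        induction v using LocalizedModule.induction_on with
        | h m t =>
          rw [algebraMap_smul, LocalizedModule.smul'_mk]
          obtain ⟨m, rfl⟩ := U.mkQ_surjective m
          have : s • U.mkQ m = 0 := by
            rw [← map_smul]
            exact (Submodule.Quotient.mk_eq_zero U).2 (Submodule.smul_mem_smul hs trivial)
          rw [this, LocalizedModule.zero_mk]
      exact Module.mem_annihilator.1 (hle hr) v
    exact WithTop.add_ne_top.2 ⟨h1, h2⟩
end finlen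

section devis
set_option linter.unusedSectionVars false
set_option linter.unusedVariables false
variable {R : Type u} [CommRing R] [IsNoetherianRing R] {ι : Type} {D : Dat R ι} {P : Ideal R}
  [P.IsPrime]

/-- `V` is killed by `w q^k`. -/
def Kil (D : Dat R ι) (P : Ideal R) (w : D.B) (k : ℕ) (V : Type u) [AddCommGroup V] [Module R V] :
    Prop := ∀ r ∈ (qB D P) ^ k, ∀ v : V, ((w : R) * (r : R)) • v = 0

theorem devissage (hAlg : ∀ i : ι, ∃ (G : R) (c0 : ℕ) (a b w : R),
    HAlg D P ((qB D P).map D.B.subtype) i G c0 a b w) (T : Finset ι) (w0 : D.B)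
    (hw0 : (w0 : R) ∉ P) (k : ℕ) :
    ∀ {V : Type u} [AddCommGroup V] [Module R V] (S : FD D T V)
      (_ : S.Growth (qB D P) T.card) (_ : Kil D P w0 k V), GoodP P V := by
  induction k with
  | zero =>
    intro V _ _ S hS hK
    refine GoodP.of_torsion fun v => ⟨w0, hw0, ?_⟩
    simpa using hK 1 (by simp) v
  | succ k ih =>
    intro V _ _ S hS hK
    let U : Submodule R V := Submodule.span R {u | ∃ b ∈ qB D P, ∃ v : V, u = (b : R) • v}
    have hU : S.Stable U := by
      intro i hi u n hu
      induction hu using Submodule.span_induction generalizing n with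
      | mem u hu =>
        obtain ⟨b, hb, v, rfl⟩ := hu
        rw [S.θ_smul_const i hi b (D.HB i b b.2)]
        exact Submodule.subset_span ⟨b, hb, _, rfl⟩
      | zero => rw [S.θ_zero]; exact Submodule.zero_mem _
      | add x y _ _ hx hy =>
        rw [map_add]
        exact Submodule.add_mem _ (hx n) (hy n)
      | smul r x _ hx =>
        rw [S.θ_smul]
        exact Submodule.sum_mem _ fun z _ => Submodule.smul_mem _ _ (hx _)
    refine GoodP.sub_quot U ?_ ?_
    · refine ih (S.sub (Finset.Subset.refl T) U hU) (hS.sub (Finset.Subset.refl T) U hU) ?_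
      rintro r hr ⟨u, hu⟩
      apply Subtype.ext
      change ((w0 : R) * (r : R)) • u = 0
      induction hu using Submodule.span_induction with
      | mem u hu =>
        obtain ⟨b, hb, v, rfl⟩ := hu
        rw [smul_smul, mul_assoc]
        exact hK (r * b) (by rw [pow_succ]; exact Ideal.mul_mem_mul hr hb) v
      | zero => exact smul_zero _
      | add x y _ _ hx hy => rw [smul_add, hx, hy, add_zero]
      | smul t x _ hx => rw [smul_comm, hx, smul_zero]
    · refine core hAlg T (S.quot (Finset.Subset.refl T) U hU) ?_
        (hS.quot (Finset.Subset.refl T) U hU)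
      intro r hr v
      have hle : (qB D P).map D.B.subtype ≤ Module.annihilator R (V ⧸ U) := by
        rw [Ideal.map_le_iff_le_comap]
        intro b hb
        rw [Ideal.mem_comap, Module.mem_annihilator]
        intro v
        obtain ⟨v, rfl⟩ := U.mkQ_surjective v
        rw [← map_smul]
        exact (Submodule.Quotient.mk_eq_zero U).2 (Submodule.subset_span ⟨b, hb, v, rfl⟩)
      exact Module.mem_annihilator.1 (hle hr) v
end devis

section init
set_option linter.unusedSectionVars false
set_option linter.unusedVariables false
variable {R : Type u} [CommRing R] {ι : Type} [Fintype ι] [DecidableEq ι] (D : Dat R ι)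

/-- Monomials. -/
noncomputable def mon (e : ι → ℕ) : R := ∏ j, D.x j ^ e j

/-- The box filtration. -/
noncomputable def boxF (l : ℕ) : Submodule D.B R :=
  Submodule.span D.B (Set.range fun e : ι → Fin (l + 1) => mon D (fun j => (e j : ℕ)))

lemma mon_mem {l : ℕ} (e : ι → ℕ) (he : ∀ j, e j ≤ l) : mon D e ∈ boxF D l :=
  Submodule.subset_span ⟨fun j => ⟨e j, Nat.lt_succ_of_le (he j)⟩, rfl⟩

lemma boxF_le {l : ℕ} {Φ : Submodule D.B R} (h : ∀ e : ι → ℕ, (∀ j, e j ≤ l) → mon D e ∈ Φ) :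
    boxF D l ≤ Φ := by
  refine Submodule.span_le.2 ?_
  rintro _ ⟨e, rfl⟩
  exact h _ fun j => Nat.le_of_lt_succ (e j).2

lemma boxF_mono {l m : ℕ} (h : l ≤ m) : boxF D l ≤ boxF D m :=
  boxF_le D fun e he => mon_mem D e fun j => (he j).trans h

lemma mon_mul (e f : ι → ℕ) : mon D e * mon D f = mon D (fun j => e j + f j) := by
  simp only [mon, ← Finset.prod_mul_distrib, pow_add]

lemma boxF_mul {l m : ℕ} {a b : R} (ha : a ∈ boxF D l) (hb : b ∈ boxF D m) :
    a * b ∈ boxF D (l + m) := by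
  induction ha using Submodule.span_induction with
  | mem a ha =>
    obtain ⟨e, rfl⟩ := ha
    induction hb using Submodule.span_induction with
    | mem b hb =>
      obtain ⟨f, rfl⟩ := hb
      change mon D _ * mon D _ ∈ _
      rw [mon_mul]
      exact mon_mem D _ fun j => by have := (e j).2; have := (f j).2; omega
    | zero => rw [mul_zero]; exact Submodule.zero_mem _
    | add x y _ _ hx hy => rw [mul_add]; exact Submodule.add_mem _ hx hy
    | smul t x _ hx => rw [mul_smul_comm]; exact Submodule.smul_mem _ _ hx
  | zero => rw [zero_mul]; exact Submodule.zero_mem _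
  | add x y _ _ hx hy => rw [add_mul]; exact Submodule.add_mem _ hx hy
  | smul t x _ hx => rw [smul_mul_assoc]; exact Submodule.smul_mem _ _ hx

lemma x_eq_mon (j : ι) : D.x j = mon D (Pi.single j 1) := by
  rw [mon, Finset.prod_eq_single j]
  · simp
  · intro b _ hb
    simp [Pi.single_apply, hb]
  · simp

lemma x_mem (j : ι) : D.x j ∈ boxF D 1 := by
  rw [x_eq_mon]
  refine mon_mem D _ fun i => ?_
  rw [Pi.single_apply]
  split_ifs <;> simp

lemma b_mem (b : R) (hb : b ∈ D.B) : b ∈ boxF D 0 := by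
  have h1 : mon D (fun _ => 0) ∈ boxF D 0 := mon_mem D _ fun _ => le_rfl
  have := FD.bsmul hb h1
  simpa [mon] using this

lemma boxF_exh (r : R) : ∃ l, r ∈ boxF D l := by
  refine D.gen (fun r => ∃ l, r ∈ boxF D l) (fun b hb => ⟨0, b_mem D b hb⟩)
    (fun j => ⟨1, x_mem D j⟩) ?_ ?_ r
  · rintro r s ⟨l, hl⟩ ⟨m, hm⟩
    exact ⟨l + m, Submodule.add_mem _ (boxF_mono D (by omega) hl) (boxF_mono D (by omega) hm)⟩
  · rintro r s ⟨l, hl⟩ ⟨m, hm⟩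
    exact ⟨l + m, boxF_mul D hl hm⟩

lemma coeff_mon (i : ι) (e : ι → ℕ) (k : ℕ) :
    PowerSeries.coeff k (D.H i (mon D e)) =
      ((e i).choose k : R) * mon D (Function.update e i (e i - k)) := by
  have h1 : D.H i (mon D e) = ((Polynomial.X + Polynomial.C (D.x i)) ^ e i : Polynomial R) *
      PowerSeries.C (∏ j ∈ Finset.univ.erase i, D.x j ^ e j) := by
    rw [mon, ← Finset.mul_prod_erase _ _ (Finset.mem_univ i), map_mul, map_pow, D.Hxi]
    congr 1
    · push_cast
      rw [add_comm]
    · rw [map_prod, map_prod]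
      refine Finset.prod_congr rfl fun j hj => ?_
      rw [map_pow, map_pow, D.Hx i j (Finset.ne_of_mem_erase hj)]
  rw [h1, PowerSeries.coeff_mul_C, Polynomial.coeff_coe, Polynomial.coeff_X_add_C_pow]
  rw [mon, ← Finset.mul_prod_erase _ _ (Finset.mem_univ i), Function.update_self]
  rw [Finset.prod_congr rfl (fun j hj => by
    rw [Function.update_of_ne (Finset.ne_of_mem_erase hj)] :
    ∀ j ∈ Finset.univ.erase i, D.x j ^ Function.update e i (e i - k) j = D.x j ^ e j)]
  ring

lemma boxF_coeff (i : ι) (l k : ℕ) (r : R) (hr : r ∈ boxF D l) :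
    PowerSeries.coeff k (D.H i r) ∈ boxF D l := by
  induction hr using Submodule.span_induction with
  | mem a ha =>
    obtain ⟨e, rfl⟩ := ha
    change PowerSeries.coeff k (D.H i (mon D _)) ∈ _
    rw [coeff_mon, ← nsmul_eq_mul]
    refine Submodule.smul_of_tower_mem _ _ (mon_mem D _ fun j => ?_)
    rw [Function.update_apply]
    have := (e j).2
    split_ifs with h
    · subst h; omega
    · omega
  | zero => rw [map_zero, map_zero]; exact Submodule.zero_mem _
  | add x y _ _ hx hy => rw [map_add, map_add]; exact Submodule.add_mem _ hx hy
  | smul t x _ hx =>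
    change PowerSeries.coeff k (D.H i ((t : R) * x)) ∈ _
    rw [map_mul, D.HB i t t.2, PowerSeries.coeff_C_mul]
    exact Submodule.smul_mem _ t hx

/-- The initial object. -/
noncomputable def initFD : FD D Finset.univ R where
  θ i hi :=
    { toFun := fun r k => PowerSeries.coeff k (D.H i r)
      map_add' := fun r s => by
        ext k
        change PowerSeries.coeff k (D.H i (r + s)) =
          PowerSeries.coeff k (D.H i r) + PowerSeries.coeff k (D.H i s)
        rw [map_add, map_add]
      map_smul' := fun r s => by
        ext k
        change PowerSeries.coeff k (D.H i (r * s)) =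
          conv (D.H i r) (fun k => PowerSeries.coeff k (D.H i s)) k
        rw [map_mul, PowerSeries.coeff_mul]
        rfl }
  θ0 i hi v := by
    change PowerSeries.coeff 0 (D.H i v) = v
    rw [PowerSeries.coeff_zero_eq_constantCoeff_apply, D.H0]
  F l := boxF D l
  mono l := boxF_mono D (by omega)
  exh := boxF_exh D
  xF j l v hv := by
    rw [add_comm]
    exact boxF_mul D (x_mem D j) hv
  θF i hi l k v hv := boxF_mono D (by omega) (boxF_coeff D i l k v hv)

lemma boxF_growth [IsNoetherianRing D.B] (P : Ideal R) [P.IsPrime] {V : Type u} [AddCommGroup V]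
    [Module R V] (g : R →ₗ[R] V) (w0 : D.B) (hw0 : (w0 : R) ∉ P) (k : ℕ) (hV : Kil D P w0 k V) :
    ∃ C : ℕ, ∀ l, ell (qB D P) ((boxF D l).map (g.restrictScalars D.B)) ≤
      (C * (l + 1) ^ (Finset.univ : Finset ι).card : ℕ) := by
  have hfin : ell (qB D P) (Submodule.span D.B {g 1}) ≠ ⊤ := by
    refine eL_fin (qB D P) k w0 hw0 ?_
    rintro r hr ⟨m, hm⟩
    exact Subtype.ext (hV r hr m)
  obtain ⟨C, hC⟩ := ENat.ne_top_iff_exists.1 hfin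
  refine ⟨C, fun l => ?_⟩
  have h1 : (boxF D l).map (g.restrictScalars D.B) ≤
      (Finset.univ : Finset (ι → Fin (l + 1))).sup (fun e => (Submodule.span D.B {g 1}).map
        ((LinearMap.lsmul R V (mon D (fun j => (e j : ℕ)))).restrictScalars D.B)) := by
    rw [boxF, Submodule.map_span, Submodule.span_le]
    rintro _ ⟨_, ⟨e, rfl⟩, rfl⟩
    refine (Finset.le_sup (f := fun e : ι → Fin (l + 1) => (Submodule.span D.B {g 1}).map
        ((LinearMap.lsmul R V (mon D (fun j => (e j : ℕ)))).restrictScalars D.B))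
        (Finset.mem_univ e)) ?_
    refine ⟨g 1, Submodule.mem_span_singleton_self _, ?_⟩
    change mon D _ • g 1 = g (mon D _)
    rw [← map_smul, smul_eq_mul, mul_one]
  refine (ell_mono _ h1).trans ((ell_sum _ _ _ C fun e _ => ?_).trans ?_)
  · rw [hC]
    exact ell_map_le _ _ _
  · rw [Finset.card_univ, Fintype.card_fun, Fintype.card_fin, Finset.card_univ, mul_comm]
    push_cast
    rfl
end init
end BassCech

namespace BassCech
set_option autoImplicit false
section pistep
set_option linter.unusedSectionVars false
set_option linter.unusedVariables false
variable {R : Type u} [CommRing R] {P : Ideal R} [P.IsPrime]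

lemma sq_pi {X : Type u} [AddCommGroup X] [Module R X] (Z B : Submodule R X)
    (f : R) (hf : f ∈ P)
    (h1 : GoodP P (SQ (Z ⊓ B.comap (LinearMap.lsmul R X f)) B))
    (h2 : GoodP P (SQ Z (B ⊔ Z.map (LinearMap.lsmul R X f)))) : GoodP P (SQ Z B) := by
  have hle : B.comap (Z ⊓ B.comap (LinearMap.lsmul R X f)).subtype ≤ (B.comap Z.subtype).comap
      (Submodule.inclusion (inf_le_left : Z ⊓ B.comap (LinearMap.lsmul R X f) ≤ Z)) :=
    fun x hx => hx
  refine GoodP.lemE f hf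
    (Submodule.mapQ (B.comap (Z ⊓ B.comap (LinearMap.lsmul R X f)).subtype) (B.comap Z.subtype)
      (Submodule.inclusion (inf_le_left : Z ⊓ B.comap (LinearMap.lsmul R X f) ≤ Z))
      hle)
    (Submodule.mapQ (B.comap Z.subtype)
      ((B ⊔ Z.map (LinearMap.lsmul R X f)).comap Z.subtype) LinearMap.id
      (by intro x hx; exact (le_sup_left : B ≤ B ⊔ Z.map (LinearMap.lsmul R X f)) hx)) ?_ ?_ ?_ ?_ h1 h2
  · rw [injective_iff_map_eq_zero]
    intro x hx
    obtain ⟨x, rfl⟩ := Submodule.mkQ_surjective _ x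
    rw [Submodule.mkQ_apply, Submodule.mapQ_apply, Submodule.Quotient.mk_eq_zero] at hx
    rw [Submodule.mkQ_apply, Submodule.Quotient.mk_eq_zero]
    exact hx
  · intro x
    obtain ⟨x, rfl⟩ := Submodule.mkQ_surjective _ x
    exact ⟨Submodule.Quotient.mk x, rfl⟩
  · intro x
    obtain ⟨x, rfl⟩ := Submodule.mkQ_surjective _ x
    rw [Submodule.mkQ_apply, ← Submodule.Quotient.mk_smul, Submodule.Quotient.mk_eq_zero]
    constructor
    · intro h
      exact ⟨Submodule.Quotient.mk ⟨x, x.2, h⟩, rfl⟩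
    · rintro ⟨y, hy⟩
      obtain ⟨y, rfl⟩ := Submodule.mkQ_surjective _ y
      rw [Submodule.mkQ_apply, Submodule.mapQ_apply, Submodule.Quotient.eq] at hy
      have h3 : f • (y : X) ∈ B := y.2.2
      have h4 : f • ((y : X) - x) ∈ B := B.smul_mem _ hy
      have := B.sub_mem h3 h4
      rw [smul_sub, sub_sub_cancel] at this
      exact this
  · intro x
    obtain ⟨x, rfl⟩ := Submodule.mkQ_surjective _ x
    rw [Submodule.mkQ_apply, Submodule.mapQ_apply, Submodule.Quotient.mk_eq_zero]
    constructor
    · intro h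
      obtain ⟨b, hb, _, ⟨z, hz, rfl⟩, h⟩ := Submodule.mem_sup.1 h
      refine ⟨Submodule.Quotient.mk ⟨z, hz⟩, ?_⟩
      rw [← Submodule.Quotient.mk_smul, Submodule.Quotient.eq]
      change f • z - (x : X) ∈ B
      have h' : b + f • z = (x : X) := h
      rw [← h', sub_add_cancel_right]
      exact B.neg_mem hb
    · rintro ⟨y, hy⟩
      obtain ⟨y, rfl⟩ := Submodule.mkQ_surjective _ y
      rw [Submodule.mkQ_apply, ← Submodule.Quotient.mk_smul, Submodule.Quotient.eq] at hy
      have h' : f • (y : X) - (x : X) ∈ B := hy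
      refine Submodule.mem_sup.2 ⟨(x : X) - f • (y : X), ?_, f • (y : X), ⟨y, y.2, rfl⟩, ?_⟩
      · rw [← neg_sub]
        exact B.neg_mem h'
      · change (x : X) - f • (y : X) + f • (y : X) = (x : X)
        rw [sub_add_cancel]

variable {M N : ModuleCat.{u} R} (g : M →ₗ[R] N) (f : R)

lemma K_inj (hinj : ∀ m : M, f • m = 0 → m = 0) (p : ℕ) (fs : List R) (x : K p fs M)
    (hx : f • x = 0) : x = 0 := by
  rw [← Kmap_smul] at hx
  have h1 : Function.Injective (f • LinearMap.id : M →ₗ[R] M) := by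
    rw [injective_iff_map_eq_zero]
    exact hinj
  exact (injective_iff_map_eq_zero _).1 (Kmap_inj p fs _ h1) x hx

lemma K_ex (hker : ∀ m : M, g m = 0 ↔ ∃ m', f • m' = m) (p : ℕ) (fs : List R) (x : K p fs M) :
    Kmap p fs g x = 0 ↔ ∃ y, f • y = x := by
  have h1 : Function.Exact (f • LinearMap.id : M →ₗ[R] M) g := fun m => hker m
  rw [Kmap_exact p fs _ g h1 x]
  constructor
  · rintro ⟨y, hy⟩
    exact ⟨y, by rw [← hy, Kmap_smul]⟩
  · rintro ⟨y, hy⟩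
    exact ⟨y, by rw [← hy, Kmap_smul]⟩

lemma mem_Zc (p : ℕ) (fs : List R) (M : ModuleCat.{u} R) (x : K p fs M) :
    x ∈ Zc p fs M ↔ d p fs M x = 0 := Iff.rfl

lemma mem_Bc (p : ℕ) (fs : List R) (M : ModuleCat.{u} R) (x : K (p + 1) fs M) :
    x ∈ Bc (p + 1) fs M ↔ ∃ y, d p fs M y = x := Iff.rfl

lemma mem_Bc0 (fs : List R) (M : ModuleCat.{u} R) (x : K 0 fs M) :
    x ∈ Bc 0 fs M ↔ x = 0 := Iff.rfl

lemma kerEquiv (hg : Function.Surjective g) (hinj : ∀ m : M, f • m = 0 → m = 0)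
    (hker : ∀ m : M, g m = 0 ↔ ∃ m', f • m' = m) (p : ℕ) (fs : List R) :
    Nonempty (SQ (Zc (p + 1) fs M ⊓ (Bc (p + 1) fs M).comap (LinearMap.lsmul R _ f))
      (Bc (p + 1) fs M) ≃ₗ[R] SQ (Zc p fs N) ((Zc p fs M).map (Kmap p fs g))) := by
  refine relEquiv _ _ _ _
    { carrier := {z | ∃ y, f • z.1 = d p fs M y ∧ Kmap p fs g y = z.2}
      add_mem' := by
        rintro ⟨a, b⟩ ⟨a', b'⟩ ⟨y, h1, h2⟩ ⟨y', h1', h2'⟩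
        refine ⟨y + y', ?_, ?_⟩
        · rw [map_add, ← h1, ← h1', ← smul_add]; rfl
        · rw [map_add, h2, h2']; rfl
      zero_mem' := ⟨0, by rw [map_zero]; exact smul_zero f, by rw [map_zero]; rfl⟩
      smul_mem' := by
        rintro r ⟨a, b⟩ ⟨y, h1, h2⟩
        refine ⟨r • y, ?_, ?_⟩
        · rw [map_smul, ← h1, smul_comm]; rfl
        · rw [map_smul, h2]; rfl } ?_ ?_ ?_
  · rintro z ⟨hz, y, hy⟩
    have hy' : d p fs M y = f • z := hy
    refine ⟨Kmap p fs g y, ?_, y, hy'.symm, rfl⟩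
    rw [mem_Zc, d_nat, hy']
    exact (K_ex g f hker _ _ _).2 ⟨z, rfl⟩
  · intro s hs
    obtain ⟨y, rfl⟩ := Kmap_surj p fs g hg s
    rw [mem_Zc, d_nat] at hs
    obtain ⟨z, hz⟩ := (K_ex g f hker _ _ _).1 hs
    refine ⟨z, ⟨?_, y, hz.symm⟩, y, hz, rfl⟩
    refine (mem_Zc _ _ _ _).2 (K_inj f hinj _ _ _ ?_)
    rw [← map_smul, hz, d_d]
  · rintro z ⟨hz, _⟩ s hs ⟨y, h1, h2⟩
    dsimp only at h1 h2
    rw [mem_Bc]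
    constructor
    · rintro ⟨y', rfl⟩
      refine ⟨y - f • y', ?_, ?_⟩
      · change _ ∈ Zc p fs M
        rw [mem_Zc, map_sub, map_smul, h1, sub_self]
      · rw [map_sub, h2, (K_ex g f hker _ _ _).2 ⟨y', rfl⟩, sub_zero]
    · rintro ⟨y', hy', h3⟩
      have hy'' : d p fs M y' = 0 := hy'
      obtain ⟨t, ht⟩ := (K_ex g f hker p fs (y - y')).1 (by rw [map_sub, h2, h3, sub_self])
      refine ⟨t, ?_⟩
      rw [← sub_eq_zero]
      refine K_inj f hinj _ _ _ ?_
      rw [smul_sub, ← map_smul, ht, map_sub, hy'', h1, sub_zero, sub_self]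

lemma cokerEquiv (hg : Function.Surjective g) (hinj : ∀ m : M, f • m = 0 → m = 0)
    (hker : ∀ m : M, g m = 0 ↔ ∃ m', f • m' = m) (p : ℕ) (fs : List R) :
    Nonempty (SQ (Zc p fs M) (Bc p fs M ⊔ (Zc p fs M).map (LinearMap.lsmul R _ f))
      ≃ₗ[R] SQ ((Zc p fs M).map (Kmap p fs g)) (Bc p fs N)) := by
  refine relEquiv _ _ _ _ (LinearMap.graph (Kmap p fs g)) ?_ ?_ ?_
  · intro z hz
    exact ⟨_, ⟨z, hz, rfl⟩, rfl⟩
  · rintro _ ⟨z, hz, rfl⟩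
    exact ⟨z, hz, rfl⟩
  · rintro z hz s _ hs
    obtain rfl : s = Kmap p fs g z := hs
    have aux : ∀ b : K p fs M, b ∈ Bc p fs M → Kmap p fs g (z - b) = 0 →
        z ∈ Bc p fs M ⊔ (Zc p fs M).map (LinearMap.lsmul R _ f) := by
      intro b hb hzb
      obtain ⟨t, ht⟩ := (K_ex g f hker _ _ _).1 hzb
      refine Submodule.mem_sup.2 ⟨b, hb, f • t, ⟨t, ?_, rfl⟩, ?_⟩
      · refine (mem_Zc _ _ _ _).2 (K_inj f hinj _ _ _ ?_)
        rw [← map_smul, ht]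
        exact (Zc p fs M).sub_mem hz (Bc_le p fs M hb)
      · rw [ht]
        exact add_sub_cancel b z
    constructor
    · intro h
      obtain ⟨b, hb, _, ⟨t, ht, rfl⟩, h⟩ := Submodule.mem_sup.1 h
      have h' : b + f • t = z := h
      rw [← h', map_add, (K_ex g f hker _ _ _).2 ⟨t, rfl⟩, add_zero]
      cases p with
      | zero =>
        rw [mem_Bc0] at hb ⊢
        rw [hb, map_zero]
      | succ p =>
        obtain ⟨y, rfl⟩ := hb
        rw [mem_Bc]
        exact ⟨Kmap p fs g y, d_nat _ _ _ _⟩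
    · intro h
      cases p with
      | zero =>
        rw [mem_Bc0] at h
        exact aux 0 (Submodule.zero_mem _) (by rw [sub_zero, h])
      | succ p =>
        rw [mem_Bc] at h
        obtain ⟨s, hs⟩ := h
        obtain ⟨y, rfl⟩ := Kmap_surj p fs g hg s
        rw [d_nat] at hs
        exact aux (d p fs M y) ⟨y, rfl⟩ (by rw [map_sub, hs, sub_self])

end pistep

section main
set_option linter.unusedSectionVars false
set_option linter.unusedVariables false
variable {R : Type u} [CommRing R] [IsNoetherianRing R] {ι : Type} [Fintype ι] [DecidableEq ι]
  {D : Dat R ι} {P : Ideal R} [P.IsPrime]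

lemma K_kil {w : D.B} {k : ℕ} {M : ModuleCat.{u} R} (h : Kil D P w k M) (p : ℕ) (fs : List R)
    {Z B : Submodule R (K p fs M)} : Kil D P w k (SQ Z B) := by
  intro r hr v
  obtain ⟨⟨v, hv⟩, rfl⟩ := Submodule.mkQ_surjective _ v
  rw [← map_smul]
  have h1 : ((w : R) * (r : R)) • v = 0 := by
    have h2 : ((w : R) * (r : R)) • (LinearMap.id : M →ₗ[R] M) = (0 : R) • LinearMap.id := by
      ext m
      rw [zero_smul]
      exact h r hr m
    rw [← Kmap_smul p fs, h2, Kmap_smul, zero_smul]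
  have h3 : ((w : R) * (r : R)) • (⟨v, hv⟩ : Z) = 0 := Subtype.ext h1
  rw [h3, map_zero]

theorem main_min [IsNoetherianRing D.B]
    (hAlg : ∀ i : ι, ∃ (G : R) (c0 : ℕ) (a b w : R),
      HAlg D P ((qB D P).map D.B.subtype) i G c0 a b w) (w0 : D.B)
    (hw0 : (w0 : R) ∉ P) (k : ℕ) (hk : Kil D P w0 k R) (i : ℕ) (fs : List R) :
    GoodP P (Hc i fs (ModuleCat.of R R)) := by
  have hG : (initFD D).Growth (qB D P) (Finset.univ : Finset ι).card := by
    obtain ⟨C, hC⟩ := boxF_growth D P LinearMap.id w0 hw0 k hk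
    refine ⟨C, fun l => ?_⟩
    have := hC l
    rw [show (LinearMap.id : R →ₗ[R] R).restrictScalars D.B = LinearMap.id from rfl,
      Submodule.map_id] at this
    exact this
  let S : FD D Finset.univ (ModuleCat.of R R) := initFD D
  obtain ⟨S', hS'⟩ := FD.sq (qB D P) (KFD_growth (qB D P) _ i fs S hG) (Zc_stable i fs S)
    (Bc_stable i fs S)
  exact devissage hAlg Finset.univ w0 hw0 k S' hS' (K_kil (M := ModuleCat.of R R) hk i fs)

theorem main_reg [IsNoetherianRing D.B]
    (hAlg : ∀ i : ι, ∃ (G : R) (c0 : ℕ) (a b w : R),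
      HAlg D P ((qB D P).map D.B.subtype) i G c0 a b w) (w0 : D.B)
    (hw0 : (w0 : R) ∉ P) (k : ℕ) (f : R) (hfB : f ∈ D.B) (hfP : f ∈ P)
    (hreg : ∀ r : R, f * r = 0 → r = 0)
    (hk : ∀ r ∈ (qB D P) ^ k, (w0 : R) * (r : R) ∈ Ideal.span {f}) (i : ℕ) (fs : List R) :
    GoodP P (Hc i fs (ModuleCat.of R R)) := by
  let U : Submodule R R := Ideal.span {f}
  let M : ModuleCat.{u} R := ModuleCat.of R R
  let N : ModuleCat.{u} R := ModuleCat.of R (R ⧸ U)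
  let g : M →ₗ[R] N := U.mkQ
  have hU : ∀ i (hi : i ∈ (Finset.univ : Finset ι)) u k, u ∈ U →
      (initFD D).θ i (Finset.Subset.refl _ hi) u k ∈ U := by
    intro i hi u k hu
    obtain ⟨t, rfl⟩ := Ideal.mem_span_singleton'.1 hu
    have h1 := (initFD D).θ_smul_const i hi f (D.HB i f hfB) t k
    rw [smul_eq_mul, mul_comm] at h1
    have h2 : f • (initFD D).θ i hi t k ∈ U :=
      Ideal.mul_mem_right _ _ (Ideal.mem_span_singleton_self f)
    exact h1 ▸ h2
  have hNk : Kil D P w0 k N := by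
    intro r hr v
    obtain ⟨v, rfl⟩ := U.mkQ_surjective v
    refine (Submodule.Quotient.mk_eq_zero U).2 ?_
    exact Ideal.mul_mem_right _ _ (hk r hr)
  let S : FD D Finset.univ M := initFD D
  let S' : FD D Finset.univ N := (initFD D).quot (Finset.Subset.refl _) U hU
  have hG : S'.Growth (qB D P) (Finset.univ : Finset ι).card :=
    boxF_growth D P g w0 hw0 k hNk
  have hlin : FD.Dlin S S' g := fun i hi v k => rfl
  have hsurj : Function.Surjective g := U.mkQ_surjective
  have hker : ∀ m : M, g m = 0 ↔ ∃ m', f • m' = m := by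
    intro m
    refine (Submodule.Quotient.mk_eq_zero U).trans ?_
    refine Ideal.mem_span_singleton'.trans ?_
    constructor
    · rintro ⟨a, ha⟩
      exact ⟨a, (mul_comm _ _).trans ha⟩
    · rintro ⟨a, ha⟩
      exact ⟨a, (mul_comm _ _).trans ha⟩
  have hst : ∀ p, (KFD p fs N S').Stable ((Zc p fs M).map (Kmap p fs g)) := fun p =>
    FD.Stable.map (Kmap_Dlin p fs S S' g hlin) _ (Zc_stable p fs S)
  refine sq_pi _ _ f hfP ?_ ?_
  · cases i with
    | zero =>
      refine GoodP.of_torsion ?_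
      intro v
      refine ⟨1, (Ideal.ne_top_iff_one P).1 Ideal.IsPrime.ne_top', ?_⟩
      obtain ⟨⟨v, hv, hv'⟩, rfl⟩ := Submodule.mkQ_surjective _ v
      rw [one_smul, Submodule.mkQ_apply, Submodule.Quotient.mk_eq_zero]
      have h1 : f • v = 0 := hv'
      exact K_inj (M := M) f hreg 0 fs v h1
    | succ p =>
      obtain ⟨e⟩ := kerEquiv g f hsurj hreg hker p fs
      obtain ⟨S'', hS''⟩ := FD.sq (qB D P) (KFD_growth (qB D P) _ p fs S' hG)
        (Zc_stable p fs S') (hst p)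
      exact GoodP.of_equiv e.symm (devissage hAlg Finset.univ w0 hw0 k S'' hS'' (K_kil hNk p fs))
  · obtain ⟨e⟩ := cokerEquiv g f hsurj hreg hker i fs
    obtain ⟨S'', hS''⟩ := FD.sq (qB D P) (KFD_growth (qB D P) _ i fs S' hG)
      (hst i) (Bc_stable i fs S')
    exact GoodP.of_equiv e.symm (devissage hAlg Finset.univ w0 hw0 k S'' hS'' (K_kil hNk i fs))
end main
end BassCech

namespace BassCech
set_option autoImplicit false
section poly
set_option linter.unusedSectionVars false
set_option linter.unusedVariables false
open Polynomial

lemma map_hasse {S T : Type u} [CommRing S] [CommRing T] (φ : S →+* T) (c : ℕ) (f : S[X]) :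
    (hasseDeriv c f).map φ = hasseDeriv c (f.map φ) := by
  ext n
  simp [hasseDeriv_coeff]

/-- The contraction of a prime and its residue domain. -/
theorem alg_poly {R : Type u} [CommRing R] (B : Subring R) (P : Ideal R) [P.IsPrime] (x : R)
    (g : B[X]) (hgP : aeval x g ∈ P) (hg : ∃ n, g.coeff n ∉ P.comap B.subtype) :
    ∃ (G a b : B[X]) (c0 : ℕ) (w : B), aeval x G ∈ P ∧ 1 ≤ c0 ∧ w ∉ P.comap B.subtype ∧
      (∀ c, 1 ≤ c → c < c0 → ∀ n, (hasseDeriv c G).coeff n ∈ P.comap B.subtype) ∧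
      ∀ n, (a * hasseDeriv c0 G + b * G - C w).coeff n ∈ P.comap B.subtype := by
  set q : Ideal B := P.comap B.subtype with hq
  let φ : (B ⧸ q) →+* (R ⧸ P) := Ideal.quotientMap P B.subtype le_rfl
  have hφ : Function.Injective φ := Ideal.quotientMap_injective
  let F := FractionRing (B ⧸ q)
  let κ := FractionRing (R ⧸ P)
  let ψ : F →+* κ := IsFractionRing.map hφ
  letI : Algebra F κ := ψ.toAlgebra
  let β : B →+* F := (algebraMap (B ⧸ q) F).comp (Ideal.Quotient.mk q)
  have hβ : ∀ r, β r = 0 ↔ r ∈ q := by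
    intro r
    change algebraMap (B ⧸ q) F (Ideal.Quotient.mk q r) = 0 ↔ _
    rw [FaithfulSMul.algebraMap_eq_zero_iff, Ideal.Quotient.eq_zero_iff_mem]
  let γ : R →+* κ := (algebraMap (R ⧸ P) κ).comp (Ideal.Quotient.mk P)
  have hγ : ∀ r, γ r = 0 ↔ r ∈ P := by
    intro r
    change algebraMap (R ⧸ P) κ (Ideal.Quotient.mk P r) = 0 ↔ _
    rw [FaithfulSMul.algebraMap_eq_zero_iff, Ideal.Quotient.eq_zero_iff_mem]
  have hcomp : ∀ r : B, algebraMap F κ (β r) = γ r := by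
    intro r
    change IsFractionRing.map hφ (algebraMap (B ⧸ q) F (Ideal.Quotient.mk q r)) = _
    exact IsLocalization.map_eq _ _
  have heval : ∀ f : B[X], aeval (γ x) (f.map β) = γ (aeval x f) := by
    intro f
    rw [aeval_def, eval₂_map, aeval_def, hom_eval₂]
    congr 1
    ext r
    exact hcomp r
  have hintegral : IsIntegral F (γ x) := by
    rw [← isAlgebraic_iff_isIntegral]
    refine ⟨g.map β, ?_, ?_⟩
    · obtain ⟨n, hn⟩ := hg
      intro h
      apply hn
      rw [← hβ, ← coeff_map, h, coeff_zero]
    · rw [heval, hγ]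
      exact hgP
  have hclear : ∀ f : F[X], ∃ (s : B) (f' : B[X]), s ∉ q ∧ f'.map β = C (β s) * f := by
    intro f
    obtain ⟨s, hs⟩ := IsLocalization.integerNormalization_map_to_map
      (nonZeroDivisors (B ⧸ q)) f
    obtain ⟨s', hs'⟩ := Ideal.Quotient.mk_surjective (s : B ⧸ q)
    obtain ⟨f', hf'⟩ := Polynomial.map_surjective (Ideal.Quotient.mk q)
      Ideal.Quotient.mk_surjective (IsLocalization.integerNormalization
      (nonZeroDivisors (B ⧸ q)) f)
    refine ⟨s', f', ?_, ?_⟩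
    · intro h
      rw [← Ideal.Quotient.eq_zero_iff_mem, hs'] at h
      exact nonZeroDivisors.ne_zero s.2 h
    · rw [← Polynomial.map_map, hf', hs, ← hs']
      ext n
      rw [coeff_smul, coeff_C_mul, Algebra.smul_def]
      rfl
  set μ := minpoly F (γ x) with hμ
  have hirr : Irreducible μ := minpoly.irreducible hintegral
  have hmonic : μ.Monic := minpoly.monic hintegral
  have hdeg : 0 < μ.natDegree := minpoly.natDegree_pos hintegral
  have hex : ∃ c, 1 ≤ c ∧ hasseDeriv c μ ≠ 0 := by
    refine ⟨μ.natDegree, hdeg, ?_⟩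
    rw [hasseDeriv_natDegree_eq_C, hmonic.leadingCoeff, C_1]
    exact one_ne_zero
  classical
  obtain ⟨hc1, hc2⟩ := Nat.find_spec hex
  have hc3 : ∀ c, 1 ≤ c → c < Nat.find hex → hasseDeriv c μ = 0 := by
    intro c h1 h2
    by_contra h3
    exact Nat.find_min hex h2 ⟨h1, h3⟩
  set c0 := Nat.find hex with hc0
  have hcop : IsCoprime μ (hasseDeriv c0 μ) := by
    rw [hirr.coprime_iff_not_dvd]
    intro hdvd
    have h1 := Polynomial.natDegree_le_of_dvd hdvd hc2
    have h2 := natDegree_hasseDeriv_le μ c0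
    omega
  obtain ⟨b', a', hab⟩ := hcop
  obtain ⟨s, G, hs, hG⟩ := hclear μ
  obtain ⟨s1, α, hs1, hα⟩ := hclear a'
  obtain ⟨s2, b, hs2, hb⟩ := hclear b'
  have hhas : ∀ c, (hasseDeriv c G).map β = C (β s) * hasseDeriv c μ := by
    intro c
    rw [map_hasse, hG, ← smul_eq_C_mul, map_smul, smul_eq_C_mul]
  refine ⟨G, C s2 * α, C s1 * b, c0, s * s1 * s2, ?_, hc1, ?_, ?_, ?_⟩
  · rw [← hγ, ← heval, hG, map_mul, minpoly.aeval, mul_zero]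
  · haveI : q.IsPrime := by rw [hq]; infer_instance
    intro h
    rcases Ideal.IsPrime.mem_or_mem ‹_› h with h | h
    · rcases Ideal.IsPrime.mem_or_mem ‹_› h with h | h
      · exact hs h
      · exact hs1 h
    · exact hs2 h
  · intro c h1 h2 n
    rw [← hβ, ← coeff_map, hhas, hc3 c h1 h2, mul_zero, coeff_zero]
  · intro n
    rw [← hβ, ← coeff_map]
    have : (C s2 * α * hasseDeriv c0 G + C s1 * b * G - C (s * s1 * s2)).map β = 0 := by
      simp only [Polynomial.map_sub, Polynomial.map_add, Polynomial.map_mul, Polynomial.map_C,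
        hhas, hG, hα, hb, map_mul]
      linear_combination (C (β s) * C (β s1) * C (β s2)) * hab
    rw [this, coeff_zero]

variable {R : Type u} [CommRing R] {ι : Type} (D : Dat R ι)

lemma coeff_H (i : ι) (c : ℕ) (f : D.B[X]) :
    PowerSeries.coeff c (D.H i (aeval (D.x i) f)) = aeval (D.x i) (hasseDeriv c f) := by
  induction f using Polynomial.induction_on' with
  | add p q hp hq => simp only [map_add, hp, hq]
  | monomial n b =>
    rw [hasseDeriv_monomial, aeval_monomial, aeval_monomial, map_mul, map_pow, D.Hxi]
    have h1 : algebraMap D.B R b = (b : R) := rfl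
    rw [h1, D.HB i b b.2, PowerSeries.coeff_C_mul, add_comm]
    have h2 : (PowerSeries.X + PowerSeries.C (D.x i)) ^ n =
        (((X + C (D.x i)) ^ n : R[X]) : PowerSeries R) := by push_cast; rfl
    rw [h2, Polynomial.coeff_coe, coeff_X_add_C_pow, map_mul, map_natCast, h1]
    ring

lemma H_other (i j : ι) (hij : i ≠ j) (f : D.B[X]) :
    D.H j (aeval (D.x i) f) = PowerSeries.C (aeval (D.x i) f) := by
  induction f using Polynomial.induction_on' with
  | add p q hp hq => simp only [map_add, hp, hq]
  | monomial n b =>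
    have h1 : algebraMap D.B R b = (b : R) := rfl
    rw [aeval_monomial, map_mul, map_pow, D.Hx j i hij, h1, D.HB j b b.2, map_mul, map_pow]

lemma aeval_mem_map (q : Ideal D.B) (x : R) (f : D.B[X]) (h : ∀ n, f.coeff n ∈ q) :
    aeval x f ∈ q.map D.B.subtype := by
  rw [aeval_eq_sum_range]
  refine Ideal.sum_mem _ fun n _ => ?_
  have h1 : f.coeff n • x ^ n = D.B.subtype (f.coeff n) * x ^ n := rfl
  rw [h1]
  exact Ideal.mul_mem_right _ _ (Ideal.mem_map_of_mem _ (h n))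

theorem hAlg_of (P : Ideal R) [P.IsPrime] (i : ι)
    (g : D.B[X]) (hgP : aeval (D.x i) g ∈ P) (hg : ∃ n, g.coeff n ∉ qB D P) :
    ∃ (G : R) (c0 : ℕ) (a b w : R), HAlg D P ((qB D P).map D.B.subtype) i G c0 a b w := by
  obtain ⟨G, a, b, c0, w, h1, h2, h3, h4, h5⟩ := alg_poly D.B P (D.x i) g hgP hg
  refine ⟨aeval (D.x i) G, c0, aeval (D.x i) a, aeval (D.x i) b, w, ?_⟩
  exact
    { GP := h1
      c0pos := h2
      wB := w.2
      wP := h3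
      low := fun c hc hc' => by
        rw [coeff_H]
        exact aeval_mem_map D _ _ _ (h4 c hc hc')
      eq := by
        rw [coeff_H]
        have := aeval_mem_map D _ (D.x i) _ h5
        rw [map_sub, map_add, map_mul, map_mul, aeval_C] at this
        exact this
      other := fun j hj => H_other D i j hj.symm G }
end poly
end BassCech

namespace BassCech

set_option autoImplicit false

section Assembly

open MvPolynomial

set_option linter.unusedSectionVars false
set_option linter.unusedVariables false

variable {A : Type u} [CommRing A] {n : ℕ}

/-- Translation in the variable `i`. -/
noncomputable def transH (i : Fin n) :
    MvPolynomial (Fin n) A →+* PowerSeries (MvPolynomial (Fin n) A) :=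
  eval₂Hom ((PowerSeries.C (R := MvPolynomial (Fin n) A)).comp C)
    (fun k => if k = i then PowerSeries.C (X k) + PowerSeries.X else PowerSeries.C (X k))

lemma transH_C (i : Fin n) (a : A) : transH i (C a) = PowerSeries.C (C a) := by
  simp [transH]

lemma transH_X_self (i : Fin n) :
    transH (A := A) i (X i) = PowerSeries.C (X i) + PowerSeries.X := by
  simp [transH]

lemma transH_X_ne (i k : Fin n) (h : k ≠ i) :
    transH (A := A) i (X k) = PowerSeries.C (X k) := by
  simp [transH, h]

lemma transH_zero (i : Fin n) (r : MvPolynomial (Fin n) A) :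
    PowerSeries.constantCoeff (transH i r) = r := by
  induction r using MvPolynomial.induction_on with
  | C a => simp [transH_C]
  | add p q hp hq => rw [map_add, map_add, hp, hq]
  | mul_X p k hp =>
    rw [map_mul, map_mul, hp]
    by_cases h : k = i
    · subst h
      simp [transH_X_self]
    · simp [transH_X_ne _ _ h]

lemma transH_supported (σ : Set (Fin n)) (i : Fin n) (hi : i ∉ σ)
    (b : MvPolynomial (Fin n) A) (hb : b ∈ supported A σ) :
    transH i b = PowerSeries.C b := by
  rw [supported_eq_adjoin_X] at hb
  induction hb using Algebra.adjoin_induction with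
  | mem x hx =>
    obtain ⟨k, hk, rfl⟩ := hx
    exact transH_X_ne _ _ (fun h => hi (h ▸ hk))
  | algebraMap r => exact transH_C i r
  | add x y _ _ hx hy => rw [map_add, map_add, hx, hy]
  | mul x y _ _ hx hy => rw [map_mul, map_mul, hx, hy]

/-- The translation datum of a polynomial ring. -/
noncomputable def polyDat (A : Type u) [CommRing A] (n : ℕ) (σ : Finset (Fin n)) :
    Dat (MvPolynomial (Fin n) A) {j : Fin n // j ∉ σ} where
  B := (supported A (σ : Set (Fin n))).toSubring
  x j := X j.1
  H i := transH i.1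
  H0 i r := transH_zero i.1 r
  HB i b hb := transH_supported _ i.1 (fun h => i.2 (Finset.mem_coe.1 h)) b hb
  Hx i j hj := transH_X_ne _ _ (fun h => hj (Subtype.ext h))
  Hxi i := transH_X_self _
  gen p hB hx hadd hmul r := by
    induction r using MvPolynomial.induction_on with
    | C a => exact hB _ ((supported A (σ : Set (Fin n))).algebraMap_mem a)
    | add p q hp hq => exact hadd _ _ hp hq
    | mul_X p k hp =>
      refine hmul _ _ hp ?_
      by_cases h : k ∈ σ
      · exact hB _ (Algebra.subset_adjoin ⟨k, h, rfl⟩)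
      · exact hx ⟨k, h⟩

lemma polyDat_C_mem (σ : Finset (Fin n)) (a : A) : C a ∈ (polyDat A n σ).B :=
  (supported A (σ : Set (Fin n))).algebraMap_mem a

lemma polyDat_noeth [IsNoetherianRing A] (σ : Finset (Fin n)) :
    IsNoetherianRing (polyDat A n σ).B := by
  have : IsNoetherianRing (MvPolynomial (σ : Set (Fin n)) A) := inferInstance
  exact isNoetherianRing_of_ringEquiv _
    (supportedEquivMvPolynomial (R := A) (σ : Set (Fin n))).symm.toRingEquiv

lemma polyDat_poly (σ : Finset (Fin n)) (i : Fin n)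
    (g : MvPolynomial (Fin n) A) (hg : g ∈ supported A (insert i (σ : Set (Fin n)))) :
    ∃ f : Polynomial (polyDat A n σ).B, Polynomial.aeval (X i : MvPolynomial (Fin n) A) f = g := by
  rw [supported_eq_adjoin_X] at hg
  induction hg using Algebra.adjoin_induction with
  | mem x hx =>
    obtain ⟨k, hk, rfl⟩ := hx
    rcases hk with rfl | hk
    · exact ⟨Polynomial.X, by simp⟩
    · refine ⟨Polynomial.C ⟨X k, Algebra.subset_adjoin ⟨k, hk, rfl⟩⟩, ?_⟩
      rw [Polynomial.aeval_C]
      rfl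
  | algebraMap r =>
    refine ⟨Polynomial.C ⟨C r, polyDat_C_mem σ r⟩, ?_⟩
    rw [Polynomial.aeval_C]
    rfl
  | add x y _ _ hx hy =>
    obtain ⟨f, hf⟩ := hx
    obtain ⟨g, hg⟩ := hy
    exact ⟨f + g, by rw [map_add, hf, hg]⟩
  | mul x y _ _ hx hy =>
    obtain ⟨f, hf⟩ := hx
    obtain ⟨g, hg⟩ := hy
    exact ⟨f * g, by rw [map_mul, hf, hg]⟩

/-- The defining property of an independent set of variables modulo `P`. -/
def IndepVars (P : Ideal (MvPolynomial (Fin n) A)) (σ : Finset (Fin n)) : Prop :=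
  ∀ b ∈ supported A (σ : Set (Fin n)), b ∈ P → b ∈ (P.comap C).map C

lemma exists_max_indep (P : Ideal (MvPolynomial (Fin n) A)) :
    ∃ σ, IndepVars P σ ∧ ∀ i ∉ σ, ¬ IndepVars P (insert i σ) := by
  classical
  let S : Finset (Finset (Fin n)) := Finset.univ.filter (IndepVars P)
  have hS : S.Nonempty := by
    refine ⟨∅, Finset.mem_filter.2 ⟨Finset.mem_univ _, ?_⟩⟩
    intro b hb hbP
    rw [Finset.coe_empty, supported_empty] at hb
    obtain ⟨a, rfl⟩ := Algebra.mem_bot.1 hb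
    exact Ideal.mem_map_of_mem C hbP
  obtain ⟨σ, hσ, hmax⟩ := S.exists_max_image Finset.card hS
  refine ⟨σ, (Finset.mem_filter.1 hσ).2, fun i hi h => ?_⟩
  have h1 := hmax (insert i σ) (Finset.mem_filter.2 ⟨Finset.mem_univ _, h⟩)
  rw [Finset.card_insert_of_notMem hi] at h1
  omega

lemma qB_map_le (P : Ideal (MvPolynomial (Fin n) A)) {σ : Finset (Fin n)}
    (hσ : IndepVars P σ) :
    (qB (polyDat A n σ) P).map (polyDat A n σ).B.subtype ≤ (P.comap C).map C := by
  rw [Ideal.map_le_iff_le_comap]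
  intro b hb
  exact hσ b.1 b.2 hb

lemma qB_pow (P : Ideal (MvPolynomial (Fin n) A)) {σ : Finset (Fin n)}
    (hσ : IndepVars P σ) (k : ℕ) (r : (polyDat A n σ).B)
    (hr : r ∈ (qB (polyDat A n σ) P) ^ k) :
    (r : MvPolynomial (Fin n) A) ∈ ((P.comap C) ^ k).map C := by
  rw [Ideal.map_pow]
  refine Ideal.pow_right_mono (qB_map_le P hσ) k ?_
  rw [← Ideal.map_pow]
  exact Ideal.mem_map_of_mem (polyDat A n σ).B.subtype hr

lemma polyDat_hAlg (P : Ideal (MvPolynomial (Fin n) A)) [P.IsPrime] {σ : Finset (Fin n)}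
    (hσ : IndepVars P σ) (hmax : ∀ i ∉ σ, ¬ IndepVars P (insert i σ))
    (i : {j : Fin n // j ∉ σ}) :
    ∃ (G : MvPolynomial (Fin n) A) (c0 : ℕ) (a b w : MvPolynomial (Fin n) A),
      HAlg (polyDat A n σ) P ((qB (polyDat A n σ) P).map (polyDat A n σ).B.subtype)
        i G c0 a b w := by
  have h1 := hmax i.1 i.2
  unfold IndepVars at h1
  push Not at h1
  obtain ⟨g, hg, hgP, hgn⟩ := h1
  rw [Finset.coe_insert] at hg
  obtain ⟨f, rfl⟩ := polyDat_poly σ i.1 g hg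
  refine hAlg_of (polyDat A n σ) P i f hgP ?_
  by_contra hcon
  push Not at hcon
  exact hgn (qB_map_le P hσ (aeval_mem_map (polyDat A n σ) _ _ f hcon))

lemma min_uniform [IsNoetherianRing A] (p : Ideal A) [p.IsPrime] (hp : p ∈ minimalPrimes A) :
    ∃ w ∉ p, ∃ k : ℕ, ∀ r ∈ p ^ k, w * r = 0 := by
  classical
  have h1 := IsLocalization.AtPrime.radical_map_of_mem_minimalPrimes
    (Localization.AtPrime p) p ⊥ hp
  rw [Ideal.map_bot] at h1
  obtain ⟨k, hk⟩ := Ideal.exists_pow_le_of_le_radical_of_fg h1.ge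
    (IsNoetherian.noetherian _)
  have h2 : ∀ r ∈ p ^ k, ∃ w ∉ p, w * r = 0 := by
    intro r hr
    have h3 : algebraMap A (Localization.AtPrime p) r = 0 := by
      rw [← Ideal.map_pow] at hk
      exact hk (Ideal.mem_map_of_mem _ hr)
    obtain ⟨m, hm⟩ := (IsLocalization.map_eq_zero_iff p.primeCompl _ r).1 h3
    exact ⟨m.1, m.2, hm⟩
  obtain ⟨s, hs⟩ := (IsNoetherian.noetherian (p ^ k) : (p ^ k).FG)
  have h3 : ∀ r : A, ∃ w ∉ p, r ∈ s → w * r = 0 := by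
    intro r
    by_cases hr : r ∈ s
    · obtain ⟨w, hw, hw'⟩ := h2 r (hs ▸ Submodule.subset_span hr)
      exact ⟨w, hw, fun _ => hw'⟩
    · exact ⟨1, fun h => (Ideal.IsPrime.ne_top ‹_›) ((Ideal.eq_top_iff_one p).2 h),
        fun h => absurd h hr⟩
  choose w hw hw' using h3
  refine ⟨∏ r ∈ s, w r, ?_, k, ?_⟩
  · intro h
    obtain ⟨r, _, hr⟩ := (Ideal.IsPrime.prod_mem_iff (p := p)).1 h
    exact hw r hr
  · intro r hr
    rw [← hs] at hr
    induction hr using Submodule.span_induction with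
    | mem x hx =>
      rw [← Finset.mul_prod_erase s w hx]
      rw [mul_right_comm, hw' x hx, zero_mul]
    | zero => rw [mul_zero]
    | add x y _ _ hx hy => rw [mul_add, hx, hy, add_zero]
    | smul a x _ hx => rw [smul_eq_mul, mul_left_comm, hx, mul_zero]

lemma cm_elem [IsNoetherianRing A] [IsLocalRing A]
    (hCM : IsCohenMacaulayLocalRing A) (hA : ringKrullDim A = 1) :
    ∃ π ∈ IsLocalRing.maximalIdeal A, (∀ a, π * a = 0 → a = 0) ∧
      ∃ k : ℕ, (IsLocalRing.maximalIdeal A) ^ k ≤ Ideal.span {π} := by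
  obtain ⟨rs, h1, h2, h3⟩ := hCM
  rw [hA] at h3
  have h4 : rs.length = 1 := by exact_mod_cast h3
  obtain ⟨π, rfl⟩ := List.length_eq_one_iff.1 h4
  have hreg : IsSMulRegular A π := ((RingTheory.Sequence.isRegular_cons_iff A π []).1 h2).1
  have hdim : Ring.KrullDimLE 1 A := Ring.krullDimLE_iff.2 (by rw [hA]; rfl)
  rw [Ring.krullDimLE_one_iff] at hdim
  refine ⟨π, h1 π (by simp), fun a ha => ?_, ?_⟩
  · apply hreg
    simpa using ha
  · refine Ideal.exists_pow_le_of_le_radical_of_fg ?_ (IsNoetherian.noetherian _)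
    rw [Ideal.radical_eq_sInf]
    refine le_sInf fun J hJ => ?_
    obtain ⟨hJ1, hJ2⟩ := hJ
    rcases hdim J hJ2 with h | h
    · exfalso
      refine hreg.notMem_of_mem_minimalPrimes (p := J) ?_
        (hJ1 (Ideal.mem_span_singleton_self π))
      rw [(Module.annihilator_eq_bot (R := A) (M := A)).2 inferInstance]
      exact h
    · rw [IsLocalRing.eq_maximalIdeal h]

theorem hc_good [IsNoetherianRing A] [IsLocalRing A]
    (hCM : IsCohenMacaulayLocalRing A) (hA : ringKrullDim A = 1)
    (P : Ideal (MvPolynomial (Fin n) A)) [P.IsPrime] (i : ℕ)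
    (fs : List (MvPolynomial (Fin n) A)) :
    GoodP P (Hc i fs (ModuleCat.of _ (MvPolynomial (Fin n) A))) := by
  classical
  obtain ⟨σ, hσ, hmax⟩ := exists_max_indep P
  have := polyDat_noeth (A := A) σ
  have hAlg := polyDat_hAlg P hσ hmax
  have hdim : Ring.KrullDimLE 1 A := Ring.krullDimLE_iff.2 (by rw [hA]; rfl)
  rw [Ring.krullDimLE_one_iff] at hdim
  rcases hdim (P.comap C) inferInstance with h | h
  · obtain ⟨w, hw, k, hk⟩ := min_uniform (P.comap C) h
    refine main_min (D := polyDat A n σ) hAlg ⟨C w, polyDat_C_mem σ w⟩ hw k ?_ i fs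
    intro r hr v
    have h1 := qB_pow P hσ k r hr
    rw [mem_map_C_iff] at h1
    have h2 : (C w : MvPolynomial (Fin n) A) * (r : MvPolynomial (Fin n) A) = 0 := by
      ext m
      rw [coeff_C_mul, hk _ (h1 m), coeff_zero]
    change ((C w : MvPolynomial (Fin n) A) * (r : MvPolynomial (Fin n) A)) • v = 0
    rw [h2, zero_smul]
  · obtain ⟨π, hπ, hreg, k, hk⟩ := cm_elem hCM hA
    have hm := IsLocalRing.eq_maximalIdeal h
    have h1P : (((1 : (polyDat A n σ).B)) : MvPolynomial (Fin n) A) ∉ P := fun h =>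
      (Ideal.IsPrime.ne_top ‹P.IsPrime›) ((Ideal.eq_top_iff_one P).2 h)
    refine main_reg (D := polyDat A n σ) hAlg 1 h1P k (C π) (polyDat_C_mem σ π)
      ?_ ?_ ?_ i fs
    · rw [← hm] at hπ
      exact hπ
    · intro r hr
      ext m
      rw [coeff_zero]
      apply hreg
      rw [← coeff_C_mul, hr, coeff_zero]
    · intro r hr
      have h1 := qB_pow P hσ k r hr
      rw [hm] at h1
      have h2 := Ideal.map_mono (f := C) hk h1
      rw [Ideal.map_span, Set.image_singleton] at h2
      rw [OneMemClass.coe_one, one_mul]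
      exact h2

end Assembly

end BassCech

theorem bassNumbers_localCohomology_finite_of_CM_local_dim_one_polynomial
    (A : Type u) [CommRing A] [IsNoetherianRing A] [IsLocalRing A]
    (hCM : IsCohenMacaulayLocalRing A) (hA : ringKrullDim A = 1)
    (n : ℕ) (I : Ideal (MvPolynomial (Fin n) A)) (i : ℕ)
    (P : Ideal (MvPolynomial (Fin n) A)) [P.IsPrime] (j : ℕ) :
    Module.Finite (Localization.AtPrime P)
      (bassExtModule _ P j
        ((localCohomology I i).obj (ModuleCat.of _ (MvPolynomial (Fin n) A)))) := by
  classical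
  obtain ⟨s, rfl⟩ : I.FG := IsNoetherian.noetherian I
  have hs : ({f | f ∈ s.toList} : Set (MvPolynomial (Fin n) A)) = (s : Set _) := by
    ext f
    simp
  obtain ⟨e⟩ := BassCech.cech_lc s.toList i (ModuleCat.of _ (MvPolynomial (Fin n) A))
  rw [hs] at e
  exact ((BassCech.hc_good hCM hA P i s.toList).of_equiv e).bass j
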